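/- Let F be an algebraically closed field of characteristic zero and n ≥ 2. Then the Jordan superalgebra P(n) cannot be written as A + B for two proper nontrivial simple subsuperalgebras A and B. -/

import Mathlib

open Matrix

namespace SJ

section SuperDefs

variable {F : Type*} [Field F] {J : Type*} [AddCommGroup J] [Module F J]

/-- A graded subspace: `A = (A ∩ J₀) ⊕ (A ∩ J₁)`. -/
def IsGradedG (ev od : Submodule F J) (A : Submodule F J) : Prop :=
  A = (A ⊓ ev) ⊔ (A ⊓ od)

/-- A subsuperalgebra: a graded subspace closed under the product. -/
def IsSubalgG (mul : J → J → J) (ev od : Submodule F J) (A : Submodule F J) : Prop :=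
  IsGradedG ev od A ∧ ∀ x ∈ A, ∀ y ∈ A, mul x y ∈ A

/-- Nontrivial: `A ∩ J₁ ≠ {0}`. -/
def NontrivG (od : Submodule F J) (A : Submodule F J) : Prop := A ⊓ od ≠ ⊥

/-- Simple: `A∘A ≠ 0` and the only graded subspaces `I ⊆ A` with `A∘I ⊆ I` are `0` and `A`. -/
def IsSimpleG (mul : J → J → J) (ev od : Submodule F J) (A : Submodule F J) : Prop :=
  (∃ x ∈ A, ∃ y ∈ A, mul x y ≠ 0) ∧
  ∀ I : Submodule F J, I ≤ A → IsGradedG ev od I →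
    (∀ x ∈ A, ∀ y ∈ I, mul x y ∈ I) → I = ⊥ ∨ I = A

/-- An isomorphism of superalgebras: an F-linear bijection mapping even part onto even
part, odd part onto odd part, and preserving the product. -/
def SuperIsoG {J₂ : Type*} [AddCommGroup J₂] [Module F J₂]
    (mul₁ : J → J → J) (ev₁ od₁ : Submodule F J)
    (mul₂ : J₂ → J₂ → J₂) (ev₂ od₂ : Submodule F J₂)
    (A : Submodule F J) (B : Submodule F J₂) : Prop :=
  ∃ e : A ≃ₗ[F] B,
    (∀ x : A, (x : J) ∈ ev₁ ↔ (e x : J₂) ∈ ev₂) ∧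
    (∀ x : A, (x : J) ∈ od₁ ↔ (e x : J₂) ∈ od₂) ∧
    ∀ x y z : A, mul₁ x y = (z : J) → mul₂ (e x) (e y) = (e z : J₂)

end SuperDefs

/-- The space of (n+m)×(n+m) matrices, indices split into even (`inl`) and odd (`inr`) ones. -/
abbrev MJ (F : Type*) [Field F] (n m : ℕ) :=
  Matrix (Fin n ⊕ Fin m) (Fin n ⊕ Fin m) F

/-- Parity of an index. -/
def pty {n m : ℕ} : Fin n ⊕ Fin m → Bool := Sum.elim (fun _ => false) (fun _ => true)

variable (F : Type*) [Field F]

/-- The odd component of a matrix (block-antidiagonal part). -/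
def oddPart {n m : ℕ} (X : MJ F n m) : MJ F n m :=
  Matrix.of fun i j => if pty i = pty j then 0 else X i j

/-- The even component of a matrix (block-diagonal part). -/
def evenPart {n m : ℕ} (X : MJ F n m) : MJ F n m :=
  Matrix.of fun i j => if pty i = pty j then X i j else 0

variable {F}

/-- The super-Jordan product on `M_{n,m}(F)^{(+)}`:  `x∘y = (xy+yx)/2` when `x` or `y` is
even and `x∘y = (xy−yx)/2` when both are odd, extended bilinearly.  (For arbitrary
matrices this bilinear extension equals `(xy+yx)/2 − y₁x₁` where `x₁, y₁` are the odd
components.) -/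
def jmul {n m : ℕ} (X Y : MJ F n m) : MJ F n m :=
  (2 : F)⁻¹ • (X * Y + Y * X) - oddPart F Y * oddPart F X

variable (F)

/-- The even part `J₀` of `M_{n,m}(F)^{(+)}`: block-diagonal matrices. -/
def evenSub (n m : ℕ) : Submodule F (MJ F n m) where
  carrier := {X | ∀ i j, pty i ≠ pty j → X i j = 0}
  zero_mem' := by intro i j _; simp
  add_mem' := by
    intro a b ha hb i j h
    simp only [Matrix.add_apply, ha i j h, hb i j h, add_zero]
  smul_mem' := by
    intro c a ha i j h
    simp only [Matrix.smul_apply, ha i j h, smul_zero]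

/-- The odd part `J₁` of `M_{n,m}(F)^{(+)}`: block-antidiagonal matrices. -/
def oddSub (n m : ℕ) : Submodule F (MJ F n m) where
  carrier := {X | ∀ i j, pty i = pty j → X i j = 0}
  zero_mem' := by intro i j _; simp
  add_mem' := by
    intro a b ha hb i j h
    simp only [Matrix.add_apply, ha i j h, hb i j h, add_zero]
  smul_mem' := by
    intro c a ha i j h
    simp only [Matrix.smul_apply, ha i j h, smul_zero]

/-- Statements about `M_{n,m}(F)^{(+)}` specialized from the generic definitions. -/
abbrev IsGraded {n m : ℕ} (A : Submodule F (MJ F n m)) : Prop :=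
  IsGradedG (evenSub F n m) (oddSub F n m) A

abbrev IsSubalg {n m : ℕ} (A : Submodule F (MJ F n m)) : Prop :=
  IsSubalgG jmul (evenSub F n m) (oddSub F n m) A

abbrev Nontriv {n m : ℕ} (A : Submodule F (MJ F n m)) : Prop :=
  NontrivG (oddSub F n m) A

abbrev IsSimple {n m : ℕ} (A : Submodule F (MJ F n m)) : Prop :=
  IsSimpleG jmul (evenSub F n m) (oddSub F n m) A

abbrev SuperIso {n₁ m₁ n₂ m₂ : ℕ}
    (A : Submodule F (MJ F n₁ m₁)) (B : Submodule F (MJ F n₂ m₂)) : Prop :=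
  SuperIsoG jmul (evenSub F n₁ m₁) (oddSub F n₁ m₁)
    jmul (evenSub F n₂ m₂) (oddSub F n₂ m₂) A B

/-- The standard symplectic matrix `S = [[0, I_q],[−I_q, 0]]` of size `2q`. -/
def SMat (q : ℕ) : Matrix (Fin (2 * q)) (Fin (2 * q)) F :=
  Matrix.of fun i j =>
    if (j : ℕ) = (i : ℕ) + q then (1 : F) else if (i : ℕ) = (j : ℕ) + q then -1 else 0

/-- `osp(p,q)`: block matrices `[[A, C],[S⁻¹Cᵀ, D]]` inside `M_{p,2q}(F)^{(+)}` with
`A` symmetric, `C` arbitrary and `Dᵀ S = S D`.  The condition on the lower-left block is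
recorded in the equivalent form `S · C₂₁ = C₁₂ᵀ`. -/
def ospSub (p q : ℕ) : Submodule F (MJ F p (2 * q)) where
  carrier := {X | (X.toBlocks₁₁)ᵀ = X.toBlocks₁₁ ∧
    SMat F q * X.toBlocks₂₁ = (X.toBlocks₁₂)ᵀ ∧
    (X.toBlocks₂₂)ᵀ * SMat F q = SMat F q * X.toBlocks₂₂}
  zero_mem' := by
    refine ⟨?_, ?_, ?_⟩ <;> ext i j <;>
      simp [Matrix.toBlocks₁₁, Matrix.toBlocks₁₂, Matrix.toBlocks₂₁, Matrix.toBlocks₂₂,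
        Matrix.mul_apply]
  add_mem' := by
    rintro a b ⟨ha1, ha2, ha3⟩ ⟨hb1, hb2, hb3⟩
    have e11 : (a + b).toBlocks₁₁ = a.toBlocks₁₁ + b.toBlocks₁₁ := rfl
    have e12 : (a + b).toBlocks₁₂ = a.toBlocks₁₂ + b.toBlocks₁₂ := rfl
    have e21 : (a + b).toBlocks₂₁ = a.toBlocks₂₁ + b.toBlocks₂₁ := rfl
    have e22 : (a + b).toBlocks₂₂ = a.toBlocks₂₂ + b.toBlocks₂₂ := rfl
    refine ⟨?_, ?_, ?_⟩
    · rw [e11, Matrix.transpose_add, ha1, hb1]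
    · rw [e21, e12, Matrix.mul_add, Matrix.transpose_add, ha2, hb2]
    · rw [e22, Matrix.transpose_add, Matrix.add_mul, Matrix.mul_add, ha3, hb3]
  smul_mem' := by
    rintro c a ⟨ha1, ha2, ha3⟩
    have e11 : (c • a).toBlocks₁₁ = c • a.toBlocks₁₁ := rfl
    have e12 : (c • a).toBlocks₁₂ = c • a.toBlocks₁₂ := rfl
    have e21 : (c • a).toBlocks₂₁ = c • a.toBlocks₂₁ := rfl
    have e22 : (c • a).toBlocks₂₂ = c • a.toBlocks₂₂ := rfl
    refine ⟨?_, ?_, ?_⟩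
    · rw [e11, Matrix.transpose_smul, ha1]
    · rw [e21, e12, Matrix.mul_smul, Matrix.transpose_smul, ha2]
    · rw [e22, Matrix.transpose_smul, Matrix.smul_mul, Matrix.mul_smul, ha3]

/-- `Q(n)`: matrices `[[A, B],[B, A]]` inside `M_{n,n}(F)^{(+)}`. -/
def QSub (n : ℕ) : Submodule F (MJ F n n) where
  carrier := {X | (∀ i j, X (Sum.inr i) (Sum.inr j) = X (Sum.inl i) (Sum.inl j)) ∧
    (∀ i j, X (Sum.inr i) (Sum.inl j) = X (Sum.inl i) (Sum.inr j))}
  zero_mem' := by constructor <;> intro i j <;> simp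
  add_mem' := by
    rintro a b ⟨ha1, ha2⟩ ⟨hb1, hb2⟩
    constructor <;> intro i j <;>
      simp only [Matrix.add_apply, ha1 i j, ha2 i j, hb1 i j, hb2 i j]
  smul_mem' := by
    rintro c a ⟨ha1, ha2⟩
    constructor <;> intro i j <;>
      simp only [Matrix.smul_apply, ha1 i j, ha2 i j]

/-- `P(n)`: matrices `[[A, B],[C, Aᵀ]]` with `B` symmetric and `C` skew-symmetric,
inside `M_{n,n}(F)^{(+)}`. -/
def PSub (n : ℕ) : Submodule F (MJ F n n) where
  carrier := {X | (∀ i j, X (Sum.inr i) (Sum.inr j) = X (Sum.inl j) (Sum.inl i)) ∧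
    (∀ i j, X (Sum.inl i) (Sum.inr j) = X (Sum.inl j) (Sum.inr i)) ∧
    (∀ i j, X (Sum.inr i) (Sum.inl j) = - X (Sum.inr j) (Sum.inl i))}
  zero_mem' := by refine ⟨?_, ?_, ?_⟩ <;> intro i j <;> simp
  add_mem' := by
    rintro a b ⟨ha1, ha2, ha3⟩ ⟨hb1, hb2, hb3⟩
    refine ⟨?_, ?_, ?_⟩ <;> intro i j <;>
      simp only [Matrix.add_apply, ha1 i j, ha2 i j, ha3 i j, hb1 i j, hb2 i j, hb3 i j] <;>
      ring
  smul_mem' := by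
    rintro c a ⟨ha1, ha2, ha3⟩
    refine ⟨?_, ?_, ?_⟩ <;> intro i j <;>
      simp only [Matrix.smul_apply, ha1 i j, ha2 i j, ha3 i j, smul_neg]


theorem fitting_idem {K : Type*} [Field K] {n : ℕ} (a : Matrix (Fin n) (Fin n) K)
    (ha : ¬ IsNilpotent a) :
    ∃ p : Polynomial K, IsIdempotentElem (a * (a * Polynomial.aeval a p)) ∧
      a * (a * Polynomial.aeval a p) ≠ 0 := by
  have hint : IsIntegral K a := Algebra.IsIntegral.isIntegral a
  have hm0 : minpoly K a ≠ 0 := minpoly.ne_zero hint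
  obtain ⟨g, hg, hg0⟩ := Polynomial.exists_eq_pow_rootMultiplicity_mul_and_not_dvd (minpoly K a) hm0 0
  set m := Polynomial.rootMultiplicity 0 (minpoly K a)
  rw [Polynomial.C_0, sub_zero] at hg hg0
  have hcop : IsCoprime (Polynomial.X ^ (m + 2)) g := by
    apply IsCoprime.pow_left
    exact (Polynomial.irreducible_X.coprime_iff_not_dvd).2 hg0
  obtain ⟨u, v, huv⟩ := hcop
  have h0 : a ^ (m + 2) * Polynomial.aeval a g = 0 := by
    have : Polynomial.aeval a (Polynomial.X ^ 2 * minpoly K a) = 0 := by simp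
    rw [hg, ← mul_assoc, ← pow_add, add_comm 2 m] at this
    simpa using this
  have h1 : Polynomial.aeval a u * a ^ (m + 2) + Polynomial.aeval a v * Polynomial.aeval a g = 1 := by
    have := congrArg (Polynomial.aeval a) huv
    simpa using this
  have key : a * (a * Polynomial.aeval a (Polynomial.X ^ m * u)) = Polynomial.aeval a u * a ^ (m + 2) := by
    have h : (Polynomial.X * (Polynomial.X * (Polynomial.X ^ m * u)) : Polynomial K)
      = u * Polynomial.X ^ (m + 2) := by ring
    have := congrArg (Polynomial.aeval a) h
    rw [map_mul, map_mul, map_mul _ u, map_pow, Polynomial.aeval_X] at this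
    exact this
  have hc : Commute (a ^ (m + 2)) (Polynomial.aeval a v) := by
    have h : a ^ (m + 2) = Polynomial.aeval a (Polynomial.X ^ (m + 2) : Polynomial K) := by
      rw [map_pow, Polynomial.aeval_X]
    rw [h]
    exact (Commute.all (Polynomial.X ^ (m + 2)) v).map (Polynomial.aeval a)
  refine ⟨Polynomial.X ^ m * u, ?_, ?_⟩
  · rw [key]
    set e := Polynomial.aeval a u * a ^ (m + 2) with he
    have : e * (Polynomial.aeval a v * Polynomial.aeval a g) = 0 := by
      rw [he, mul_assoc, ← mul_assoc (a ^ (m+2)), hc.eq, mul_assoc, h0]; simp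
    have h2 : e * (e + Polynomial.aeval a v * Polynomial.aeval a g) = e := by rw [h1, mul_one]
    rw [mul_add, this, add_zero] at h2
    exact h2
  · rw [key]
    intro hz
    apply ha
    refine ⟨m + 2, ?_⟩
    rw [hz, zero_add] at h1
    calc a ^ (m + 2) = a ^ (m+2) * (Polynomial.aeval a v * Polynomial.aeval a g) := by rw [h1, mul_one]
      _ = 0 := by rw [← mul_assoc, hc.eq, mul_assoc, h0, mul_zero]

theorem trace_idem_ne {K : Type*} [Field K] [CharZero K] {n : ℕ} (e : Matrix (Fin n) (Fin n) K)
    (he : IsIdempotentElem e) (h0 : e ≠ 0) : e.trace ≠ 0 := by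
  have h1 : IsIdempotentElem (Matrix.toLin' e) := by
    unfold IsIdempotentElem at *
    rw [Module.End.mul_eq_comp, ← Matrix.toLin'_mul, he]
  have := (LinearMap.isProj_range_iff_isIdempotentElem _).2 h1
  have ht := this.trace
  rw [Matrix.trace_toLin'_eq] at ht
  rw [ht]
  simp only [ne_eq, Nat.cast_eq_zero]
  rw [Submodule.finrank_eq_zero, LinearMap.range_eq_bot]
  simpa using h0


/-- vectors sent into `T` by all of `S` -/
def colonV {K : Type*} [Field K] {n : ℕ} (S : Submodule K (Matrix (Fin n) (Fin n) K))
    (T : Submodule K (Fin n → K)) : Submodule K (Fin n → K) where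
  carrier := {u | ∀ a ∈ S, a *ᵥ u ∈ T}
  zero_mem' := by intro a _; simp
  add_mem' := by
    intro u v hu hv a ha
    rw [Matrix.mulVec_add]; exact T.add_mem (hu a ha) (hv a ha)
  smul_mem' := by
    intro c u hu a ha
    rw [Matrix.mulVec_smul]; exact T.smul_mem c (hu a ha)

def zSeq {K : Type*} [Field K] {n : ℕ} (S : Submodule K (Matrix (Fin n) (Fin n) K)) :
    ℕ → Submodule K (Fin n → K)
  | 0 => ⊥
  | k + 1 => colonV S (zSeq S k)

theorem zSeq_mono {K : Type*} [Field K] {n : ℕ} (S : Submodule K (Matrix (Fin n) (Fin n) K)) :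
    Monotone (zSeq S) := by
  apply monotone_nat_of_le_succ
  intro k
  induction k with
  | zero => exact bot_le
  | succ k ih => intro u hu a ha; exact ih (hu a ha)

theorem zSeq_pred {K : Type*} [Field K] {n : ℕ} (S : Submodule K (Matrix (Fin n) (Fin n) K))
    (k : ℕ) (u : Fin n → K) (hu : u ∈ zSeq S k) (a : Matrix (Fin n) (Fin n) K) (ha : a ∈ S) :
    a *ᵥ u ∈ zSeq S (k - 1) := by
  cases k with
  | zero =>
    have : u = 0 := hu
    rw [this, Matrix.mulVec_zero]; exact Submodule.zero_mem _
  | succ k => exact hu a ha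

theorem engel {K : Type*} [Field K] {n : ℕ} (S : Submodule K (Matrix (Fin n) (Fin n) K)) :
    (∀ a ∈ S, ∀ b ∈ S, a * b + b * a ∈ S) → (∀ a ∈ S, IsNilpotent a) →
    ∀ T M : Submodule K (Fin n → K), (∀ a ∈ S, ∀ u ∈ T, a *ᵥ u ∈ T) →
    (∀ a ∈ S, ∀ u ∈ M, a *ᵥ u ∈ M) → T < M → ∃ u ∈ M, u ∉ T ∧ ∀ a ∈ S, a *ᵥ u ∈ T := by
  induction S using WellFoundedLT.induction with
  | ind S IH =>
  intro hc hn T M hT hM hlt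
  by_cases hS : S = ⊥
  · obtain ⟨u, hu, huT⟩ := SetLike.exists_of_lt hlt
    refine ⟨u, hu, huT, ?_⟩
    intro a ha
    rw [hS] at ha
    have : a = 0 := ha
    rw [this, Matrix.zero_mulVec]; exact T.zero_mem
  obtain ⟨L, ⟨hL, hLc⟩, hmax⟩ := (wellFounded_gt (α := Submodule K (Matrix (Fin n) (Fin n) K))).has_min
    {L | L < S ∧ ∀ a ∈ L, ∀ b ∈ L, a * b + b * a ∈ L} ⟨⊥, bot_lt_iff_ne_bot.2 hS, by
      intro a ha b hb
      have ha : a = 0 := ha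
      rw [ha]; simp⟩
  have IHL := IH L hL hLc (fun a ha => hn a (hL.le ha))
  -- the sequence reaches the top
  obtain ⟨N, hN⟩ := (monotone_stabilizes_iff_noetherian (R := K) (M := Fin n → K)).2 inferInstance
    ⟨zSeq L, zSeq_mono L⟩
  have hZ : zSeq L N = ⊤ := by
    by_contra hne
    obtain ⟨u, _, hu1, hu2⟩ := IHL (zSeq L N) ⊤
      (fun a ha u hu => zSeq_mono L (Nat.sub_le N 1) (zSeq_pred L N u hu a ha))
      (fun _ _ _ _ => trivial) (lt_top_iff_ne_top.2 hne)
    apply hu1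
    have := hN (N + 1) (Nat.le_succ N)
    change zSeq L N = zSeq L (N + 1) at this
    rw [this]
    exact hu2
  have hZ' : ∀ j, N ≤ j → zSeq L j = ⊤ := fun j hj => top_le_iff.1 (hZ ▸ zSeq_mono L hj)
  have good : ∃ a ∈ S, a ∉ L ∧ ∀ k ∈ L, k * a + a * k ∈ L := by
    by_contra hno
    push Not at hno
    have step : ∀ i : ℕ, ∃ a ∈ S, a ∉ L ∧ ∀ j, ∀ u ∈ zSeq L j, a *ᵥ u ∈ zSeq L (N + j - i) := by
      intro i
      induction i with
      | zero =>
        obtain ⟨a, ha, haL⟩ := SetLike.exists_of_lt hL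
        refine ⟨a, ha, haL, ?_⟩
        intro j u _
        rw [hZ' _ (by omega)]; trivial
      | succ i ih =>
        obtain ⟨a, ha, haL, hQ⟩ := ih
        obtain ⟨k, hk, hka⟩ := hno a ha haL
        refine ⟨k * a + a * k, hc _ (hL.le hk) _ ha, hka, ?_⟩
        intro j u hu
        rw [Matrix.add_mulVec, ← Matrix.mulVec_mulVec, ← Matrix.mulVec_mulVec]
        apply Submodule.add_mem
        · have := zSeq_pred L _ _ (hQ j u hu) k hk
          rwa [Nat.sub_sub] at this
        · cases j with
          | zero =>
            have : u = 0 := hu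
            rw [this, Matrix.mulVec_zero, Matrix.mulVec_zero]; exact Submodule.zero_mem _
          | succ j =>
            have := hQ j _ (zSeq_pred L _ _ hu k hk)
            have e : N + (j + 1) - (i + 1) = N + j - i := by omega
            rwa [e]
    obtain ⟨a, _, haL, hQ⟩ := step (N + N)
    apply haL
    have : a = 0 := by
      apply Matrix.ext_of_mulVec_single
      intro i
      have := hQ N (Pi.single i 1) (by rw [hZ]; trivial)
      rw [Nat.sub_self] at this
      have h2 : a *ᵥ (Pi.single i 1) = 0 := this
      rw [h2, Matrix.zero_mulVec]
    rw [this]; exact L.zero_mem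
  obtain ⟨a, haS, haL, hak⟩ := good
  obtain ⟨u0, hu0M, hu0T, hu0⟩ := IHL T M (fun b hb => hT b (hL.le hb)) (fun b hb => hM b (hL.le hb)) hlt
  have hpow : ∀ m : ℕ, (a ^ m) *ᵥ u0 ∈ M ∧ ∀ k ∈ L, k *ᵥ ((a ^ m) *ᵥ u0) ∈ T := by
    intro m
    induction m with
    | zero => simpa using ⟨hu0M, hu0⟩
    | succ m ih =>
      rw [pow_succ', ← Matrix.mulVec_mulVec]
      refine ⟨hM a haS _ ih.1, ?_⟩
      intro k hk
      have h1 := ih.2 _ (hak k hk)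
      have h2 := hT a haS _ (ih.2 k hk)
      rw [Matrix.add_mulVec, ← Matrix.mulVec_mulVec, ← Matrix.mulVec_mulVec] at h1
      exact (Submodule.add_mem_iff_left _ h2).1 h1
  obtain ⟨m0, hm0⟩ := hn a haS
  have hex : ∃ m, (a ^ m) *ᵥ u0 ∈ T := ⟨m0, by rw [hm0, Matrix.zero_mulVec]; exact T.zero_mem⟩
  classical
  obtain ⟨m, hm⟩ : ∃ m, Nat.find hex = m + 1 := by
    apply Nat.exists_eq_succ_of_ne_zero
    intro h0
    have := Nat.find_spec hex
    rw [h0, pow_zero, Matrix.one_mulVec] at this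
    exact hu0T this
  have hmT : (a ^ m) *ᵥ u0 ∉ T := Nat.find_min hex (by omega)
  have hmT' : a *ᵥ ((a ^ m) *ᵥ u0) ∈ T := by
    have := Nat.find_spec hex
    rw [hm, pow_succ', ← Matrix.mulVec_mulVec] at this
    exact this
  refine ⟨(a ^ m) *ᵥ u0, (hpow m).1, hmT, ?_⟩
  set w := (a ^ m) *ᵥ u0 with hw
  let L' : Submodule K (Matrix (Fin n) (Fin n) K) :=
    { carrier := {b | b ∈ S ∧ b *ᵥ w ∈ T}
      zero_mem' := ⟨S.zero_mem, by rw [Matrix.zero_mulVec]; exact T.zero_mem⟩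
      add_mem' := fun hb hc => ⟨S.add_mem hb.1 hc.1, by
        rw [Matrix.add_mulVec]; exact T.add_mem hb.2 hc.2⟩
      smul_mem' := fun c b hb => ⟨S.smul_mem c hb.1, by
        rw [Matrix.smul_mulVec]; exact T.smul_mem c hb.2⟩ }
  have hL'S : L' ≤ S := fun b hb => hb.1
  have hLL' : L < L' := by
    refine lt_of_le_of_ne (fun k hk => ⟨hL.le hk, (hpow m).2 k hk⟩) ?_
    intro h
    apply haL
    rw [h]
    exact ⟨haS, hmT'⟩
  by_cases heq : L' = S
  · intro b hb
    rw [← heq] at hb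
    exact hb.2
  · exfalso
    refine hmax L' ⟨lt_of_le_of_ne hL'S heq, ?_⟩ hLL'
    intro b hb c hc'
    refine ⟨hc b hb.1 c hc'.1, ?_⟩
    rw [Matrix.add_mulVec, ← Matrix.mulVec_mulVec, ← Matrix.mulVec_mulVec]
    exact T.add_mem (hT b hb.1 _ hc'.2) (hT c hc'.1 _ hb.2)

section
variable {K : Type*} [Field K] {n : ℕ}

def act (a : Matrix (Fin n) (Fin n) K) (x : Matrix (Fin n) (Fin n) K × Matrix (Fin n) (Fin n) K) :
    Matrix (Fin n) (Fin n) K × Matrix (Fin n) (Fin n) K :=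
  (a * x.1 + x.1 * aᵀ, aᵀ * x.2 + x.2 * a)

def br (x y : Matrix (Fin n) (Fin n) K × Matrix (Fin n) (Fin n) K) : Matrix (Fin n) (Fin n) K :=
  x.1 * y.2 - y.1 * x.2

structure Sys (S0 : Submodule K (Matrix (Fin n) (Fin n) K))
    (S1 : Submodule K (Matrix (Fin n) (Fin n) K × Matrix (Fin n) (Fin n) K)) : Prop where
  j0 : ∀ a ∈ S0, ∀ b ∈ S0, a * b + b * a ∈ S0
  j1 : ∀ a ∈ S0, ∀ x ∈ S1, act a x ∈ S1
  j2 : ∀ x ∈ S1, ∀ y ∈ S1, br x y ∈ S0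

structure IsIdl (S0 : Submodule K (Matrix (Fin n) (Fin n) K))
    (S1 : Submodule K (Matrix (Fin n) (Fin n) K × Matrix (Fin n) (Fin n) K))
    (I0 : Submodule K (Matrix (Fin n) (Fin n) K))
    (I1 : Submodule K (Matrix (Fin n) (Fin n) K × Matrix (Fin n) (Fin n) K)) : Prop where
  le0 : I0 ≤ S0
  le1 : I1 ≤ S1
  c00 : ∀ a ∈ S0, ∀ b ∈ I0, a * b + b * a ∈ I0
  c01 : ∀ a ∈ I0, ∀ x ∈ S1, act a x ∈ I1
  c10 : ∀ a ∈ S0, ∀ x ∈ I1, act a x ∈ I1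
  c11 : ∀ x ∈ S1, ∀ y ∈ I1, br x y ∈ I0

structure SimpSys (S0 : Submodule K (Matrix (Fin n) (Fin n) K))
    (S1 : Submodule K (Matrix (Fin n) (Fin n) K × Matrix (Fin n) (Fin n) K)) : Prop
    extends Sys S0 S1 where
  sym : ∀ x ∈ S1, x.1ᵀ = x.1
  skew : ∀ x ∈ S1, x.2ᵀ = - x.2
  ne1 : S1 ≠ ⊥
  prd : ¬ ((∀ a ∈ S0, ∀ b ∈ S0, a * b + b * a = 0) ∧ (∀ a ∈ S0, ∀ x ∈ S1, act a x = 0) ∧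
    (∀ x ∈ S1, ∀ y ∈ S1, br x y = 0))
  simp : ∀ I0 I1, IsIdl S0 S1 I0 I1 → (I0 = ⊥ ∧ I1 = ⊥) ∨ (I0 = S0 ∧ I1 = S1)

structure Stab (S0 : Submodule K (Matrix (Fin n) (Fin n) K))
    (S1 : Submodule K (Matrix (Fin n) (Fin n) K × Matrix (Fin n) (Fin n) K))
    (U Y : Submodule K (Fin n → K)) : Prop where
  h1 : ∀ a ∈ S0, ∀ u ∈ U, a *ᵥ u ∈ U
  h2 : ∀ a ∈ S0, ∀ u ∈ Y, aᵀ *ᵥ u ∈ Y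
  h3 : ∀ x ∈ S1, ∀ u ∈ Y, x.1 *ᵥ u ∈ U
  h4 : ∀ x ∈ S1, ∀ u ∈ U, x.2 *ᵥ u ∈ Y

theorem half_lemma [CharZero K] {S0 : Submodule K (Matrix (Fin n) (Fin n) K)}
    {S1 : Submodule K (Matrix (Fin n) (Fin n) K × Matrix (Fin n) (Fin n) K)}
    (hS : Sys S0 S1) (I : Submodule K (Matrix (Fin n) (Fin n) K)) (hI : I ≤ S0)
    (hIi : ∀ a ∈ S0, ∀ b ∈ I, a * b + b * a ∈ I)
    (hIn : ∀ a ∈ I, IsNilpotent a)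
    (hIs : ∀ a ∈ I, ∀ x ∈ S1, ∀ y ∈ S1,
      (x.1 * y.2 + y.1 * x.2) * a - a * (x.1 * y.2 + y.1 * x.2) ∈ I)
    {U Y U1 Y1 : Submodule K (Fin n → K)} (hW : Stab S0 S1 U Y) (hW1 : Stab S0 S1 U1 Y1)
    (hU : U1 ≤ U) (hY : Y1 ≤ Y)
    (hmax : ∀ U' Y', Stab S0 S1 U' Y' → U1 ≤ U' → Y1 ≤ Y' → U' ≤ U → Y' ≤ Y →
      (U' = U1 ∧ Y' = Y1) ∨ (U' = U ∧ Y' = Y)) :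
    ∀ a ∈ I, ∀ u ∈ U, a *ᵥ u ∈ U1 := by
  by_cases hUU : U1 = U
  · intro a ha u hu
    rw [hUU]; exact hW.h1 a (hI ha) u hu
  obtain ⟨u0, hu0, hu0U, hu0I⟩ := engel I (fun a ha b hb => hIi a (hI ha) b hb) hIn U1 U
    (fun a ha => hW1.h1 a (hI ha)) (fun a ha => hW.h1 a (hI ha)) (lt_of_le_of_ne hU hUU)
  let X : Submodule K (Fin n → K) := U ⊓ colonV I U1
  let G : Set (Fin n → K) := {w | ∃ x ∈ S1, ∃ u ∈ X, x.2 *ᵥ u = w}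
  have h1X : U1 ≤ X := fun u hu => ⟨hU hu, fun a ha => hW1.h1 a (hI ha) u hu⟩
  have hst1 : ∀ a ∈ S0, ∀ u ∈ X, a *ᵥ u ∈ X := by
    intro a ha u hu
    refine ⟨hW.h1 a ha u hu.1, ?_⟩
    intro c hc
    have e1 := hu.2 _ (hIi a ha c hc)
    rw [Matrix.add_mulVec, ← Matrix.mulVec_mulVec, ← Matrix.mulVec_mulVec] at e1
    exact (Submodule.add_mem_iff_right _ (hW1.h1 a ha _ (hu.2 c hc))).1 e1
  have hst : Stab S0 S1 X (Y1 ⊔ Submodule.span K G) := by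
    refine ⟨hst1, ?_, ?_, ?_⟩
    · intro a ha y hyy
      obtain ⟨y1, hy1, y, hy, rfl⟩ := Submodule.mem_sup.1 hyy
      rw [Matrix.mulVec_add]
      refine Submodule.add_mem _ (Submodule.mem_sup_left (hW1.h2 a ha y1 hy1)) ?_
      · refine Submodule.mem_sup_right ?_
        clear hy1 hyy
        induction hy using Submodule.span_induction with
        | mem y hy =>
          obtain ⟨x, hx, u, hu, rfl⟩ := hy
          have e1 : (act a x).2 *ᵥ u ∈ Submodule.span K G :=
            Submodule.subset_span ⟨_, hS.j1 a ha x hx, u, hu, rfl⟩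
          have e2 : x.2 *ᵥ (a *ᵥ u) ∈ Submodule.span K G :=
            Submodule.subset_span ⟨x, hx, _, hst1 a ha u hu, rfl⟩
          simp only [act, Matrix.add_mulVec] at e1
          rw [← Matrix.mulVec_mulVec, ← Matrix.mulVec_mulVec] at e1
          exact (Submodule.add_mem_iff_left _ e2).1 e1
        | zero => rw [Matrix.mulVec_zero]; exact Submodule.zero_mem _
        | add p q _ _ hp hq => rw [Matrix.mulVec_add]; exact Submodule.add_mem _ hp hq
        | smul c p _ hp => rw [Matrix.mulVec_smul]; exact Submodule.smul_mem _ c hp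
    · intro y hy v hvv
      obtain ⟨v1, hv1, v, hv, rfl⟩ := Submodule.mem_sup.1 hvv
      rw [Matrix.mulVec_add]
      refine Submodule.add_mem _ (h1X (hW1.h3 y hy v1 hv1)) ?_
      · clear hv1 hvv
        induction hv using Submodule.span_induction with
        | mem v hv =>
          obtain ⟨x, hx, u, hu, rfl⟩ := hv
          refine ⟨hW.h3 y hy _ (hW.h4 x hx u hu.1), ?_⟩
          intro c hc
          have hd : (c * (y.1 * x.2 - x.1 * y.2)) *ᵥ u ∈ U1 := by
            have e1 := hu.2 _ (hIi _ (hS.j2 y hy x hx) c hc)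
            have e2 := hW1.h1 _ (hS.j2 y hy x hx) _ (hu.2 c hc)
            rw [Matrix.add_mulVec, ← Matrix.mulVec_mulVec] at e1
            exact (Submodule.add_mem_iff_right _ e2).1 e1
          have hs : (c * (y.1 * x.2 + x.1 * y.2)) *ᵥ u ∈ U1 := by
            have e1 := hu.2 _ (hIs c hc y hy x hx)
            have e2 : ((y.1 * x.2 + x.1 * y.2) * c) *ᵥ u ∈ U1 := by
              rw [← Matrix.mulVec_mulVec, Matrix.add_mulVec, ← Matrix.mulVec_mulVec,
                ← Matrix.mulVec_mulVec]
              exact U1.add_mem (hW1.h3 _ hy _ (hW1.h4 _ hx _ (hu.2 c hc)))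
                (hW1.h3 _ hx _ (hW1.h4 _ hy _ (hu.2 c hc)))
            rw [Matrix.sub_mulVec] at e1
            have := U1.sub_mem e2 e1
            rwa [sub_sub_cancel] at this
          have h2 := U1.smul_mem (2:K)⁻¹ (U1.add_mem hd hs)
          have e : c *ᵥ (y.1 *ᵥ (x.2 *ᵥ u)) = (2:K)⁻¹ • ((c * (y.1 * x.2 - x.1 * y.2)) *ᵥ u +
            (c * (y.1 * x.2 + x.1 * y.2)) *ᵥ u) := by
            rw [← Matrix.add_mulVec, ← mul_add, sub_add_add_cancel, ← two_smul K (y.1 * x.2),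
              mul_smul_comm, Matrix.smul_mulVec, smul_smul, inv_mul_cancel₀ two_ne_zero, one_smul,
              Matrix.mulVec_mulVec, Matrix.mulVec_mulVec, mul_assoc]
          rw [e]; exact h2
        | zero => rw [Matrix.mulVec_zero]; exact Submodule.zero_mem _
        | add p q _ _ hp hq => rw [Matrix.mulVec_add]; exact Submodule.add_mem _ hp hq
        | smul c p _ hp => rw [Matrix.mulVec_smul]; exact Submodule.smul_mem _ c hp
    · intro x hx u hu
      exact Submodule.mem_sup_right (Submodule.subset_span ⟨x, hx, u, hu, rfl⟩)
  have hGY : Submodule.span K G ≤ Y := by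
    rw [Submodule.span_le]
    rintro _ ⟨x, hx, u, hu, rfl⟩
    exact hW.h4 x hx u hu.1
  rcases hmax _ _ hst h1X le_sup_left inf_le_left (sup_le hY hGY) with h | h
  · exact absurd (h.1 ▸ (⟨hu0, hu0I⟩ : u0 ∈ X)) hu0U
  · intro a ha u hu
    rw [← h.1] at hu
    exact hu.2 a ha
end

section
set_option linter.unusedSectionVars false
set_option linter.unusedSimpArgs false
variable {K : Type*} [Field K] [CharZero K] {n : ℕ} {S0 : Submodule K (Matrix (Fin n) (Fin n) K)}
    {S1 : Submodule K (Matrix (Fin n) (Fin n) K × Matrix (Fin n) (Fin n) K)}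

theorem half_mem {V : Type*} [AddCommGroup V] [Module K V] (S : Submodule K V) {a b : V}
    (hb : b ∈ S) (h : a + a = b) : a ∈ S := by
  have : a = (2:K)⁻¹ • b := by
    rw [← h, ← two_smul K a, smul_smul, inv_mul_cancel₀ two_ne_zero, one_smul]
  rw [this]; exact S.smul_mem _ hb

theorem Sys.sq (hS : Sys S0 S1) {a} (ha : a ∈ S0) : a * a ∈ S0 :=
  half_mem S0 (hS.j0 a ha a ha) rfl

theorem Sys.pow (hS : Sys S0 S1) {a} (ha : a ∈ S0) (k : ℕ) : a ^ (k + 1) ∈ S0 := by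
  induction k with
  | zero => simpa using ha
  | succ k ih => 
    apply half_mem S0 (hS.j0 _ ha _ ih)
    rw [← pow_succ, ← pow_succ']

theorem Sys.poly (hS : Sys S0 S1) {a} (ha : a ∈ S0) (p : Polynomial K) :
    a * Polynomial.aeval a p ∈ S0 := by
  induction p using Polynomial.induction_on' with
  | add p q hp hq => rw [map_add, mul_add]; exact S0.add_mem hp hq
  | monomial k c =>
    rw [Polynomial.aeval_monomial, ← Algebra.smul_def, mul_smul_comm, ← pow_succ']
    exact S0.smul_mem _ (hS.pow ha k)

/-- the radical of the trace form -/
def rad (S0 : Submodule K (Matrix (Fin n) (Fin n) K)) : Submodule K (Matrix (Fin n) (Fin n) K) where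
  carrier := {a | a ∈ S0 ∧ ∀ b ∈ S0, (a * b).trace = 0}
  zero_mem' := ⟨S0.zero_mem, by simp⟩
  add_mem' := fun ha hb => ⟨S0.add_mem ha.1 hb.1, fun c hc => by
    rw [add_mul, trace_add, ha.2 c hc, hb.2 c hc, add_zero]⟩
  smul_mem' := fun c a ha => ⟨S0.smul_mem c ha.1, fun b hb => by
    rw [smul_mul_assoc, trace_smul, ha.2 b hb, smul_zero]⟩

theorem rad_idl (hS : Sys S0 S1) : ∀ a ∈ S0, ∀ b ∈ rad S0, a * b + b * a ∈ rad S0 := by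
  intro a ha b hb
  refine ⟨hS.j0 a ha b hb.1, ?_⟩
  intro c hc
  have := hb.2 _ (hS.j0 a ha c hc)
  rw [mul_add, trace_add] at this
  rw [add_mul, trace_add, mul_assoc b, add_comm, trace_mul_comm (a * b) c, ← mul_assoc c,
    trace_mul_comm (c * a) b]
  exact this

theorem rad_nil (hS : Sys S0 S1) : ∀ a ∈ rad S0, IsNilpotent a := by
  intro a ha
  by_contra hn
  obtain ⟨p, hp, hp0⟩ := fitting_idem a hn
  exact trace_idem_ne _ hp hp0 (ha.2 _ (hS.poly ha.1 p))

theorem comm_mem (hS : Sys S0 S1) : ∀ a ∈ S0, ∀ x ∈ S1, ∀ y ∈ S1,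
      (x.1 * y.2 + y.1 * x.2) * a - a * (x.1 * y.2 + y.1 * x.2) ∈ S0 := by
  intro a ha x hx y hy
  have h1 := hS.j2 x hx _ (hS.j1 a ha y hy)
  have h2 := hS.j2 y hy _ (hS.j1 a ha x hx)
  have := S0.add_mem h1 h2
  simp only [act, br] at this
  convert this using 1
  noncomm_ring

theorem rad_comm (hS : Sys S0 S1) : ∀ a ∈ rad S0, ∀ x ∈ S1, ∀ y ∈ S1,
      (x.1 * y.2 + y.1 * x.2) * a - a * (x.1 * y.2 + y.1 * x.2) ∈ rad S0 := by
  intro a ha x hx y hy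
  refine ⟨comm_mem hS a ha.1 x hx y hy, ?_⟩
  intro b hb
  have := ha.2 _ (comm_mem hS b hb x hx y hy)
  set s := x.1 * y.2 + y.1 * x.2
  rw [mul_sub, trace_sub] at this
  rw [sub_mul, trace_sub, mul_assoc s, trace_mul_comm s, mul_assoc, mul_assoc]
  linear_combination - this

theorem swap_sys (hS : SimpSys S0 S1) : Sys (S0.comap (Matrix.transposeLinearEquiv (Fin n) (Fin n) K K).toLinearMap)
    (S1.comap (LinearEquiv.prodComm K _ _).toLinearMap) := by
  refine ⟨?_, ?_, ?_⟩
  · intro a ha b hb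
    change (a * b + b * a)ᵀ ∈ S0
    rw [transpose_add, transpose_mul, transpose_mul]
    exact hS.j0 _ hb _ ha
  · intro a ha x hx
    have := hS.j1 _ ha _ hx
    exact this
  · intro x hx y hy
    change (x.1 * y.2 - y.1 * x.2)ᵀ ∈ S0
    have h1 := hS.sym _ hx
    have h2 := hS.skew _ hx
    have h3 := hS.sym _ hy
    have h4 := hS.skew _ hy
    have h := hS.j2 _ hx _ hy
    simp only [LinearEquiv.coe_coe, LinearEquiv.prodComm_apply, Prod.fst_swap, Prod.snd_swap, br] at h1 h2 h3 h4 h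
    rw [transpose_sub, transpose_mul, transpose_mul, h1, h2, h3, h4]
    convert h using 1
    noncomm_ring

theorem rad_bot (hS : SimpSys S0 S1) : rad S0 = ⊥ := by
  by_contra hI
  let P : Set (Submodule K (Fin n → K) × Submodule K (Fin n → K)) :=
    {W | Stab S0 S1 W.1 W.2 ∧ (∀ a ∈ S0, ∀ v, a *ᵥ v ∈ W.1 ∧ aᵀ *ᵥ v ∈ W.2) ∧
      (∀ x ∈ S1, ∀ v, x.1 *ᵥ v ∈ W.1 ∧ x.2 *ᵥ v ∈ W.2)}
  obtain ⟨⟨U, Y⟩, ⟨hW, hW0, hW1⟩, hmin⟩ := (wellFounded_lt (α := Submodule K (Fin n → K) × Submodule K (Fin n → K))).has_min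
    P ⟨⟨⊤, ⊤⟩, by refine ⟨⟨?_, ?_, ?_, ?_⟩, ?_, ?_⟩ <;> intros <;> trivial⟩
  dsimp only at hW hW0 hW1
  have hmat : ∀ a : Matrix (Fin n) (Fin n) K, (∀ v, a *ᵥ v = 0) → a = 0 := by
    intro a ha
    apply Matrix.ext_of_mulVec_single
    intro i
    rw [ha, Matrix.zero_mulVec]
  have hWne : (U, Y) ≠ ⊥ := by
    intro h
    have hU : U = ⊥ := congrArg Prod.fst h
    have hY : Y = ⊥ := congrArg Prod.snd h
    apply hS.ne1
    rw [eq_bot_iff]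
    intro x hx
    have e1 : x.1 = 0 := hmat _ (fun v => by have := (hW1 x hx v).1; rwa [hU] at this)
    have e2 : x.2 = 0 := hmat _ (fun v => by have := (hW1 x hx v).2; rwa [hY] at this)
    exact Prod.ext e1 e2
  obtain ⟨⟨U1, Y1⟩, ⟨hV, hVlt⟩, hmax⟩ := (wellFounded_gt (α := Submodule K (Fin n → K) × Submodule K (Fin n → K))).has_min
    {W | Stab S0 S1 W.1 W.2 ∧ W < (U, Y)} ⟨⊥, by
      refine ⟨⟨?_, ?_, ?_, ?_⟩, bot_lt_iff_ne_bot.2 hWne⟩ <;>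
      · intro a ha u hu
        have hu : u = 0 := hu
        rw [hu, Matrix.mulVec_zero]
        exact Submodule.zero_mem _⟩
  dsimp only at hV
  have hU1 : U1 ≤ U := hVlt.le.1
  have hY1 : Y1 ≤ Y := hVlt.le.2
  have hmax' : ∀ U' Y', Stab S0 S1 U' Y' → U1 ≤ U' → Y1 ≤ Y' → U' ≤ U → Y' ≤ Y →
      (U' = U1 ∧ Y' = Y1) ∨ (U' = U ∧ Y' = Y) := by
    intro U' Y' h a1 a2 a3 a4
    by_contra hcon
    push Not at hcon
    have lt1 : (U', Y') < (U, Y) := lt_of_le_of_ne ⟨a3, a4⟩ (fun e => by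
      exact hcon.2 (congrArg Prod.fst e) (congrArg Prod.snd e))
    have lt2 : (U1, Y1) < (U', Y') := lt_of_le_of_ne ⟨a1, a2⟩ (fun e => by
      exact hcon.1 (congrArg Prod.fst e).symm (congrArg Prod.snd e).symm)
    exact hmax (U', Y') ⟨h, lt1⟩ lt2
  have k1 := half_lemma hS.toSys (rad S0) (fun a ha => ha.1) (rad_idl hS.toSys) (rad_nil hS.toSys)
    (rad_comm hS.toSys) hW hV hU1 hY1 hmax'
  have hsw : ∀ {U' Y'}, Stab (S0.comap (Matrix.transposeLinearEquiv (Fin n) (Fin n) K K).toLinearMap)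
    (S1.comap (LinearEquiv.prodComm K _ _).toLinearMap) Y' U' → Stab S0 S1 U' Y' := by
    intro U' Y' h
    refine ⟨fun a ha => ?_, fun a ha => ?_, fun x hx => ?_, fun x hx => ?_⟩
    · exact h.h2 aᵀ (by change aᵀᵀ ∈ S0; rwa [transpose_transpose])
    · exact h.h1 aᵀ (by change aᵀᵀ ∈ S0; rwa [transpose_transpose])
    · exact h.h4 (x.2, x.1) hx
    · exact h.h3 (x.2, x.1) hx
  have hsw' : ∀ {U' Y'}, Stab S0 S1 U' Y' → Stab (S0.comap (Matrix.transposeLinearEquiv (Fin n) (Fin n) K K).toLinearMap)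
    (S1.comap (LinearEquiv.prodComm K _ _).toLinearMap) Y' U' := by
    intro U' Y' h
    refine ⟨fun a ha => ?_, fun a ha => ?_, fun x hx => ?_, fun x hx => ?_⟩
    · have := h.h2 _ ha
      exact this
    · exact h.h1 _ ha
    · exact h.h4 (x.2, x.1) hx
    · exact h.h3 (x.2, x.1) hx
  have k2 := half_lemma (swap_sys hS) ((rad S0).comap (Matrix.transposeLinearEquiv (Fin n) (Fin n) K K).toLinearMap)
    (fun a ha => ha.1) (by
      intro a ha b hb
      change (a * b + b * a)ᵀ ∈ rad S0
      rw [transpose_add, transpose_mul, transpose_mul, add_comm]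
      exact rad_idl hS.toSys _ ha _ hb) (by
      intro a ha
      obtain ⟨k, hk⟩ := rad_nil hS.toSys _ ha
      refine ⟨k, ?_⟩
      have hk : aᵀ ^ k = 0 := hk
      rw [← transpose_pow] at hk
      rw [← transpose_transpose (a ^ k), hk, transpose_zero]) (by
      intro a ha x hx y hy
      change ((x.1 * y.2 + y.1 * x.2) * a - a * (x.1 * y.2 + y.1 * x.2))ᵀ ∈ rad S0
      have h1 := hS.sym _ hx
      have h2 := hS.skew _ hx
      have h3 := hS.sym _ hy
      have h4 := hS.skew _ hy
      have h := rad_comm hS.toSys _ ha _ hx _ hy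
      simp only [LinearEquiv.coe_coe, LinearEquiv.prodComm_apply, Prod.fst_swap, Prod.snd_swap, br] at h1 h2 h3 h4 h
      rw [transpose_sub, transpose_mul, transpose_mul, transpose_add, transpose_mul, transpose_mul, h1, h2, h3, h4]
      convert h using 1
      change aᵀ * _ - _ * aᵀ = _ * aᵀ - aᵀ * _
      noncomm_ring) (hsw' hW) (hsw' hV) hY1 hU1 (by
      intro Y' U' h a1 a2 a3 a4
      have := hmax' U' Y' (hsw h) a2 a1 a4 a3
      tauto)
  have k2' : ∀ a ∈ rad S0, ∀ u ∈ Y, aᵀ *ᵥ u ∈ Y1 := by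
    intro a ha
    apply k2
    change aᵀᵀ ∈ rad S0
    rwa [transpose_transpose]
  -- general ideal
  let I0 : Submodule K (Fin n → K) → Submodule K (Fin n → K) → Submodule K (Matrix (Fin n) (Fin n) K) :=
    fun U' Y' =>
    { carrier := {a | a ∈ S0 ∧ (∀ u ∈ U', a *ᵥ u ∈ U1) ∧ (∀ u ∈ Y', aᵀ *ᵥ u ∈ Y1)}
      zero_mem' := ⟨S0.zero_mem, by intro u _; rw [zero_mulVec]; exact U1.zero_mem, by
        intro u _; rw [transpose_zero, zero_mulVec]; exact Y1.zero_mem⟩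
      add_mem' := fun ha hb => ⟨S0.add_mem ha.1 hb.1, fun u hu => by
        rw [add_mulVec]; exact U1.add_mem (ha.2.1 u hu) (hb.2.1 u hu), fun u hu => by
        rw [transpose_add, add_mulVec]; exact Y1.add_mem (ha.2.2 u hu) (hb.2.2 u hu)⟩
      smul_mem' := fun c a ha => ⟨S0.smul_mem c ha.1, fun u hu => by
        rw [smul_mulVec]; exact U1.smul_mem c (ha.2.1 u hu), fun u hu => by
        rw [transpose_smul, smul_mulVec]; exact Y1.smul_mem c (ha.2.2 u hu)⟩ }
  let I1 : Submodule K (Fin n → K) → Submodule K (Fin n → K) → Submodule K (Matrix (Fin n) (Fin n) K × Matrix (Fin n) (Fin n) K) :=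
    fun U' Y' =>
    { carrier := {x | x ∈ S1 ∧ (∀ u ∈ Y', x.1 *ᵥ u ∈ U1) ∧ (∀ u ∈ U', x.2 *ᵥ u ∈ Y1)}
      zero_mem' := ⟨S1.zero_mem, by intro u _; rw [Prod.fst_zero, zero_mulVec]; exact U1.zero_mem, by
        intro u _; rw [Prod.snd_zero, zero_mulVec]; exact Y1.zero_mem⟩
      add_mem' := fun ha hb => ⟨S1.add_mem ha.1 hb.1, fun u hu => by
        rw [Prod.fst_add, add_mulVec]; exact U1.add_mem (ha.2.1 u hu) (hb.2.1 u hu), fun u hu => by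
        rw [Prod.snd_add, add_mulVec]; exact Y1.add_mem (ha.2.2 u hu) (hb.2.2 u hu)⟩
      smul_mem' := fun c a ha => ⟨S1.smul_mem c ha.1, fun u hu => by
        rw [Prod.smul_fst, smul_mulVec]; exact U1.smul_mem c (ha.2.1 u hu), fun u hu => by
        rw [Prod.smul_snd, smul_mulVec]; exact Y1.smul_mem c (ha.2.2 u hu)⟩ }
  have hidl : ∀ U' Y', Stab S0 S1 U' Y' → IsIdl S0 S1 (I0 U' Y') (I1 U' Y') := by
    intro U' Y' h
    have hskew : ∀ x ∈ S1, ∀ y ∈ S1, (br x y)ᵀ = x.2 * y.1 - y.2 * x.1 := by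
      intro x hx y hy
      rw [br, transpose_sub, transpose_mul, transpose_mul, hS.sym x hx, hS.sym y hy, hS.skew x hx, hS.skew y hy]
      noncomm_ring
    refine ⟨fun a ha => ha.1, fun a ha => ha.1, ?_, ?_, ?_, ?_⟩
    · intro a ha b hb
      refine ⟨hS.j0 a ha b hb.1, fun u hu => ?_, fun u hu => ?_⟩
      · rw [add_mulVec, ← mulVec_mulVec, ← mulVec_mulVec]
        exact U1.add_mem (hV.h1 _ ha _ (hb.2.1 _ hu)) (hb.2.1 _ (h.h1 _ ha _ hu))
      · rw [transpose_add, transpose_mul, transpose_mul, add_mulVec, ← mulVec_mulVec, ← mulVec_mulVec]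
        exact Y1.add_mem (hb.2.2 _ (h.h2 _ ha _ hu)) (hV.h2 _ ha _ (hb.2.2 _ hu))
    · intro a ha x hx
      refine ⟨hS.j1 a ha.1 x hx, fun u hu => ?_, fun u hu => ?_⟩
      · rw [act, add_mulVec, ← mulVec_mulVec, ← mulVec_mulVec]
        exact U1.add_mem (ha.2.1 _ (h.h3 _ hx _ hu)) (hV.h3 _ hx _ (ha.2.2 _ hu))
      · rw [act, add_mulVec, ← mulVec_mulVec, ← mulVec_mulVec]
        exact Y1.add_mem (ha.2.2 _ (h.h4 _ hx _ hu)) (hV.h4 _ hx _ (ha.2.1 _ hu))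
    · intro a ha x hx
      refine ⟨hS.j1 a ha x hx.1, fun u hu => ?_, fun u hu => ?_⟩
      · rw [act, add_mulVec, ← mulVec_mulVec, ← mulVec_mulVec]
        exact U1.add_mem (hV.h1 _ ha _ (hx.2.1 _ hu)) (hx.2.1 _ (h.h2 _ ha _ hu))
      · rw [act, add_mulVec, ← mulVec_mulVec, ← mulVec_mulVec]
        exact Y1.add_mem (hV.h2 _ ha _ (hx.2.2 _ hu)) (hx.2.2 _ (h.h1 _ ha _ hu))
    · intro x hx y hy
      refine ⟨hS.j2 x hx y hy.1, fun u hu => ?_, fun u hu => ?_⟩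
      · rw [br, sub_mulVec, ← mulVec_mulVec, ← mulVec_mulVec]
        exact U1.sub_mem (hV.h3 _ hx _ (hy.2.2 _ hu)) (hy.2.1 _ (h.h4 _ hx _ hu))
      · rw [hskew x hx y hy.1, sub_mulVec, ← mulVec_mulVec, ← mulVec_mulVec]
        exact Y1.sub_mem (hV.h4 _ hx _ (hy.2.1 _ hu)) (hy.2.2 _ (h.h3 _ hx _ hu))
  have hJ : I0 U Y = S0 ∧ I1 U Y = S1 := by
    rcases hS.simp _ _ (hidl U Y hW) with h | h
    · exfalso
      apply hI
      rw [eq_bot_iff, ← h.1]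
      intro a ha
      exact ⟨ha.1, k1 a ha, k2' a ha⟩
    · exact h
  have hJ0 : ∀ a ∈ S0, a ∈ I0 U Y := fun a ha => by rw [hJ.1]; exact ha
  have hJ1 : ∀ a ∈ S1, a ∈ I1 U Y := fun a ha => by rw [hJ.2]; exact ha
  rcases hS.simp _ _ (hidl ⊤ ⊤ (by refine ⟨?_, ?_, ?_, ?_⟩ <;> intros <;> trivial)) with h | h
  · apply hS.prd
    refine ⟨?_, ?_, ?_⟩
    · intro a ha b hb
      have : a * b + b * a ∈ I0 ⊤ ⊤ := by
        refine ⟨hS.j0 a ha b hb, fun u _ => ?_, fun u _ => ?_⟩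
        · rw [add_mulVec, ← mulVec_mulVec, ← mulVec_mulVec]
          exact U1.add_mem ((hJ0 a ha).2.1 _ (hW0 b hb u).1) ((hJ0 b hb).2.1 _ (hW0 a ha u).1)
        · rw [transpose_add, transpose_mul, transpose_mul, add_mulVec, ← mulVec_mulVec, ← mulVec_mulVec]
          exact Y1.add_mem ((hJ0 b hb).2.2 _ (hW0 a ha u).2) ((hJ0 a ha).2.2 _ (hW0 b hb u).2)
      rw [h.1] at this
      exact this
    · intro a ha x hx
      have : act a x ∈ I1 ⊤ ⊤ := by
        refine ⟨hS.j1 a ha x hx, fun u _ => ?_, fun u _ => ?_⟩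
        · rw [act, add_mulVec, ← mulVec_mulVec, ← mulVec_mulVec]
          exact U1.add_mem ((hJ0 a ha).2.1 _ (hW1 x hx u).1) ((hJ1 x hx).2.1 _ (hW0 a ha u).2)
        · rw [act, add_mulVec, ← mulVec_mulVec, ← mulVec_mulVec]
          exact Y1.add_mem ((hJ0 a ha).2.2 _ (hW1 x hx u).2) ((hJ1 x hx).2.2 _ (hW0 a ha u).1)
      rw [h.2] at this
      exact this
    · intro x hx y hy
      have : br x y ∈ I0 ⊤ ⊤ := by
        refine ⟨hS.j2 x hx y hy, fun u _ => ?_, fun u _ => ?_⟩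
        · rw [br, sub_mulVec, ← mulVec_mulVec, ← mulVec_mulVec]
          exact U1.sub_mem ((hJ1 x hx).2.1 _ (hW1 y hy u).2) ((hJ1 y hy).2.1 _ (hW1 x hx u).2)
        · rw [br, transpose_sub, transpose_mul, transpose_mul, hS.sym x hx, hS.sym y hy, hS.skew x hx,
            hS.skew y hy, neg_mul, neg_mul, sub_neg_eq_add, neg_add_eq_sub, sub_mulVec, ← mulVec_mulVec, ← mulVec_mulVec]
          exact Y1.sub_mem ((hJ1 x hx).2.2 _ (hW1 y hy u).1) ((hJ1 y hy).2.2 _ (hW1 x hx u).1)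
      rw [h.1] at this
      exact this
  · refine hmin (U1, Y1) ⟨hV, ?_, ?_⟩ hVlt
    · intro a ha v
      rw [← h.1] at ha
      exact ⟨ha.2.1 v trivial, ha.2.2 v trivial⟩
    · intro x hx v
      rw [← h.2] at hx
      exact ⟨hx.2.1 v trivial, hx.2.2 v trivial⟩
end

section
set_option linter.unusedSectionVars false
variable {K : Type*} [Field K] [CharZero K] {n : ℕ} {S0 : Submodule K (Matrix (Fin n) (Fin n) K)}
    {S1 : Submodule K (Matrix (Fin n) (Fin n) K × Matrix (Fin n) (Fin n) K)}

structure JA (S0 : Submodule K (Matrix (Fin n) (Fin n) K)) : Prop where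
  j0 : ∀ a ∈ S0, ∀ b ∈ S0, a * b + b * a ∈ S0
  nd : ∀ a ∈ S0, (∀ b ∈ S0, (a * b).trace = 0) → a = 0
  cent : ∀ q : Matrix (Fin n) (Fin n) K, (∀ a ∈ S0, q * a = a * q) → ∃ κ : K, q = κ • 1
  one : (1 : Matrix (Fin n) (Fin n) K) ∈ S0

def trForm (S0 : Submodule K (Matrix (Fin n) (Fin n) K)) : S0 →ₗ[K] Module.Dual K S0 :=
  LinearMap.mk₂ K (fun a b : S0 => ((a : Matrix (Fin n) (Fin n) K) * b).trace)
    (fun a b c => by simp [add_mul, trace_add]) (fun c a b => by simp [trace_smul])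
    (fun a b c => by simp [mul_add, trace_add]) (fun c a b => by simp [trace_smul])

theorem exists_repr (nd : ∀ a ∈ S0, (∀ b ∈ S0, (a * b).trace = 0) → a = 0)
    (φ : Matrix (Fin n) (Fin n) K →ₗ[K] K) : ∃ e ∈ S0, ∀ a ∈ S0, (e * a).trace = φ a := by
  have hinj : Function.Injective (trForm S0) := by
    rw [injective_iff_map_eq_zero]
    intro a ha
    apply Subtype.ext
    apply nd a a.2
    intro b hb
    exact congrArg (fun f => f ⟨b, hb⟩) ha
  have hsurj := (LinearMap.injective_iff_surjective_of_finrank_eq_finrank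
    (Subspace.dual_finrank_eq (K := K) (V := S0)).symm).1 hinj
  obtain ⟨e, he⟩ := hsurj (φ.comp S0.subtype)
  exact ⟨e, e.2, fun a ha => congrArg (fun f => f ⟨a, ha⟩) he⟩

theorem JA_of (hS : SimpSys S0 S1)
    (cent : ∀ q : Matrix (Fin n) (Fin n) K, (∀ a ∈ S0, q * a = a * q) → ∃ κ : K, q = κ • 1) :
    JA S0 := by
  have nd : ∀ a ∈ S0, (∀ b ∈ S0, (a * b).trace = 0) → a = 0 := by
    intro a ha h
    have : a ∈ rad S0 := ⟨ha, h⟩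
    rw [rad_bot hS] at this
    exact this
  refine ⟨hS.j0, nd, cent, ?_⟩
  obtain ⟨e, he, het⟩ := exists_repr nd (traceLinearMap (Fin n) K K)
  have h2 : ∀ a ∈ S0, e * a + a * e = a + a := by
    intro a ha
    rw [← sub_eq_zero]
    apply nd _ (S0.sub_mem (hS.j0 e he a ha) (S0.add_mem ha ha))
    intro b hb
    have h := het _ (hS.j0 a ha b hb)
    simp only [traceLinearMap_apply, mul_add, trace_add] at h
    rw [sub_mul, add_mul, add_mul, trace_sub, trace_add, trace_add]
    have e1 : (a * e * b).trace = (e * (b * a)).trace := by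
      rw [mul_assoc, trace_mul_comm, mul_assoc]
    rw [e1, mul_assoc, h, trace_mul_comm b a, sub_self]
  have hee : e * e = e := by
    have := h2 e he
    rw [← two_smul K, ← two_smul K] at this
    exact smul_right_injective _ (two_ne_zero (α := K)) this
  have hl : ∀ a ∈ S0, e * a = a := by
    intro a ha
    have h := h2 a ha
    have h3 : e * (e * a + a * e) = e * (a + a) := by rw [h]
    have h4 : (e * a + a * e) * e = (a + a) * e := by rw [h]
    rw [mul_add, mul_add, ← mul_assoc, hee, add_left_cancel_iff] at h3
    rw [add_mul, add_mul, mul_assoc a, hee, add_right_cancel_iff, mul_assoc] at h4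
    rw [← h4, h3, ← two_smul K, ← two_smul K] at h
    exact smul_right_injective _ (two_ne_zero (α := K)) h
  have hr : ∀ a ∈ S0, a * e = a := by
    intro a ha
    have h := h2 a ha
    rw [hl a ha, add_right_inj] at h
    exact h
  obtain ⟨κ, hκ⟩ := cent e (fun a ha => by rw [hl a ha, hr a ha])
  by_cases hz : ∀ a ∈ S0, a = 0
  · exfalso
    apply hS.prd
    refine ⟨fun a ha b hb => hz _ (hS.j0 a ha b hb), fun a ha x hx => ?_, fun x hx y hy => hz _ (hS.j2 x hx y hy)⟩
    rw [hz a ha]; simp [act]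
  · push Not at hz
    obtain ⟨a, ha, ha0⟩ := hz
    have h := hl a ha
    rw [hκ, smul_mul_assoc, one_mul] at h
    have : (κ - 1) • a = 0 := by rw [sub_smul, h, one_smul, sub_self]
    rcases smul_eq_zero.1 this with h | h
    · rw [sub_eq_zero.1 h, one_smul] at hκ
      rw [← hκ]; exact he
    · exact absurd h ha0

theorem trip (j0 : ∀ a ∈ S0, ∀ b ∈ S0, a * b + b * a ∈ S0) {a b c} (ha : a ∈ S0) (hb : b ∈ S0)
    (hc : c ∈ S0) : a * b * c + c * b * a ∈ S0 := by
  apply half_mem S0 (S0.sub_mem (S0.add_mem (j0 _ ha _ (j0 _ hb _ hc)) (j0 _ (j0 _ ha _ hb) _ hc))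
    (j0 _ hb _ (j0 _ ha _ hc)))
  noncomm_ring

theorem umem (j0 : ∀ a ∈ S0, ∀ b ∈ S0, a * b + b * a ∈ S0) {a b} (ha : a ∈ S0) (hb : b ∈ S0) :
    a * b * a ∈ S0 := half_mem S0 (trip j0 ha hb ha) rfl

structure Prim (S0 : Submodule K (Matrix (Fin n) (Fin n) K)) (e : Matrix (Fin n) (Fin n) K) : Prop where
  mem : e ∈ S0
  idem : e * e = e
  ne : e ≠ 0
  prim : ∀ b ∈ S0, ∃ μ : K, e * b * e = μ • e

structure Frame (S0 : Submodule K (Matrix (Fin n) (Fin n) K)) {r : ℕ}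
    (E : Fin r → Matrix (Fin n) (Fin n) K) : Prop where
  mem : ∀ i, E i ∈ S0
  idem : ∀ i, E i * E i = E i
  ne : ∀ i, E i ≠ 0
  orth : ∀ i j, i ≠ j → E i * E j = 0
  sum : ∑ i, E i = 1

theorem trace_idem_nat (e : Matrix (Fin n) (Fin n) K)
    (he : e * e = e) (h0 : e ≠ 0) : ∃ k : ℕ, e.trace = k ∧ 1 ≤ k := by
  have h1 : IsIdempotentElem (Matrix.toLin' e) := by
    unfold IsIdempotentElem at *
    rw [Module.End.mul_eq_comp, ← Matrix.toLin'_mul, he]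
  have := (LinearMap.isProj_range_iff_isIdempotentElem _).2 h1
  have ht := this.trace
  rw [Matrix.trace_toLin'_eq] at ht
  refine ⟨_, ht, ?_⟩
  rw [Nat.one_le_iff_ne_zero]
  intro h
  exact trace_idem_ne e he h0 (by rw [ht, h, Nat.cast_zero])

theorem Frame.le {r : ℕ} {E : Fin r → Matrix (Fin n) (Fin n) K} (hE : Frame S0 E) : r ≤ n := by
  choose k hk hk1 using fun i => trace_idem_nat (E i) (hE.idem i) (hE.ne i)
  have h := congrArg Matrix.trace hE.sum
  rw [trace_sum, trace_one, Fintype.card_fin] at h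
  simp only [hk] at h
  have h' : ∑ i, k i = n := by exact_mod_cast h
  calc r = ∑ _i : Fin r, 1 := by simp
    _ ≤ ∑ i, k i := Finset.sum_le_sum (fun i _ => hk1 i)
    _ = n := h'

theorem exists_eig [IsAlgClosed K] (b : Matrix (Fin n) (Fin n) K) (hb : ¬ IsNilpotent b) :
    ∃ μ : K, μ ≠ 0 ∧ ∃ v : Fin n → K, v ≠ 0 ∧ b *ᵥ v = μ • v := by
  by_contra hcon
  push Not at hcon
  apply hb
  refine ⟨n, ?_⟩
  have hroots : ∀ μ ∈ b.charpoly.roots, μ = 0 := by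
    intro μ hμ
    by_contra hμ0
    have h1 : b.charpoly.eval μ = 0 := (Polynomial.mem_roots'.1 hμ).2
    rw [Matrix.eval_charpoly] at h1
    obtain ⟨v, hv, hv2⟩ := Matrix.exists_mulVec_eq_zero_iff.2 h1
    apply hcon μ hμ0 v hv
    rw [sub_mulVec, sub_eq_zero] at hv2
    rw [← hv2, Matrix.scalar_apply, ← smul_one_eq_diagonal, smul_mulVec, one_mulVec]
  have hsp := IsAlgClosed.splits b.charpoly
  have hm := b.charpoly_monic
  have hp := hsp.eq_prod_roots_of_monic hm
  have hr := Multiset.eq_replicate_of_mem hroots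
  rw [hr] at hp
  have hc : Multiset.card b.charpoly.roots = n := by
    rw [← hsp.natDegree_eq_card_roots, b.charpoly_natDegree_eq_dim, Fintype.card_fin]
  rw [hc] at hp
  simp only [Multiset.map_replicate, Multiset.prod_replicate, Polynomial.C_0, sub_zero] at hp
  have := b.aeval_self_charpoly
  rw [hp] at this
  simpa using this

theorem Frame.refine {r : ℕ} {E : Fin r → Matrix (Fin n) (Fin n) K} (hE : Frame S0 E) (i : Fin r)
    {e : Matrix (Fin n) (Fin n) K} (he : e ∈ S0) (hi : e * e = e) (h0 : e ≠ 0) (hne : e ≠ E i)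
    (hl : E i * e = e) (hr : e * E i = e) :
    Frame S0 (Fin.cons e (Function.update E i (E i - e)) : Fin (r + 1) → Matrix (Fin n) (Fin n) K) := by
  have ho1 : ∀ j, j ≠ i → e * E j = 0 := by
    intro j hj
    rw [← hr, mul_assoc, hE.orth i j (Ne.symm hj), mul_zero]
  have ho2 : ∀ j, j ≠ i → E j * e = 0 := by
    intro j hj
    rw [← hl, ← mul_assoc, hE.orth j i hj, zero_mul]
  refine ⟨?_, ?_, ?_, ?_, ?_⟩
  · intro j
    refine Fin.cases he (fun j => ?_) j
    rw [Fin.cons_succ]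
    by_cases hj : j = i
    · subst hj; rw [Function.update_self]; exact S0.sub_mem (hE.mem _) he
    · rw [Function.update_of_ne hj]; exact hE.mem j
  · intro j
    refine Fin.cases hi (fun j => ?_) j
    rw [Fin.cons_succ]
    by_cases hj : j = i
    · subst hj; rw [Function.update_self, sub_mul, mul_sub, mul_sub, hE.idem, hl, hr, hi, sub_self, sub_zero]
    · rw [Function.update_of_ne hj]; exact hE.idem j
  · intro j
    refine Fin.cases h0 (fun j => ?_) j
    rw [Fin.cons_succ]
    by_cases hj : j = i
    · subst hj; rw [Function.update_self]; exact sub_ne_zero.2 hne.symm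
    · rw [Function.update_of_ne hj]; exact hE.ne j
  · intro j k
    refine Fin.cases ?_ (fun j => ?_) j <;> refine Fin.cases ?_ (fun k => ?_) k
    · intro h; exact absurd rfl h
    · intro _
      rw [Fin.cons_succ, Fin.cons_zero]
      by_cases hk : k = i
      · subst hk; rw [Function.update_self, mul_sub, hr, hi, sub_self]
      · rw [Function.update_of_ne hk]; exact ho1 k hk
    · intro _
      rw [Fin.cons_succ, Fin.cons_zero]
      by_cases hk : j = i
      · subst hk; rw [Function.update_self, sub_mul, hl, hi, sub_self]
      · rw [Function.update_of_ne hk]; exact ho2 j hk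
    · intro h
      have h : j ≠ k := fun e => h (congrArg Fin.succ e)
      rw [Fin.cons_succ, Fin.cons_succ]
      by_cases hj : j = i
      · subst hj
        rw [Function.update_self, Function.update_of_ne h.symm, sub_mul, hE.orth _ _ h, ho1 k h.symm, sub_zero]
      · by_cases hk : k = i
        · subst hk
          rw [Function.update_self, Function.update_of_ne h, mul_sub, hE.orth _ _ h, ho2 j h, sub_zero]
        · rw [Function.update_of_ne hj, Function.update_of_ne hk]; exact hE.orth _ _ h
  · rw [Fin.sum_univ_succ]
    simp only [Fin.cons_zero, Fin.cons_succ]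
    rw [Finset.sum_update_of_mem (Finset.mem_univ i), ← add_assoc, add_sub_cancel,
      ← Finset.erase_eq, Finset.add_sum_erase _ _ (Finset.mem_univ i), hE.sum]

theorem prim_of_max [IsAlgClosed K] (hJ : JA S0) {r : ℕ} {E : Fin r → Matrix (Fin n) (Fin n) K}
    (hE : Frame S0 E) (hmax : ∀ E' : Fin (r + 1) → Matrix (Fin n) (Fin n) K, ¬ Frame S0 E') (i : Fin r) :
    Prim S0 (E i) := by
  refine ⟨hE.mem i, hE.idem i, hE.ne i, ?_⟩
  set e := E i with hei
  have he : e ∈ S0 := hE.mem i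
  have hee : e * e = e := hE.idem i
  have hsys : Sys S0 (⊥ : Submodule K (Matrix (Fin n) (Fin n) K × Matrix (Fin n) (Fin n) K)) := by
    refine ⟨hJ.j0, ?_, ?_⟩
    · intro a _ x hx
      have : x = 0 := hx
      rw [this]; simp [act]
    · intro x hx y hy
      have hx : x = 0 := hx
      have hy : y = 0 := hy
      rw [hx, hy]; simp [br]
  have cl1 : ∀ b ∈ S0, e * b = b → b * e = b → ∃ μ : K, IsNilpotent (b - μ • e) := by
    intro b hb hl hr
    by_cases hn : IsNilpotent b
    · exact ⟨0, by simpa using hn⟩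
    obtain ⟨μ, hμ, v, hv0, hv⟩ := exists_eig b hn
    refine ⟨μ, ?_⟩
    by_contra hd
    obtain ⟨p, hp, hp0⟩ := fitting_idem _ hd
    set d := b - μ • e with hdd
    have hdS : d ∈ S0 := S0.sub_mem hb (S0.smul_mem _ he)
    have hdl : e * d = d := by rw [hdd, mul_sub, mul_smul_comm, hl, hee]
    have hdr : d * e = d := by rw [hdd, sub_mul, smul_mul_assoc, hr, hee]
    have hcom : Commute d (Polynomial.aeval d p) := by
      have h := (Commute.all Polynomial.X p).map (Polynomial.aeval d)
      rwa [Polynomial.aeval_X] at h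
    have hev : e *ᵥ v = v := by
      have : μ • (e *ᵥ v) = μ • v := by rw [← mulVec_smul, ← hv, mulVec_mulVec, hl]
      exact smul_right_injective _ hμ this
    have hdv : d *ᵥ v = 0 := by rw [hdd, sub_mulVec, smul_mulVec, hv, hev, sub_self]
    have hform : d * (d * Polynomial.aeval d p) = Polynomial.aeval d p * d * d := by
      rw [hcom.eq, ← mul_assoc, hcom.eq]
    refine hmax _ (hE.refine i (e := d * (d * Polynomial.aeval d p)) ?_ hp hp0 ?_ ?_ ?_)
    · have := hsys.poly hdS (Polynomial.X * p)
      rwa [map_mul, Polynomial.aeval_X] at this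
    · intro h
      have h2 : (d * (d * Polynomial.aeval d p)) *ᵥ v = 0 := by
        rw [hform, ← mulVec_mulVec, hdv, mulVec_zero]
      rw [h] at h2
      exact hv0 (hev ▸ h2)
    · rw [← mul_assoc]; change e * d * _ = _; rw [hdl]
    · rw [hform, mul_assoc]; change _ * (d * e) = _; rw [hdr]
  have hte : e.trace ≠ 0 := trace_idem_ne e hee (hE.ne i)
  have cl2 : ∀ b ∈ S0, e * b = b → b * e = b → b.trace = 0 → IsNilpotent b := by
    intro b hb hl hr ht
    obtain ⟨μ, hμ⟩ := cl1 b hb hl hr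
    have h := (Matrix.isNilpotent_trace_of_isNilpotent hμ).eq_zero
    rw [trace_sub, trace_smul, ht, zero_sub, neg_eq_zero, smul_eq_mul] at h
    rcases mul_eq_zero.1 h with h | h
    · rwa [h, zero_smul, sub_zero] at hμ
    · exact absurd h hte
  have cl3 : ∀ b ∈ S0, e * b = b → b * e = b → b.trace = 0 → b = 0 := by
    intro b hb hl hr ht
    have key : ∀ c ∈ S0, e * c = c → c * e = c → (b * c).trace = 0 := by
      have k0 : ∀ c ∈ S0, e * c = c → c * e = c → c.trace = 0 → (c * c).trace = 0 := by
        intro c hc hl hr ht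
        obtain ⟨k, hk⟩ := cl2 c hc hl hr ht
        have : IsNilpotent (c * c) := ⟨k, by rw [← pow_two, ← pow_mul, mul_comm, pow_mul, hk, pow_two, mul_zero]⟩
        exact (Matrix.isNilpotent_trace_of_isNilpotent this).eq_zero
      intro c hc hcl hcr
      set c0 := c - (c.trace / e.trace) • e with hc0
      have hc0S : c0 ∈ S0 := S0.sub_mem hc (S0.smul_mem _ he)
      have hc0l : e * c0 = c0 := by rw [hc0, mul_sub, mul_smul_comm, hcl, hee]
      have hc0r : c0 * e = c0 := by rw [hc0, sub_mul, smul_mul_assoc, hcr, hee]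
      have hc0t : c0.trace = 0 := by
        rw [hc0, trace_sub, trace_smul, smul_eq_mul, div_mul_cancel₀ _ hte, sub_self]
      have h1 := k0 (b + c0) (S0.add_mem hb hc0S) (by rw [mul_add, hl, hc0l])
        (by rw [add_mul, hr, hc0r]) (by rw [trace_add, ht, hc0t, add_zero])
      have h2 := k0 b hb hl hr ht
      have h3 := k0 c0 hc0S hc0l hc0r hc0t
      rw [add_mul, mul_add, mul_add, trace_add, trace_add, trace_add, h2, h3, trace_mul_comm c0 b, zero_add, add_zero,
        ← two_mul] at h1
      have h4 : (b * c0).trace = 0 := (mul_eq_zero.1 h1).resolve_left two_ne_zero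
      rw [hc0, mul_sub, mul_smul_comm, hr, trace_sub, trace_smul, ht, smul_zero, sub_zero] at h4
      exact h4
    apply hJ.nd b hb
    intro c hc
    have := key (e * c * e) (umem hJ.j0 he hc) (by rw [← mul_assoc, ← mul_assoc, hee])
      (by rw [mul_assoc, hee])
    rw [← mul_assoc, ← mul_assoc, hr, trace_mul_comm, ← mul_assoc, hl] at this
    exact this
  intro b hb
  refine ⟨(e * b * e).trace / e.trace, ?_⟩
  rw [← sub_eq_zero]
  apply cl3 _ (S0.sub_mem (umem hJ.j0 he hb) (S0.smul_mem _ he))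
  · rw [mul_sub, mul_smul_comm, hee, ← mul_assoc, ← mul_assoc, hee]
  · rw [sub_mul, smul_mul_assoc, hee, mul_assoc, hee]
  · rw [trace_sub, trace_smul, smul_eq_mul, div_mul_cancel₀ _ hte, sub_self]

structure PF (S0 : Submodule K (Matrix (Fin n) (Fin n) K)) {r : ℕ}
    (E : Fin r → Matrix (Fin n) (Fin n) K) : Prop where
  prim : ∀ i, Prim S0 (E i)
  orth : ∀ i j, i ≠ j → E i * E j = 0
  sum : ∑ i, E i = 1

theorem exists_PF [IsAlgClosed K] (hJ : JA S0) : ∃ (r : ℕ) (E : Fin r → Matrix (Fin n) (Fin n) K), PF S0 E := by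
  classical
  have hex : ∃ r : ℕ, ∃ E : Fin r → Matrix (Fin n) (Fin n) K, Frame S0 E := by
    by_cases h1 : (1 : Matrix (Fin n) (Fin n) K) = 0
    · exact ⟨0, Fin.elim0, ⟨fun i => i.elim0, fun i => i.elim0, fun i => i.elim0, fun i => i.elim0, by
        simp [h1]⟩⟩
    · exact ⟨1, fun _ => 1, ⟨fun _ => hJ.one, fun _ => one_mul 1, fun _ => h1,
        fun i j h => absurd (Subsingleton.elim i j) h, by simp⟩⟩
  obtain ⟨r0, hr0⟩ := hex
  have hP := Nat.findGreatest_spec (P := fun r => ∃ E : Fin r → Matrix (Fin n) (Fin n) K, Frame S0 E)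
    (n := n) (m := r0) (by obtain ⟨E, hE⟩ := hr0; exact hE.le) hr0
  obtain ⟨E, hE⟩ := hP
  refine ⟨_, E, fun i => prim_of_max hJ hE ?_ i, hE.orth, hE.sum⟩
  intro E' hE'
  have := Nat.le_findGreatest (P := fun r => ∃ E : Fin r → Matrix (Fin n) (Fin n) K, Frame S0 E) hE'.le ⟨E', hE'⟩
  omega
end

section
set_option linter.unusedSectionVars false
variable {K : Type*} [Field K] [CharZero K] {n : ℕ} {S0 : Submodule K (Matrix (Fin n) (Fin n) K)}
    {S1 : Submodule K (Matrix (Fin n) (Fin n) K × Matrix (Fin n) (Fin n) K)}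
    {p q a b c d : Matrix (Fin n) (Fin n) K}

structure PA (S0 : Submodule K (Matrix (Fin n) (Fin n) K)) (p q a : Matrix (Fin n) (Fin n) K) : Prop where
  mem : a ∈ S0
  pl : p * a = a * q
  ql : q * a = a * p
  tot : p * a + q * a = a

theorem PA.symm (h : PA S0 p q a) : PA S0 q p a := ⟨h.mem, h.ql, h.pl, by rw [add_comm, h.tot]⟩

theorem PA.add (h : PA S0 p q a) (h' : PA S0 p q b) : PA S0 p q (a + b) :=
  ⟨S0.add_mem h.mem h'.mem, by rw [mul_add, add_mul, h.pl, h'.pl], by rw [mul_add, add_mul, h.ql, h'.ql], by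
    rw [mul_add, mul_add, add_add_add_comm, h.tot, h'.tot]⟩

theorem PA.smul (h : PA S0 p q a) (c : K) : PA S0 p q (c • a) :=
  ⟨S0.smul_mem c h.mem, by rw [mul_smul_comm, smul_mul_assoc, h.pl], by
    rw [mul_smul_comm, smul_mul_assoc, h.ql], by rw [mul_smul_comm, mul_smul_comm, ← smul_add, h.tot]⟩

theorem PA.of (hJ : JA S0) (hp : Prim S0 p) (hq : Prim S0 q) (hpq : p * q = 0) (hqp : q * p = 0) (hc : c ∈ S0) :
    PA S0 p q (p * c * q + q * c * p) := by
  have e1 : p * (p * c * q + q * c * p) = p * c * q := by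
    rw [mul_add, ← mul_assoc, ← mul_assoc, hp.idem, ← mul_assoc, ← mul_assoc, hpq]; simp
  have e2 : q * (p * c * q + q * c * p) = q * c * p := by
    rw [mul_add, ← mul_assoc, ← mul_assoc, hqp, ← mul_assoc, ← mul_assoc, hq.idem]; simp
  have e3 : (p * c * q + q * c * p) * p = q * c * p := by
    rw [add_mul, mul_assoc _ q, hqp, mul_assoc _ p, hp.idem]; simp
  have e4 : (p * c * q + q * c * p) * q = p * c * q := by
    rw [add_mul, mul_assoc _ q, hq.idem, mul_assoc _ p, hpq]; simp
  exact ⟨trip hJ.j0 hp.mem hc hq.mem, by rw [e1, e4], by rw [e2, e3], by rw [e1, e2]⟩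

theorem PA.sq (hJ : JA S0) (hp : Prim S0 p) (hq : Prim S0 q) (h : PA S0 p q a) :
    ∃ f : K, a * a = f • (p + q) := by
  have haa : a * a ∈ S0 := half_mem S0 (hJ.j0 a h.mem a h.mem) rfl
  obtain ⟨α, hα⟩ := hp.prim _ haa
  obtain ⟨β, hβ⟩ := hq.prim _ haa
  have c1 : p * (a * a) = a * a * p := by
    rw [← mul_assoc, h.pl, mul_assoc, h.ql, mul_assoc]
  have c2 : q * (a * a) = a * a * q := by
    rw [← mul_assoc, h.ql, mul_assoc, h.pl, mul_assoc]
  have e1 : p * (a * a) = α • p := by rw [← hα]; have := hp.idem; grind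
  have e2 : q * (a * a) = β • q := by rw [← hβ]; have := hq.idem; grind
  have e3 : a * a = α • p + β • q := by
    rw [← e1, ← e2, ← mul_assoc, ← mul_assoc, ← add_mul, h.tot]
  have e4 : (α - β) • (p * a) = 0 := by
    have l1 : p * a * (a * a) = α • (p * a) := by
      rw [mul_assoc, ← mul_assoc a, ← mul_assoc, e1, smul_mul_assoc]
    have l2 : p * a * (a * a) = β • (p * a) := by
      rw [h.pl, mul_assoc, e2, mul_smul_comm]
    rw [sub_smul, ← l1, ← l2, sub_self]
  rcases smul_eq_zero.1 e4 with h0 | h0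
  · rw [sub_eq_zero.1 h0] at e3
    exact ⟨β, by rw [smul_add, ← e3]⟩
  · have a0 : α • p = 0 := by rw [← e1, ← mul_assoc, h0, zero_mul]
    have b0 : β • q = 0 := by rw [← e2, c2, mul_assoc, ← h.pl, h0, mul_zero]
    exact ⟨0, by rw [e3, a0, b0]; simp⟩

theorem PA.polar (hJ : JA S0) (hp : Prim S0 p) (hq : Prim S0 q) (h : PA S0 p q a) (h' : PA S0 p q b) :
    ∃ f : K, a * b + b * a = f • (p + q) := by
  obtain ⟨f1, h1⟩ := h.sq hJ hp hq
  obtain ⟨f2, h2⟩ := h'.sq hJ hp hq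
  obtain ⟨f3, h3⟩ := (h.add h').sq hJ hp hq
  refine ⟨f3 - f1 - f2, ?_⟩
  rw [sub_smul, sub_smul, ← h3, ← h1, ← h2]
  noncomm_ring

theorem PA.ndeg (hJ : JA S0) (hp : Prim S0 p) (hq : Prim S0 q) (hpq : p * q = 0) (hqp : q * p = 0)
    (h : PA S0 p q a) (h0 : ∀ b, PA S0 p q b → (a * b).trace = 0) : a = 0 := by
  apply hJ.nd a h.mem
  intro c hc
  have := h0 _ (PA.of hJ hp hq hpq hqp hc)
  have e1 : (a * (p * c * q)).trace = (q * a * c).trace := by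
    rw [← mul_assoc, trace_mul_comm]
    congr 1
    have := hq.idem
    have := h.ql
    grind
  have e2 : (a * (q * c * p)).trace = (p * a * c).trace := by
    rw [← mul_assoc, trace_mul_comm]
    congr 1
    have := hp.idem
    have := h.pl
    grind
  rw [mul_add, trace_add, e1, e2, ← trace_add, ← add_mul, add_comm, h.tot] at this
  exact this

theorem PA.exists_unit [IsAlgClosed K] (hJ : JA S0) (hp : Prim S0 p) (hq : Prim S0 q) (hpq : p * q = 0) (hqp : q * p = 0)
    (h : PA S0 p q a) (h0 : a ≠ 0) : ∃ u, PA S0 p q u ∧ u * u = p + q := by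
  by_cases hz : ∀ b, PA S0 p q b → b * b = 0
  · exfalso
    apply h0
    apply h.ndeg hJ hp hq hpq hqp
    intro b hb
    have h1 := hz _ (h.add hb)
    rw [add_mul, mul_add, mul_add, hz _ h, hz _ hb, zero_add, add_zero] at h1
    have h2 := congrArg Matrix.trace h1
    rw [trace_add, trace_mul_comm b a, trace_zero, ← two_mul] at h2
    exact (mul_eq_zero.1 h2).resolve_left two_ne_zero
  · push Not at hz
    obtain ⟨b, hb, hb0⟩ := hz
    obtain ⟨f, hf⟩ := hb.sq hJ hp hq
    have hf0 : f ≠ 0 := by rintro rfl; rw [zero_smul] at hf; exact hb0 hf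
    obtain ⟨s, hs⟩ := IsAlgClosed.exists_pow_nat_eq f (n := 2) (by norm_num)
    have hs0 : s ≠ 0 := by rintro rfl; apply hf0; rw [← hs]; simp
    refine ⟨s⁻¹ • b, hb.smul _, ?_⟩
    rw [smul_mul_assoc, mul_smul_comm, smul_smul, hf, smul_smul, ← hs]
    have : s⁻¹ * s⁻¹ * s ^ 2 = 1 := by field_simp
    rw [this, one_smul]

theorem PA.left0 (h : PA S0 p q a) {s : Matrix (Fin n) (Fin n) K} (h1 : s * p = 0) (h2 : s * q = 0) : s * a = 0 := by
  rw [← h.tot, mul_add, ← mul_assoc, ← mul_assoc, h1, h2]; simp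

theorem PA.right0 (h : PA S0 p q a) {s : Matrix (Fin n) (Fin n) K} (h1 : p * s = 0) (h2 : q * s = 0) : a * s = 0 := by
  rw [← h.tot, add_mul, h.pl, h.ql, mul_assoc, mul_assoc, h1, h2]; simp

/-- product of Peirce components -/
theorem PA.mul (hJ : JA S0) {s : Matrix (Fin n) (Fin n) K} (hp : p * p = p) (hs : s * s = s)
    (hpq : p * q = 0) (hqp : q * p = 0) (hps : p * s = 0) (hsp : s * p = 0)
    (hqs : q * s = 0) (hsq : s * q = 0) (h : PA S0 p q a) (h' : PA S0 q s b) :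
    PA S0 p s (a * b + b * a) := by
  have pb : p * b = 0 := h'.left0 hpq hps
  have bp : b * p = 0 := h'.right0 hqp hsp
  have sa : s * a = 0 := h.left0 hsp hsq
  have as : a * s = 0 := h.right0 hps hqs
  have e1 : p * (a * b + b * a) = a * b := by
    rw [mul_add, ← mul_assoc, ← mul_assoc, pb, zero_mul, add_zero]
    conv_rhs => rw [← h'.tot, mul_add, ← mul_assoc, ← mul_assoc, as, ← h.pl]
    simp
  have e2 : s * (a * b + b * a) = b * a := by
    rw [mul_add, ← mul_assoc, ← mul_assoc, sa, zero_mul, zero_add]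
    conv_rhs => rw [← h'.tot, add_mul, h'.pl, mul_assoc b s, sa, mul_zero, zero_add]
  have e3 : (a * b + b * a) * s = a * b := by
    rw [add_mul, mul_assoc, ← h'.pl, mul_assoc b, as, mul_zero, add_zero]
    conv_rhs => rw [← h'.tot, mul_add, ← mul_assoc a s, as, zero_mul, add_zero]
  have e4 : (a * b + b * a) * p = b * a := by
    rw [add_mul, mul_assoc, bp, mul_zero, zero_add, mul_assoc, ← h.ql]
    conv_rhs => rw [← h.tot, mul_add, ← mul_assoc b p, bp, zero_mul, zero_add]
  exact ⟨hJ.j0 a h.mem b h'.mem, by rw [e1, e3], by rw [e2, e4], by rw [e1, e2]⟩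
end

section
set_option linter.unusedSectionVars false
variable {K : Type*} [Field K] [CharZero K] {n : ℕ} {S0 : Submodule K (Matrix (Fin n) (Fin n) K)}
    {S1 : Submodule K (Matrix (Fin n) (Fin n) K × Matrix (Fin n) (Fin n) K)}
    {p q a b c d : Matrix (Fin n) (Fin n) K} {r : ℕ} {E : Fin r → Matrix (Fin n) (Fin n) K}

theorem PF.conn [IsAlgClosed K] (hJ : JA S0) (hE : PF S0 E) (i j : Fin r) (hij : i ≠ j) :
    ∃ u, PA S0 (E i) (E j) u ∧ u * u = E i + E j := by
  classical
  let Q : Finset (Fin r) := Finset.univ.filter (fun j => j = i ∨ ∃ a, PA S0 (E i) (E j) a ∧ a ≠ 0)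
  have hQ : ∀ j, j ∈ Q ↔ j = i ∨ ∃ a, PA S0 (E i) (E j) a ∧ a ≠ 0 := by intro j; simp [Q]
  have key : ∀ a ∈ S0, ∀ j ∈ Q, ∀ l ∉ Q, E j * a * E l = 0 ∧ E l * a * E j = 0 := by
    intro a ha j hj l hl
    have hjl : j ≠ l := fun h => hl (h ▸ hj)
    have hil : i ≠ l := by rintro rfl; exact hl ((hQ i).2 (Or.inl rfl))
    have hb := PA.of hJ (hE.prim j) (hE.prim l) (hE.orth j l hjl) (hE.orth l j hjl.symm) ha
    set b := E j * a * E l + E l * a * E j with hbd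
    have e1 : E j * b = E j * a * E l := by
      rw [hbd, mul_add, ← mul_assoc, ← mul_assoc, (hE.prim j).idem, ← mul_assoc, ← mul_assoc,
        hE.orth j l hjl]; simp
    have e2 : E l * b = E l * a * E j := by
      rw [hbd, mul_add, ← mul_assoc, ← mul_assoc, hE.orth l j hjl.symm, ← mul_assoc, ← mul_assoc,
        (hE.prim l).idem]; simp
    have hl0 : ∀ b', PA S0 (E i) (E l) b' → b' = 0 := by
      intro b' hb'
      by_contra h0
      exact hl ((hQ l).2 (Or.inr ⟨b', hb', h0⟩))
    suffices hb0 : b = 0 by rw [← e1, ← e2, hb0]; simp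
    by_cases hji : j = i
    · subst hji; exact hl0 b hb
    · obtain ⟨x', hx', hx0⟩ := ((hQ j).1 hj).resolve_left hji
      have hij : i ≠ j := Ne.symm hji
      obtain ⟨x, hx, hxx⟩ := hx'.exists_unit hJ (hE.prim i) (hE.prim j) (hE.orth i j hij) (hE.orth j i hji) hx0
      have h0 := hl0 _ (PA.mul hJ (hE.prim i).idem (hE.prim l).idem (hE.orth i j hij) (hE.orth j i hji)
        (hE.orth i l hil) (hE.orth l i hil.symm) (hE.orth j l hjl) (hE.orth l j hjl.symm) hx hb)
      have hib : E i * b = 0 := hb.left0 (hE.orth i j hij) (hE.orth i l hil)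
      have hbi : b * E i = 0 := hb.right0 (hE.orth j i hji) (hE.orth l i hil.symm)
      have f1 : E i * x * b = 0 := by
        have := congrArg (fun z => E i * z) h0
        simp only [mul_add, ← mul_assoc, hib, zero_mul, add_zero, mul_zero] at this
        exact this
      have f2 : b * x * E i = 0 := by
        have := congrArg (fun z => z * E i) h0
        simp only [add_mul, mul_assoc, hbi, zero_mul, zero_add, mul_zero] at this
        rwa [← mul_assoc] at this
      have g1 : E j * b = 0 := by
        have : x * (E i * x * b) = E j * b := by
          rw [hx.pl, ← mul_assoc, ← mul_assoc, hxx, add_mul, hE.orth i j hij, (hE.prim j).idem, zero_add]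
        rw [← this, f1, mul_zero]
      have g2 : b * E j = 0 := by
        have : b * x * E i * x = b * E j := by
          rw [mul_assoc b, ← hx.ql, mul_assoc, mul_assoc, hxx, mul_add, hE.orth j i hji, (hE.prim j).idem, zero_add]
        rw [← this, f2, zero_mul]
      rw [← hb.tot, hb.ql, g1, g2, add_zero]
  have hcom : ∀ a ∈ S0, (∑ j ∈ Q, E j) * a = a * ∑ j ∈ Q, E j := by
    intro a ha
    have hs : ∑ j ∈ Q, E j + ∑ j ∈ Qᶜ, E j = 1 := by rw [Finset.sum_add_sum_compl, hE.sum]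
    have h1 : (∑ j ∈ Q, E j) * a * ∑ j ∈ Qᶜ, E j = 0 := by
      rw [Finset.sum_mul, Finset.sum_mul]
      refine Finset.sum_eq_zero (fun j hj => ?_)
      rw [Finset.mul_sum]
      exact Finset.sum_eq_zero (fun l hl => (key a ha j hj l (Finset.mem_compl.1 hl)).1)
    have h2 : (∑ j ∈ Qᶜ, E j) * a * ∑ j ∈ Q, E j = 0 := by
      rw [Finset.sum_mul, Finset.sum_mul]
      refine Finset.sum_eq_zero (fun j hj => ?_)
      rw [Finset.mul_sum]
      exact Finset.sum_eq_zero (fun l hl => (key a ha l hl j (Finset.mem_compl.1 hj)).2)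
    set c := ∑ j ∈ Q, E j
    have hc' : ∑ j ∈ Qᶜ, E j = 1 - c := by rw [← hs]; simp
    rw [hc', mul_sub, mul_one, sub_eq_zero] at h1
    rw [hc', sub_mul, one_mul, sub_mul, sub_eq_zero] at h2
    rw [h1, h2]
  obtain ⟨κ, hκ⟩ := hJ.cent _ hcom
  have hiQ : i ∈ Q := (hQ i).2 (Or.inl rfl)
  have hEi : ∀ l, l ∈ Q → E l * ∑ j ∈ Q, E j = E l := by
    intro l hl
    rw [Finset.mul_sum, Finset.sum_eq_single l (fun j _ hj => hE.orth l j hj.symm) (fun h => absurd hl h), (hE.prim l).idem]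
  have hκ1 : κ = 1 := by
    have := hEi i hiQ
    rw [hκ, mul_smul_comm, mul_one] at this
    have h : (κ - 1) • E i = 0 := by rw [sub_smul, this, one_smul, sub_self]
    exact sub_eq_zero.1 ((smul_eq_zero.1 h).resolve_right (hE.prim i).ne)
  rw [hκ1, one_smul] at hκ
  have hjQ : j ∈ Q := by
    by_contra hj
    have : E j * ∑ l ∈ Q, E l = 0 := by
      rw [Finset.mul_sum]
      exact Finset.sum_eq_zero (fun l hl => hE.orth j l (fun h => hj (h ▸ hl)))
    rw [hκ, mul_one] at this
    exact (hE.prim j).ne this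
  obtain ⟨a, ha, ha0⟩ := ((hQ j).1 hjQ).resolve_left hij.symm
  exact ha.exists_unit hJ (hE.prim i) (hE.prim j) (hE.orth i j hij) (hE.orth j i hij.symm) ha0

structure Units (S0 : Submodule K (Matrix (Fin n) (Fin n) K)) (E : Fin r → Matrix (Fin n) (Fin n) K) (o : Fin r)
    (u : Fin r → Matrix (Fin n) (Fin n) K) : Prop where
  uo : u o = E o
  mem : ∀ i, u i ∈ S0
  l : ∀ i, E o * u i = u i * E i
  r : ∀ i, E i * u i = u i * E o
  c : ∀ i, u i * E o * u i = E i
  d : ∀ i, u i * E i * u i = E o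
  pa : ∀ i, i ≠ o → PA S0 (E o) (E i) (u i)

theorem PF.units [IsAlgClosed K] (hJ : JA S0) (hE : PF S0 E) (o : Fin r) : ∃ u, Units S0 E o u := by
  classical
  choose! v hv hvv using fun i (h : i ≠ o) => hE.conn hJ o i h.symm
  let u : Fin r → Matrix (Fin n) (Fin n) K := fun i => if i = o then E o else v i
  have h1 : u o = E o := by simp [u]
  have h2 : ∀ i, i ≠ o → u i = v i := fun i hi => by simp [u, hi]
  have io := (hE.prim o).idem
  refine ⟨u, h1, ?_, ?_, ?_, ?_, ?_, ?_⟩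
  · intro i
    by_cases hi : i = o
    · subst hi; rw [h1]; exact (hE.prim _).mem
    · rw [h2 i hi]; exact (hv i hi).mem
  · intro i
    by_cases hi : i = o
    · subst hi; rw [h1]
    · rw [h2 i hi]; exact (hv i hi).pl
  · intro i
    by_cases hi : i = o
    · subst hi; rw [h1]
    · rw [h2 i hi]; exact (hv i hi).ql
  · intro i
    by_cases hi : i = o
    · subst hi; rw [h1, io, io]
    · rw [h2 i hi, ← (hv i hi).ql, mul_assoc, hvv i hi, mul_add, hE.orth i o hi, (hE.prim i).idem, zero_add]
  · intro i
    by_cases hi : i = o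
    · subst hi; rw [h1, io, io]
    · rw [h2 i hi, ← (hv i hi).pl, mul_assoc, hvv i hi, mul_add, hE.orth o i (Ne.symm hi), (hE.prim o).idem, add_zero]
  · intro i hi
    rw [h2 i hi]; exact hv i hi

theorem lemmaM [IsAlgClosed K] (hJ : JA S0) (hE : PF S0 E) (o : Fin r) (hl : E o * q = q) (hr : q * E o = q)
    (hq : ∀ b ∈ S0, ∀ d ∈ S0, q * (E o * b * d * E o) = (E o * b * d * E o) * q) : ∃ κ : K, q = κ • E o := by
  classical
  obtain ⟨u, hu⟩ := hE.units hJ o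
  have io := (hE.prim o).idem
  have hw : ∀ c ∈ S0, ∀ i j, q * (E o * u i * c * u j * E o) = (E o * u i * c * u j * E o) * q := by
    intro c hc i j
    by_cases hij : i = j
    · subst hij
      obtain ⟨μ, hμ⟩ := (hE.prim o).prim _ (umem hJ.j0 (hu.mem i) hc)
      have : E o * u i * c * u i * E o = μ • E o := by rw [← hμ]; simp only [mul_assoc]
      rw [this, mul_smul_comm, smul_mul_assoc, hl, hr]
    by_cases hi : i = o
    · subst hi
      rw [hu.uo, io]
      exact hq c hc _ (hu.mem j)
    by_cases hj : j = o
    · subst hj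
      rw [hu.uo]
      have : E j * u i * c * E j * E j = E j * u i * c * E j := by rw [mul_assoc _ (E j), io]
      rw [this]
      exact hq _ (hu.mem i) c hc
    have hc' := PA.of hJ (hE.prim i) (hE.prim j) (hE.orth i j hij) (hE.orth j i (Ne.symm hij)) hc
    set c' := E i * c * E j + E j * c * E i with hcd
    have hoc : E o * c' = 0 := hc'.left0 (hE.orth o i (Ne.symm hi)) (hE.orth o j (Ne.symm hj))
    have e1 : E i * c' = E i * c * E j := by
      rw [hcd, mul_add, ← mul_assoc, ← mul_assoc, (hE.prim i).idem, ← mul_assoc, ← mul_assoc,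
        hE.orth i j hij]; simp
    have hb := hJ.j0 _ (hu.mem i) _ hc'.mem
    have e2 : E o * (u i * c' + c' * u i) * u j * E o = E o * u i * c * u j * E o := by
      have l1 := hu.l i
      have l2 := hu.r j
      rw [mul_add, ← mul_assoc (E o) c', hoc, zero_mul, add_zero]
      clear_value c'
      have e3 : E o * (u i * c') * u j * E o = u i * (E i * c') * u j * E o := by
        rw [← mul_assoc (E o), l1]; simp only [mul_assoc]
      rw [e3, e1, l1]
      have e4 : u i * (E i * c * E j) * u j * E o = u i * E i * c * (E j * u j) * E o := by simp only [mul_assoc]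
      rw [e4, l2]
      have e5 : u i * E i * c * (u j * E o) * E o = u i * E i * c * u j * (E o * E o) := by simp only [mul_assoc]
      rw [e5, io]
    rw [← e2]
    exact hq _ hb _ (hu.mem j)
  have key : ∀ c ∈ S0, (∑ i, u i * q * u i) * c = c * ∑ i, u i * q * u i := by
    intro c hc
    calc (∑ i, u i * q * u i) * c = (∑ i, u i * q * u i) * c * ∑ j, E j := by rw [hE.sum, mul_one]
      _ = ∑ i, ∑ j, (u i * q * u i) * c * E j := by
        rw [Finset.sum_mul, Finset.sum_mul]
        exact Finset.sum_congr rfl (fun i _ => Finset.mul_sum _ _ _)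
      _ = ∑ i, ∑ j, u i * (q * (E o * u i * c * u j * E o)) * u j := by
        refine Finset.sum_congr rfl (fun i _ => Finset.sum_congr rfl (fun j _ => ?_))
        rw [← hu.c j]
        have this : ∀ z, q * (E o * z) = q * z := fun z => by rw [← mul_assoc, hr]
        simp only [mul_assoc, this]
      _ = ∑ i, ∑ j, E i * (c * (u j * q * u j)) := by
        refine Finset.sum_congr rfl (fun i _ => Finset.sum_congr rfl (fun j _ => ?_))
        rw [hw c hc i j, ← hu.c i]
        have this : ∀ z, E o * (q * z) = q * z := fun z => by rw [← mul_assoc, hl]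
        simp only [mul_assoc, this]
      _ = (∑ i, E i) * (c * ∑ j, u j * q * u j) := by
        rw [Finset.sum_mul]
        refine Finset.sum_congr rfl (fun i _ => ?_)
        rw [Finset.mul_sum, Finset.mul_sum]
      _ = c * ∑ i, u i * q * u i := by rw [hE.sum, one_mul]
  obtain ⟨κ, hκ⟩ := hJ.cent _ key
  refine ⟨κ, ?_⟩
  have h := congrArg (fun z => E o * z) hκ
  simp only [Finset.mul_sum, mul_smul_comm, mul_one] at h
  rw [← h, Finset.sum_eq_single o]
  · rw [hu.uo, ← mul_assoc, ← mul_assoc, io, hl, hr]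
  · intro i _ hi
    rw [← mul_assoc, ← mul_assoc, hu.l i, ← hl, mul_assoc (u i), ← mul_assoc (E i), hE.orth i o hi]
    simp
  · intro h; exact absurd (Finset.mem_univ o) h
end

section
set_option linter.unusedSectionVars false
variable {K : Type*} [Field K] [CharZero K] {n : ℕ} {S0 : Submodule K (Matrix (Fin n) (Fin n) K)}
    {S1 : Submodule K (Matrix (Fin n) (Fin n) K × Matrix (Fin n) (Fin n) K)}
    {p q a b c d : Matrix (Fin n) (Fin n) K} {r : ℕ} {E : Fin r → Matrix (Fin n) (Fin n) K}

def paSub (S0 : Submodule K (Matrix (Fin n) (Fin n) K)) (p q : Matrix (Fin n) (Fin n) K) :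
    Submodule K (Matrix (Fin n) (Fin n) K) where
  carrier := {a | PA S0 p q a}
  zero_mem' := ⟨S0.zero_mem, by simp, by simp, by simp⟩
  add_mem' := fun h h' => h.add h'
  smul_mem' := fun c _ h => h.smul c

theorem PA.basis (hJ : JA S0) (hp : Prim S0 p) (hq : Prim S0 q) (hpq : p * q = 0) (hqp : q * p = 0) :
    ∃ (m : ℕ) (v : Fin m → Matrix (Fin n) (Fin n) K), (∀ i, PA S0 p q (v i)) ∧
      (∀ b, PA S0 p q b → ∃ c : Fin m → K, b = ∑ i, c i • v i) ∧
      (∀ i, ∃ l : K, l ≠ 0 ∧ v i * v i = l • (p + q)) ∧ ∀ i j, i ≠ j → v i * v j = - (v j * v i) := by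
  have htr : (p + q).trace ≠ 0 := by
    apply trace_idem_ne
    · unfold IsIdempotentElem
      simp only [mul_add, add_mul, hpq, hqp, hp.idem, hq.idem, zero_add, add_zero]
    · intro h
      apply hp.ne
      have := congrArg (fun z => p * z) h
      simpa [mul_add, hp.idem, hpq] using this
  have : Invertible (2 : K) := invertibleOfNonzero two_ne_zero
  obtain ⟨v, hv⟩ := LinearMap.BilinForm.exists_orthogonal_basis (B := trForm (paSub S0 p q))
    ⟨fun a b => trace_mul_comm (a : Matrix (Fin n) (Fin n) K) b⟩
  have hsep : LinearMap.SeparatingLeft (trForm (paSub S0 p q)) := by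
    intro a ha
    apply Subtype.ext
    exact PA.ndeg hJ hp hq hpq hqp a.2 (fun b hb => ha ⟨b, hb⟩)
  refine ⟨_, fun i => (v i : Matrix (Fin n) (Fin n) K), fun i => (v i).2, ?_, ?_, ?_⟩
  · intro b hb
    refine ⟨fun i => v.repr ⟨b, hb⟩ i, ?_⟩
    have := congrArg Subtype.val (v.sum_repr ⟨b, hb⟩)
    simp only [Submodule.coe_sum, Submodule.coe_smul] at this
    exact this.symm
  · intro i
    obtain ⟨f, hf⟩ := PA.sq hJ hp hq (v i).2
    refine ⟨f, ?_, hf⟩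
    rintro rfl
    apply hv.not_isOrtho_basis_self_of_separatingLeft hsep i
    change ((v i : Matrix (Fin n) (Fin n) K) * v i).trace = 0
    rw [hf]; simp
  · intro i j hij
    obtain ⟨f, hf⟩ := PA.polar hJ hp hq (v i).2 (v j).2
    have h1 : ((v i : Matrix (Fin n) (Fin n) K) * v j).trace = 0 := hv hij
    have h2 := congrArg trace hf
    rw [trace_add, trace_mul_comm (v j : Matrix (Fin n) (Fin n) K), h1, add_zero, trace_smul, smul_eq_mul] at h2
    have h3 : f = 0 := (mul_eq_zero.1 h2.symm).resolve_right htr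
    rw [h3, zero_smul] at hf
    exact eq_neg_of_add_eq_zero_left hf

structure Good (e : Matrix (Fin n) (Fin n) K) (T : Submodule K (Fin n → K)) (π : Matrix (Fin n) (Fin n) K) : Prop where
  l : e * π = π
  r : π * e = π
  im : ∀ v, π *ᵥ v ∈ T
  id : ∀ v ∈ T, π *ᵥ v = v

theorem Good.exists {e : Matrix (Fin n) (Fin n) K} (he : e * e = e) (T : Submodule K (Fin n → K)) (hT : ∀ v ∈ T, e *ᵥ v = v) :
    ∃ π, Good e T π := by
  obtain ⟨f, hf⟩ := T.subtype.exists_leftInverse_of_injective (by simp)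
  let π : Matrix (Fin n) (Fin n) K := LinearMap.toMatrix' (T.subtype ∘ₗ f)
  have h1 : ∀ v, π *ᵥ v = f v := fun v => by simp only [π, LinearMap.toMatrix'_mulVec]; simp
  have h2 : ∀ v ∈ T, π *ᵥ v = v := by
    intro v hv
    rw [h1]
    have := LinearMap.congr_fun hf ⟨v, hv⟩
    simp only [LinearMap.comp_apply, Submodule.subtype_apply, LinearMap.id_apply] at this
    rw [this]
  have h3 : ∀ v, π *ᵥ v ∈ T := fun v => by rw [h1]; exact (f v).2
  have hE : ∀ A B : Matrix (Fin n) (Fin n) K, (∀ v, A *ᵥ v = B *ᵥ v) → A = B := by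
    intro A B h
    exact Matrix.ext_of_mulVec_single (fun i => h _)
  refine ⟨π * e, ?_, ?_, ?_, ?_⟩
  · apply hE
    intro v
    rw [← mulVec_mulVec, ← mulVec_mulVec, hT _ (h3 _)]
  · rw [mul_assoc, he]
  · intro v
    rw [← mulVec_mulVec]; exact h3 _
  · intro v hv
    rw [← mulVec_mulVec, hT v hv, h2 v hv]

theorem Good.avg {e : Matrix (Fin n) (Fin n) K} {T : Submodule K (Fin n → K)} {ι : Type*} [Finite ι] (g : ι → Matrix (Fin n) (Fin n) K)
    (he : e * e = e)
    (hT : ∀ v ∈ T, e *ᵥ v = v) (hl : ∀ i, e * g i = g i) (hr : ∀ i, g i * e = g i)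
    (hgT : ∀ i, ∀ v ∈ T, g i *ᵥ v ∈ T)
    (hsq : ∀ i, ∃ l : K, l ≠ 0 ∧ g i * g i = l • e) (hc : ∀ i j, g i * g j = g j * g i ∨ g i * g j = - (g j * g i)) :
    ∃ π, Good e T π ∧ ∀ i, g i * π = π * g i := by
  classical
  have := Fintype.ofFinite ι
  suffices h : ∀ s : Finset ι, ∃ π, Good e T π ∧ ∀ i ∈ s, g i * π = π * g i by
    obtain ⟨π, h1, h2⟩ := h Finset.univ
    exact ⟨π, h1, fun i => h2 i (Finset.mem_univ i)⟩
  intro s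
  induction s using Finset.induction_on with
  | empty =>
    obtain ⟨π, h⟩ := Good.exists he T hT
    exact ⟨π, h, by simp⟩
  | insert k s hk ih =>
    obtain ⟨π, h, hs⟩ := ih
    obtain ⟨l, hl0, hkk⟩ := hsq k
    refine ⟨(2:K)⁻¹ • (π + l⁻¹ • (g k * π * g k)), ⟨?_, ?_, ?_, ?_⟩, ?_⟩
    · rw [mul_smul_comm, mul_add, mul_smul_comm, ← mul_assoc, ← mul_assoc, hl, h.l]
    · rw [smul_mul_assoc, add_mul, smul_mul_assoc, mul_assoc _ (g k), hr, h.r]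
    · intro v
      rw [smul_mulVec, add_mulVec, smul_mulVec]
      refine T.smul_mem _ (T.add_mem (h.im v) (T.smul_mem _ ?_))
      rw [← mulVec_mulVec, ← mulVec_mulVec]
      exact hgT _ _ (h.im _)
    · intro v hv
      rw [smul_mulVec, add_mulVec, smul_mulVec, ← mulVec_mulVec, ← mulVec_mulVec, h.id v hv,
        h.id _ (hgT k v hv), mulVec_mulVec, hkk, smul_mulVec, hT v hv, smul_smul, inv_mul_cancel₀ hl0, one_smul,
        ← two_smul K v, smul_smul, inv_mul_cancel₀ two_ne_zero, one_smul]
    · intro i hi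
      rw [mul_smul_comm, smul_mul_assoc, mul_add, add_mul, mul_smul_comm, smul_mul_assoc]
      congr 1
      rcases Finset.mem_insert.1 hi with rfl | hi
      · have e1 : g i * (g i * π * g i) = l • (π * g i) := by
          rw [← mul_assoc, ← mul_assoc, hkk, smul_mul_assoc, smul_mul_assoc, h.l]
        have e2 : g i * π * g i * g i = l • (g i * π) := by
          rw [mul_assoc, hkk, mul_smul_comm, mul_assoc, h.r]
        rw [e1, e2, smul_smul, smul_smul, inv_mul_cancel₀ hl0, one_smul, one_smul, add_comm]
      · have hi' := hs i hi
        rw [hi']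
        congr 2
        rcases hc i k with h1 | h1
        · rw [← mul_assoc, ← mul_assoc, h1, mul_assoc (g k), hi', mul_assoc (g k * π), ← h1]
          simp only [mul_assoc]
        · have h2 : g k * g i = - (g i * g k) := by rw [h1, neg_neg]
          rw [← mul_assoc, ← mul_assoc, h1, neg_mul, neg_mul, mul_assoc (g k), hi', mul_assoc (g k * π), h2]
          simp only [mul_assoc, mul_neg]

theorem irr [IsAlgClosed K] (hJ : JA S0) (hE : PF S0 E) (o : Fin r) (T : Submodule K (Fin n → K))
    (hT : ∀ v ∈ T, E o *ᵥ v = v)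
    (hst : ∀ b ∈ S0, ∀ d ∈ S0, ∀ v ∈ T, (E o * b * d * E o) *ᵥ v ∈ T) :
    T = ⊥ ∨ ∀ v, E o *ᵥ v ∈ T := by
  classical
  have io := (hE.prim o).idem
  suffices h : ∃ π, Good (E o) T π ∧ ∀ b ∈ S0, ∀ d ∈ S0, π * (E o * b * d * E o) = (E o * b * d * E o) * π by
    obtain ⟨π, h1, h2⟩ := h
    obtain ⟨κ, hκ⟩ := lemmaM hJ hE o h1.l h1.r h2
    by_cases h0 : κ = 0
    · left
      rw [h0, zero_smul] at hκ
      rw [Submodule.eq_bot_iff]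
      intro v hv
      rw [← h1.id v hv, hκ, zero_mulVec]
    · right
      intro v
      have := T.smul_mem κ⁻¹ (h1.im v)
      rwa [hκ, smul_mulVec, smul_smul, inv_mul_cancel₀ h0, one_smul] at this
  -- decompose
  have hdec : ∀ b d, E o * b * d * E o = ∑ l, E o * b * E l * d * E o := by
    intro b d
    calc E o * b * d * E o = E o * b * (∑ l, E l) * d * E o := by rw [hE.sum, mul_one]
      _ = _ := by simp only [Finset.mul_sum, Finset.sum_mul]
  have hoo : ∀ π, Good (E o) T π → ∀ b ∈ S0, ∀ d ∈ S0,
      π * (E o * b * E o * d * E o) = (E o * b * E o * d * E o) * π := by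
    intro π hπ b hb d hd
    obtain ⟨f, hf⟩ := (hE.prim o).prim b hb
    obtain ⟨f', hf'⟩ := (hE.prim o).prim d hd
    have : E o * b * E o * d * E o = (f * f') • E o := by
      rw [hf, smul_mul_assoc, smul_mul_assoc, hf', smul_smul]
    rw [this, mul_smul_comm, smul_mul_assoc, hπ.l, hπ.r]
  by_cases hj : ∃ j, j ≠ o
  swap
  · push Not at hj
    obtain ⟨π, hπ⟩ := Good.exists io T hT
    refine ⟨π, hπ, ?_⟩
    intro b hb d hd
    rw [hdec, Finset.mul_sum, Finset.sum_mul]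
    refine Finset.sum_congr rfl (fun l _ => ?_)
    rw [hj l]
    exact hoo π hπ b hb d hd
  obtain ⟨j, hj⟩ := hj
  have ooj := hE.orth o j hj.symm
  have ojo := hE.orth j o hj
  have ij := (hE.prim j).idem
  obtain ⟨m, v, hv, hsp, hvv, hac⟩ := PA.basis hJ (hE.prim o) (hE.prim j) ooj ojo
  have hve : ∀ k l, E o * (v k * v l) = v k * v l * E o := by
    intro k l
    rw [← mul_assoc, (hv k).pl, mul_assoc, (hv l).ql, ← mul_assoc]
  have hg1 : ∀ k l, E o * v k * v l * E o = v k * v l * E o := by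
    intro k l
    rw [mul_assoc (E o), hve, mul_assoc, io]
  have hsgn : ∀ k l, ∃ ε : K, (ε = 1 ∨ ε = -1) ∧ v k * v l = ε • (v l * v k) := by
    intro k l
    by_cases h : k = l
    · exact ⟨1, Or.inl rfl, by rw [h, one_smul]⟩
    · exact ⟨-1, Or.inr rfl, by rw [hac k l h, neg_smul, one_smul]⟩
  have hprod : ∀ k l k' l', E o * v k * v l * E o * (E o * v k' * v l' * E o) = v k * v l * (v k' * v l') * E o := by
    intro k l k' l'
    rw [hg1, hg1, mul_assoc _ (E o), ← mul_assoc (E o), hve, mul_assoc _ (E o), io, ← mul_assoc]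
  obtain ⟨π, hπ, hπc⟩ := Good.avg (e := E o) (T := T) (fun k : Fin m × Fin m => E o * v k.1 * v k.2 * E o) io hT
    (fun i => by rw [← mul_assoc, ← mul_assoc, ← mul_assoc, io]) (fun i => by rw [mul_assoc, io])
    (fun i w hw => hst _ (hv _).mem _ (hv _).mem w hw)
    (fun ⟨k, l⟩ => by
      obtain ⟨ε, hε, h⟩ := hsgn l k
      obtain ⟨f, hf, h1⟩ := hvv k
      obtain ⟨f', hf', h2⟩ := hvv l
      refine ⟨ε * f * f', by rcases hε with rfl | rfl <;> simp [hf, hf'], ?_⟩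
      simp only
      rw [hprod]
      calc v k * v l * (v k * v l) * E o = v k * (v l * v k) * v l * E o := by simp only [mul_assoc]
        _ = ε • (v k * v k * (v l * v l) * E o) := by rw [h]; simp only [mul_assoc, smul_mul_assoc, mul_smul_comm]
        _ = _ := by
          have : (E o + E j) * E o = E o := by rw [add_mul, io, ojo, add_zero]
          rw [h1, h2, mul_assoc, smul_mul_assoc, smul_mul_assoc, mul_smul_comm, this, this, smul_smul, smul_smul,
            mul_assoc])
    (fun ⟨k, l⟩ ⟨k', l'⟩ => by
      simp only
      rw [hprod, hprod]
      obtain ⟨ε1, hε1, h1⟩ := hsgn l k'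
      obtain ⟨ε2, hε2, h2⟩ := hsgn l l'
      obtain ⟨ε3, hε3, h3⟩ := hsgn k k'
      obtain ⟨ε4, hε4, h4⟩ := hsgn k l'
      have : v k * v l * (v k' * v l') = (ε1 * ε2 * ε3 * ε4) • (v k' * v l' * (v k * v l)) := by
        calc v k * v l * (v k' * v l') = v k * (v l * v k') * v l' := by simp only [mul_assoc]
          _ = ε1 • (v k * v k' * (v l * v l')) := by rw [h1]; simp only [mul_assoc, smul_mul_assoc, mul_smul_comm]
          _ = (ε1 * ε2 * ε3) • (v k' * (v k * v l') * v l) := by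
            rw [h2, h3]; simp only [mul_assoc, smul_mul_assoc, mul_smul_comm, smul_smul]
          _ = _ := by rw [h4]; simp only [mul_assoc, smul_mul_assoc, mul_smul_comm, smul_smul]
      rw [this]
      rcases hε1 with rfl | rfl <;> rcases hε2 with rfl | rfl <;> rcases hε3 with rfl | rfl <;>
        rcases hε4 with rfl | rfl <;> simp)
  refine ⟨π, hπ, ?_⟩
  have hPA : ∀ b, PA S0 (E o) (E j) b → ∀ d, PA S0 (E o) (E j) d →
      π * (E o * b * d * E o) = (E o * b * d * E o) * π := by
    intro b hb d hd
    obtain ⟨f, rfl⟩ := hsp b hb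
    obtain ⟨f', rfl⟩ := hsp d hd
    simp only [Finset.mul_sum, Finset.sum_mul, mul_smul_comm, smul_mul_assoc]
    refine Finset.sum_congr rfl (fun k _ => ?_)
    congr 1
    refine Finset.sum_congr rfl (fun l _ => ?_)
    rw [hπc (l, k)]
  intro b hb d hd
  rw [hdec, Finset.mul_sum, Finset.sum_mul]
  refine Finset.sum_congr rfl (fun l _ => ?_)
  by_cases hlo : l = o
  · subst hlo
    exact hoo π hπ b hb d hd
  have ool := hE.orth o l (Ne.symm hlo)
  have olo := hE.orth l o hlo
  have il := (hE.prim l).idem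
  have hbl := PA.of hJ (hE.prim o) (hE.prim l) ool olo hb
  have hdl := PA.of hJ (hE.prim o) (hE.prim l) ool olo hd
  have eb : E o * (E o * b * E l + E l * b * E o) = E o * b * E l := by
    rw [mul_add, ← mul_assoc, ← mul_assoc, io, ← mul_assoc, ← mul_assoc, ool]; simp
  have ed : (E o * d * E l + E l * d * E o) * E o = E l * d * E o := by
    rw [add_mul, mul_assoc, olo, mul_assoc _ (E o), io]; simp
  set b' := E o * b * E l + E l * b * E o
  set d' := E o * d * E l + E l * d * E o
  by_cases hlj : l = j
  · subst hlj
    have := hPA b' hbl d' hdl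
    have e1 : E o * b' * d' * E o = E o * b * E l * d * E o := by
      rw [mul_assoc _ d', ed, eb]
      simp only [← mul_assoc]
      rw [mul_assoc (E o * b), il]
    rwa [e1] at this
  · have olj := hE.orth l j hlj
    have ojl := hE.orth j l (Ne.symm hlj)
    obtain ⟨c, hc, hcc⟩ := hE.conn hJ l j hlj
    have h1 := PA.mul hJ io ij ool olo ooj ojo olj ojl hbl hc
    have h2 := PA.mul hJ io ij ool olo ooj ojo olj ojl hdl hc
    have oc : E o * c = 0 := hc.left0 ool ooj
    have co : c * E o = 0 := hc.right0 olo ojo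
    have := hPA _ h1 _ h2
    have e1 : E o * (b' * c + c * b') * (d' * c + c * d') * E o = E o * b * E l * d * E o := by
      have x1 : E o * (b' * c + c * b') = E o * b * E l * c := by
        rw [mul_add, ← mul_assoc, ← mul_assoc, eb, oc, zero_mul, add_zero]
      have x2 : (d' * c + c * d') * E o = c * (E l * d * E o) := by
        rw [add_mul, mul_assoc, co, mul_zero, zero_add, mul_assoc, ed]
      rw [mul_assoc _ (d' * c + c * d'), x1, x2]
      have : E o * b * E l * c * (c * (E l * d * E o)) = E o * b * E l * (c * c) * E l * d * E o := by
        simp only [mul_assoc]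
      rw [this, hcc, mul_assoc _ (E l + E j), add_mul, il, ojl, add_zero, mul_assoc _ (E l) (E l), il]
    rwa [e1] at this
end

section
set_option linter.unusedSectionVars false
variable {K : Type*} [Field K] [CharZero K] {n : ℕ} {S0 : Submodule K (Matrix (Fin n) (Fin n) K)}
    {S1 : Submodule K (Matrix (Fin n) (Fin n) K × Matrix (Fin n) (Fin n) K)}
    {p q a b c d e : Matrix (Fin n) (Fin n) K} {r : ℕ} {E : Fin r → Matrix (Fin n) (Fin n) K}
    {x y : Matrix (Fin n) (Fin n) K × Matrix (Fin n) (Fin n) K}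

theorem tr_ss {B C : Matrix (Fin n) (Fin n) K} (hB : Bᵀ = B) (hC : Cᵀ = - C) : (B * C).trace = 0 := by
  have h : (B * C).trace = - (B * C).trace := by
    conv_lhs => rw [← trace_transpose, transpose_mul, hB, hC, neg_mul, trace_neg, trace_mul_comm]
  exact self_eq_neg.1 h

theorem Sys.ab (hS : Sys S0 S1) (ha : a ∈ S0) (hb : b ∈ S0) (hx : x ∈ S1) :
    (a * x.1 * bᵀ + b * x.1 * aᵀ, aᵀ * x.2 * b + bᵀ * x.2 * a) ∈ S1 := by
  apply half_mem S1 (S1.sub_mem (S1.add_mem (hS.j1 a ha _ (hS.j1 b hb x hx)) (hS.j1 b hb _ (hS.j1 a ha x hx)))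
    (hS.j1 _ (hS.j0 a ha b hb) x hx))
  simp only [act, Prod.mk_add_mk, Prod.mk_sub_mk, transpose_add, transpose_mul]
  ext1 <;> simp only <;> noncomm_ring

theorem Sys.bd (hS : Sys S0 S1) (hb : b ∈ S0) (hd : d ∈ S0) (hx : x ∈ S1) :
    (b * d * x.1 + x.1 * (b * d)ᵀ, (d * b)ᵀ * x.2 + x.2 * (d * b)) ∈ S1 := by
  have := S1.sub_mem (hS.j1 b hb _ (hS.j1 d hd x hx)) (hS.ab hb hd hx)
  simp only [act, Prod.mk_sub_mk] at this
  convert this using 2 <;> rw [transpose_mul] <;> noncomm_ring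

theorem Sys.corner (hS : Sys S0 S1) (he : e ∈ S0) (hx : x ∈ S1) : (e * x.1 * eᵀ, eᵀ * x.2 * e) ∈ S1 :=
  half_mem S1 (hS.ab he he hx) rfl

structure XE (S1 : Submodule K (Matrix (Fin n) (Fin n) K × Matrix (Fin n) (Fin n) K))
    (e : Matrix (Fin n) (Fin n) K) (x : Matrix (Fin n) (Fin n) K × Matrix (Fin n) (Fin n) K) : Prop where
  mem : x ∈ S1
  l1 : e * x.1 = x.1
  r1 : x.1 * eᵀ = x.1
  l2 : eᵀ * x.2 = x.2
  r2 : x.2 * e = x.2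

theorem XE.add (h : XE S1 e x) (h' : XE S1 e y) : XE S1 e (x + y) :=
  ⟨S1.add_mem h.mem h'.mem, by rw [Prod.fst_add, mul_add, h.l1, h'.l1], by rw [Prod.fst_add, add_mul, h.r1, h'.r1],
   by rw [Prod.snd_add, mul_add, h.l2, h'.l2], by rw [Prod.snd_add, add_mul, h.r2, h'.r2]⟩

theorem XE.of (hS : Sys S0 S1) (he : e ∈ S0) (hi : e * e = e) (hx : x ∈ S1) :
    XE S1 e (e * x.1 * eᵀ, eᵀ * x.2 * e) := by
  have hi' : eᵀ * eᵀ = eᵀ := by rw [← transpose_mul, hi]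
  refine ⟨hS.corner he hx, ?_, ?_, ?_, ?_⟩ <;> simp only
  · rw [← mul_assoc, ← mul_assoc, hi]
  · rw [mul_assoc, hi']
  · rw [← mul_assoc, ← mul_assoc, hi']
  · rw [mul_assoc, hi]

theorem XE.st (hS : Sys S0 S1) (he : e ∈ S0) (hi : e * e = e) (h : XE S1 e x) (hb : b ∈ S0) (hd : d ∈ S0) :
    XE S1 e ((e * b * d * e) * x.1 + x.1 * (e * b * d * e)ᵀ, (e * d * b * e)ᵀ * x.2 + x.2 * (e * d * b * e)) := by
  have := XE.of hS he hi (hS.bd hb hd h.mem)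
  convert this using 2
  · simp only [mul_add, add_mul, transpose_mul]
    congr 1
    · simp only [mul_assoc]; rw [h.r1, h.l1]
    · simp only [← mul_assoc]; rw [h.l1, h.r1]
  · simp only [mul_add, add_mul, transpose_mul]
    congr 1
    · simp only [mul_assoc]; rw [h.r2, h.l2]
    · simp only [← mul_assoc]; rw [h.l2, h.r2]

theorem XE.br0 (hS : SimpSys S0 S1) (hp : Prim S0 e) (h : XE S1 e x) (h' : XE S1 e y) : x.1 * y.2 = y.1 * x.2 := by
  obtain ⟨μ, hμ⟩ := hp.prim _ (hS.j2 x h.mem y h'.mem)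
  have e1 : e * br x y * e = br x y := by
    simp only [br, mul_sub, sub_mul, ← mul_assoc, h.l1, h'.l1]
    rw [mul_assoc x.1, h'.r2, mul_assoc y.1, h.r2]
  have e2 : (br x y).trace = 0 := by
    rw [br, trace_sub, tr_ss (hS.sym x h.mem) (hS.skew y h'.mem), tr_ss (hS.sym y h'.mem) (hS.skew x h.mem), sub_zero]
  rw [e1] at hμ
  rw [hμ, trace_smul, smul_eq_mul] at e2
  have := (mul_eq_zero.1 e2).resolve_right (trace_idem_ne e hp.idem hp.ne)
  rw [this, zero_smul] at hμ
  exact sub_eq_zero.1 hμ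

theorem XE.q0 [IsAlgClosed K] (hS : SimpSys S0 S1) (hJ : JA S0) (hE : PF S0 E) (o : Fin r) (h : XE S1 (E o) x) :
    x.1 * x.2 = 0 := by
  have hp := hE.prim o
  have io := hp.idem
  have tre := trace_idem_ne (E o) io hp.ne
  have trq := tr_ss (hS.sym x h.mem) (hS.skew x h.mem)
  obtain ⟨β, χ⟩ := x
  have hsym := hS.sym _ h.mem
  have hskew := hS.skew _ h.mem
  have hl1 := h.l1
  have hr1 := h.r1
  have hl2 := h.l2
  have hr2 := h.r2
  simp only at hsym hskew hl1 hr1 hl2 hr2 trq ⊢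
  set q := β * χ with hqd
  have eq : E o * q = q := by rw [hqd, ← mul_assoc, hl1]
  have qe : q * E o = q := by rw [hqd, mul_assoc, hr2]
  have hsc : ∀ κ : K, q = κ • E o → q = 0 := by
    intro κ hκ
    rw [hκ, trace_smul, smul_eq_mul] at trq
    rw [hκ, (mul_eq_zero.1 trq).resolve_right tre, zero_smul]
  have hcm : ∀ a ∈ S0, q * a - a * q ∈ S0 := by
    intro a ha
    apply half_mem S0 (comm_mem hS.toSys a ha _ h.mem _ h.mem)
    simp only [← hqd]
    noncomm_ring
  have hw : ∀ b ∈ S0, ∀ d ∈ S0, ∃ f σ : K, ∃ w, w = E o * b * d * E o - E o * d * b * E o ∧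
      E o * b * d * E o + E o * d * b * E o = f • E o ∧ E o * w = w ∧ w * E o = w ∧
      q * w + w * q = σ • E o ∧ (β * wᵀ * χ) + (β * wᵀ * χ) = - (σ • E o) := by
    intro b hb d hd
    obtain ⟨f, hf⟩ := hp.prim _ (hJ.j0 b hb d hd)
    have hf' : E o * b * d * E o + E o * d * b * E o = f • E o := by
      rw [← hf]; noncomm_ring
    obtain ⟨s, hs⟩ := hp.prim _ (hJ.j0 _ (hcm b hb) d hd)
    obtain ⟨fb, hfb⟩ := hp.prim b hb
    obtain ⟨fd, hfd⟩ := hp.prim d hd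
    have hX := XE.br0 hS hp h (h.st hS.toSys hp.mem io hb hd)
    simp only at hX
    set u := E o * b * d * E o with hu
    set v := E o * d * b * E o with hv
    have hs' : q * u - v * q = s • E o := by
      have z1 : E o * b * q * d * E o = E o * d * q * b * E o := by
        have y1 : E o * b * q * d * E o = (E o * b * E o) * q * (E o * d * E o) := by
          have : q = E o * q * E o := by rw [eq, qe]
          conv_lhs => rw [this]
          simp only [mul_assoc]
        have y2 : E o * d * q * b * E o = (E o * d * E o) * q * (E o * b * E o) := by
          have : q = E o * q * E o := by rw [eq, qe]
          conv_lhs => rw [this]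
          simp only [mul_assoc]
        rw [y1, y2, hfb, hfd]
        simp only [smul_mul_assoc, mul_smul_comm]
        rw [smul_comm]
      have z2 : E o * ((q * b - b * q) * d + d * (q * b - b * q)) * E o =
          (E o * q) * b * d * E o - E o * b * q * d * E o + E o * d * q * b * E o - E o * d * b * (q * E o) := by
        noncomm_ring
      rw [← hs, z2, z1, eq, qe, hu, hv]
      have z3 : q * (E o * b * d * E o) = (q * E o) * b * d * E o := by simp only [mul_assoc]
      have z4 : E o * d * b * E o * q = E o * d * b * (E o * q) := by simp only [mul_assoc]
      rw [z3, z4, eq, qe]; abel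
    have hvu : v = f • E o - u := by rw [← hf']; abel
    have eu : E o * u = u := by simp only [hu, ← mul_assoc, io]
    have ue : u * E o = u := by rw [hu, mul_assoc, io]
    refine ⟨f, s + s, u - v, rfl, hf', ?_, ?_, ?_, ?_⟩
    · rw [hvu]; simp only [mul_sub, mul_smul_comm, eu, io]
    · rw [hvu]; simp only [sub_mul, smul_mul_assoc, ue, io]
    · rw [add_smul, ← hs', hvu]
      simp only [mul_sub, sub_mul, mul_smul_comm, smul_mul_assoc, eq, qe]
      abel
    · rw [add_smul, ← hs', hvu]
      rw [hvu] at hX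
      simp only [transpose_sub, transpose_smul, mul_sub, sub_mul, mul_add, add_mul, mul_smul_comm, smul_mul_assoc,
        hr1, hl2, hr2, eq] at hX ⊢
      simp only [← mul_assoc, ← hqd] at hX ⊢
      have hX' : β * uᵀ * χ + β * uᵀ * χ = f • q + f • q - q * u - u * q := by
        rw [mul_assoc u, ← hqd] at hX
        have t1 : f • q + f • q - q * u - u * q = (f • q - β * uᵀ * χ + (f • q - q * u)) + β * uᵀ * χ - u * q := by abel
        rw [t1, hX]; abel
      have t2 : β * uᵀ * χ - (f • q - β * uᵀ * χ) + (β * uᵀ * χ - (f • q - β * uᵀ * χ)) =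
        (β * uᵀ * χ + β * uᵀ * χ) + (β * uᵀ * χ + β * uᵀ * χ) - f • q - f • q := by abel
      rw [t2, hX']; abel
  clear_value q
  have hcw : ∀ z : Matrix (Fin n) (Fin n) K, E o * z = z → z * E o = z → (∀ b ∈ S0, ∀ d ∈ S0,
      z * (E o * b * d * E o - E o * d * b * E o) = (E o * b * d * E o - E o * d * b * E o) * z) →
      ∃ κ : K, z = κ • E o := by
    intro z hz1 hz2 hz
    apply lemmaM hJ hE o hz1 hz2
    intro b hb d hd
    obtain ⟨f, σ, w, hwd, hf, -⟩ := hw b hb d hd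
    have h1 := hz b hb d hd
    have h2 : E o * d * b * E o = f • E o - E o * b * d * E o := by rw [← hf]; abel
    rw [h2] at h1
    set u := E o * b * d * E o
    simp only [mul_sub, sub_mul, mul_smul_comm, smul_mul_assoc, hz1, hz2] at h1
    have h3 : (2 : K) • (z * u) = (2 : K) • (u * z) := by
      rw [two_smul, two_smul]
      have t : z * u + z * u = z * u - (f • z - z * u) + f • z := by abel
      rw [t, h1]; abel
    exact smul_right_injective _ (two_ne_zero (α := K)) h3
  obtain ⟨μ, hμ⟩ := hcw (q * q) (by rw [← mul_assoc, eq]) (by rw [mul_assoc, qe]) (by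
    intro b hb d hd
    obtain ⟨f, σ, w, hwd, hf, ew, we, hqw, -⟩ := hw b hb d hd
    rw [← hwd]
    have t1 : q * w = σ • E o - w * q := by rw [← hqw]; abel
    rw [mul_assoc, t1, mul_sub, mul_smul_comm, qe, ← mul_assoc, t1, sub_mul, smul_mul_assoc, eq, ← mul_assoc]
    abel)
  have htw : ∀ b ∈ S0, ∀ d ∈ S0, ∃ f σ : K, ∃ w, w = E o * b * d * E o - E o * d * b * E o ∧
      E o * w = w ∧ w * E o = w ∧
      q * w + w * q = σ • E o ∧ β * wᵀ * χ = - ((σ / 2) • E o) ∧ χ * w * β = (σ / 2) • (E o)ᵀ := by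
    intro b hb d hd
    obtain ⟨f, σ, w, hwd, hf, ew, we, hqw, hx⟩ := hw b hb d hd
    have h1 : β * wᵀ * χ = - ((σ / 2) • E o) := by
      apply smul_right_injective _ (two_ne_zero (α := K))
      simp only
      rw [two_smul, hx, smul_neg, smul_smul, mul_div_cancel₀ _ (two_ne_zero)]
    refine ⟨f, σ, w, hwd, ew, we, hqw, h1, ?_⟩
    have := congrArg transpose h1
    simp only [transpose_mul, transpose_neg, transpose_smul, transpose_transpose, hsym, hskew, neg_mul, neg_inj] at this
    rw [mul_assoc, this]
  by_cases hμ0 : μ = 0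
  · rw [hμ0, zero_smul] at hμ
    by_cases hσ : ∀ b ∈ S0, ∀ d ∈ S0, (q * (E o * b * d * E o - E o * d * b * E o)).trace = 0
    · have hcom : ∀ a ∈ S0, q * a = a * q := by
        intro a ha
        rw [← sub_eq_zero]
        apply hJ.nd _ (hcm a ha)
        intro b hb
        have h1 := hσ a ha b hb
        have t1 : ((q * a - a * q) * b).trace = (q * a * b).trace - (q * b * a).trace := by
          rw [sub_mul, trace_sub, mul_assoc a, trace_mul_comm a]
        have t2 : ∀ c d, (q * (E o * c * d * E o)).trace = (q * c * d).trace := by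
          intro c d
          rw [← mul_assoc, trace_mul_comm]
          simp only [← mul_assoc, eq, qe]
        rw [mul_sub, trace_sub, t2, t2] at h1
        rw [t1, h1]
      obtain ⟨κ, hκ⟩ := hJ.cent q hcom
      rw [hκ] at hμ
      simp only [smul_mul_assoc, mul_smul_comm, mul_one, smul_smul] at hμ
      rcases smul_eq_zero.1 hμ with h0 | h0
      · rw [hκ, mul_self_eq_zero.1 h0, zero_smul]
      · rw [hκ, h0, smul_zero]
    · push Not at hσ
      obtain ⟨b, hb, d, hd, hne⟩ := hσ
      obtain ⟨f, σ, w, hwd, ew, we, hqw, h1, h2⟩ := htw b hb d hd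
      rw [← hwd] at hne
      have hs0 : σ ≠ 0 := by
        rintro rfl
        have := congrArg trace hqw
        rw [trace_add, trace_mul_comm w, zero_smul, trace_zero, ← two_mul] at this
        exact hne ((mul_eq_zero.1 this).resolve_left two_ne_zero)
      have h3 : β * wᵀ * (χ * w * β) * χ = - ((σ / 2 * (σ / 2)) • E o) := by
        rw [h2, mul_smul_comm, smul_mul_assoc, mul_assoc _ (E o)ᵀ, hl2, h1, smul_neg, smul_smul]
      have h4 : β * wᵀ * (χ * w * β) * χ * q = 0 := by
        have : β * wᵀ * (χ * w * β) * χ * q = β * wᵀ * χ * w * (q * q) := by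
          rw [hqd]; simp only [mul_assoc]
        rw [this, hμ, mul_zero]
      rw [h3, neg_mul, smul_mul_assoc, eq, neg_eq_zero] at h4
      refine (smul_eq_zero.1 h4).resolve_left ?_
      exact mul_ne_zero (div_ne_zero hs0 two_ne_zero) (div_ne_zero hs0 two_ne_zero)
  · obtain ⟨κ, hκ⟩ := hcw q eq qe (by
      intro b hb d hd
      obtain ⟨f, σ, w, hwd, ew, we, hqw, h1, h2⟩ := htw b hb d hd
      rw [← hwd]
      have h3 : q * w * q = (σ / 2) • q := by
        have : q * w * q = β * (χ * w * β) * χ := by rw [hqd]; simp only [mul_assoc]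
        rw [this, h2, mul_smul_comm, hr1, smul_mul_assoc, ← hqd]
      have h4 : μ • (w * q) = (σ / 2) • μ • E o := by
        have := congrArg (fun z => q * z) h3
        simp only [mul_smul_comm, hμ] at this
        rw [← this, mul_assoc, ← mul_assoc q q, hμ, smul_mul_assoc, ← mul_assoc, ew]
      have h5 : μ • (q * w) = (σ / 2) • μ • E o := by
        have := congrArg (fun z => z * q) h3
        simp only [smul_mul_assoc, hμ] at this
        rw [← this, mul_assoc _ q q, hμ, mul_smul_comm, mul_assoc, we]
      exact smul_right_injective _ hμ0 (h5.trans h4.symm))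
    exact hsc κ hκ

theorem XE.pure [IsAlgClosed K] (hS : SimpSys S0 S1) (hJ : JA S0) (hE : PF S0 E) (o : Fin r) :
    (∀ x, XE S1 (E o) x → x.1 = 0) ∨ (∀ x, XE S1 (E o) x → x.2 = 0) := by
  have hp := hE.prim o
  have hm : ∀ A B : Matrix (Fin n) (Fin n) K, (∀ v, A *ᵥ v = B *ᵥ v) → A = B := by
    intro A B h
    exact Matrix.ext_of_mulVec_single (fun i => h _)
  have h0 : ∀ x, XE S1 (E o) x → ∀ y, XE S1 (E o) y → y.2 * x.1 = 0 := by
    intro x hx y hy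
    have h1 := XE.br0 hS hp hx hy
    have h2 := XE.q0 hS hJ hE o (hx.add hy)
    rw [Prod.fst_add, Prod.snd_add, mul_add, add_mul, add_mul, hx.q0 hS hJ hE o, hy.q0 hS hJ hE o, zero_add, add_zero,
      ← h1] at h2
    have h3 : x.1 * y.2 = 0 := by
      rw [← two_smul K] at h2
      exact (smul_eq_zero.1 h2).resolve_left two_ne_zero
    have := congrArg transpose h3
    rwa [transpose_mul, hS.sym _ hx.mem, hS.skew _ hy.mem, neg_mul, transpose_zero, neg_eq_zero] at this
  let T : Submodule K (Fin n → K) :=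
    { carrier := {v | E o *ᵥ v = v ∧ ∀ x, XE S1 (E o) x → x.2 *ᵥ v = 0}
      zero_mem' := ⟨by simp, by simp⟩
      add_mem' := fun {a b} ha hb => ⟨by rw [mulVec_add, ha.1, hb.1], fun x hx => by
        rw [mulVec_add, ha.2 x hx, hb.2 x hx, add_zero]⟩
      smul_mem' := fun c a ha => ⟨by rw [mulVec_smul, ha.1], fun x hx => by
        rw [mulVec_smul, ha.2 x hx, smul_zero]⟩ }
  rcases irr hJ hE o T (fun v hv => hv.1) (by
    intro b hb d hd v hv
    refine ⟨?_, ?_⟩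
    · rw [mulVec_mulVec, ← mul_assoc, ← mul_assoc, ← mul_assoc, hp.idem]
    · intro x hx
      have := hv.2 _ (hx.st hS.toSys hp.mem hp.idem hd hb)
      simp only at this
      rw [add_mulVec, ← mulVec_mulVec, hv.2 x hx, mulVec_zero, zero_add, ← mulVec_mulVec] at this
      exact this) with h | h
  · left
    intro x hx
    apply hm
    intro v
    have : x.1 *ᵥ v ∈ T := by
      refine ⟨by rw [mulVec_mulVec, hx.l1], fun y hy => ?_⟩
      rw [mulVec_mulVec, h0 x hx y hy, zero_mulVec]
    rw [h] at this
    rw [(Submodule.mem_bot K).1 this, zero_mulVec]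
  · right
    intro x hx
    apply hm
    intro v
    have := (h v).2 x hx
    rw [mulVec_mulVec, hx.r2] at this
    rw [this, zero_mulVec]
end

section
set_option linter.unusedSectionVars false
variable {K : Type*} [Field K] [CharZero K] {n : ℕ} {S0 : Submodule K (Matrix (Fin n) (Fin n) K)}
    {S1 : Submodule K (Matrix (Fin n) (Fin n) K × Matrix (Fin n) (Fin n) K)}
    {p q a b c d e : Matrix (Fin n) (Fin n) K} {r : ℕ} {E : Fin r → Matrix (Fin n) (Fin n) K}
    {x y : Matrix (Fin n) (Fin n) K × Matrix (Fin n) (Fin n) K}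

theorem zero_of (p q p' q' Z : Matrix (Fin n) (Fin n) K) (h1 : p * Z = Z * p') (h2 : q * Z = Z * q')
    (h3 : p * Z * p' = 0) (h4 : q * Z * q' = 0) (hp : p' * p' = p') (hq : q' * q' = q') (h5 : p * Z + q * Z = Z) : Z = 0 := by
  rw [h1, mul_assoc, hp] at h3
  rw [h2, mul_assoc, hq] at h4
  rw [← h5, h1, h2, h3, h4, add_zero]

structure X2 (p q B : Matrix (Fin n) (Fin n) K) : Prop where
  pl : p * B = B * qᵀ
  ql : q * B = B * pᵀ
  tot : p * B + q * B = B

theorem X2.of (hp : p * p = p) (hq : q * q = q) (hpq : p * q = 0) (hqp : q * p = 0) (B : Matrix (Fin n) (Fin n) K) :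
    X2 p q (p * B * qᵀ + q * B * pᵀ) := by
  have hp' : pᵀ * pᵀ = pᵀ := by rw [← transpose_mul, hp]
  have hq' : qᵀ * qᵀ = qᵀ := by rw [← transpose_mul, hq]
  have hpq' : pᵀ * qᵀ = 0 := by rw [← transpose_mul, hqp, transpose_zero]
  have hqp' : qᵀ * pᵀ = 0 := by rw [← transpose_mul, hpq, transpose_zero]
  have e1 : p * (p * B * qᵀ + q * B * pᵀ) = p * B * qᵀ := by
    rw [mul_add, ← mul_assoc, ← mul_assoc, ← mul_assoc, ← mul_assoc, hp, hpq]; simp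
  have e2 : q * (p * B * qᵀ + q * B * pᵀ) = q * B * pᵀ := by
    rw [mul_add, ← mul_assoc, ← mul_assoc, ← mul_assoc, ← mul_assoc, hqp, hq]; simp
  refine ⟨?_, ?_, ?_⟩
  · rw [e1, add_mul, mul_assoc _ qᵀ, hq', mul_assoc _ pᵀ, hpq', mul_zero, add_zero]
  · rw [e2, add_mul, mul_assoc _ qᵀ, hqp', mul_assoc _ pᵀ, hp', mul_zero, zero_add]
  · rw [e1, e2]

theorem X2.anti {B : Matrix (Fin n) (Fin n) K} (h : X2 p q B) (hp : p * p = p) (hq : q * q = q) (h1 : p * a = a * q)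
    (h2 : q * a = a * p) (h3 : p * a + q * a = a)
    (z1 : p * (a * B + B * aᵀ) * pᵀ = 0) (z2 : q * (a * B + B * aᵀ) * qᵀ = 0) : a * B = - (B * aᵀ) := by
  have hp' : pᵀ * pᵀ = pᵀ := by rw [← transpose_mul, hp]
  have hq' : qᵀ * qᵀ = qᵀ := by rw [← transpose_mul, hq]
  have h1' : qᵀ * aᵀ = aᵀ * pᵀ := by rw [← transpose_mul, ← transpose_mul, h1]
  have h2' : pᵀ * aᵀ = aᵀ * qᵀ := by rw [← transpose_mul, ← transpose_mul, h2]
  apply eq_neg_of_add_eq_zero_left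
  refine zero_of p q pᵀ qᵀ _ ?_ ?_ z1 z2 hp' hq' ?_
  · rw [mul_add, add_mul, ← mul_assoc, h1, mul_assoc a, h.ql, ← mul_assoc, ← mul_assoc p, h.pl, mul_assoc B, h1', mul_assoc B]
  · rw [mul_add, add_mul, ← mul_assoc, h2, mul_assoc a, h.pl, ← mul_assoc, ← mul_assoc q, h.ql, mul_assoc B, h2', mul_assoc B]
  · rw [mul_add, mul_add, add_add_add_comm, ← mul_assoc, ← mul_assoc, ← add_mul, h3, ← mul_assoc, ← mul_assoc q,
      ← add_mul, h.tot]

theorem tr_ij (hS : SimpSys S0 S1) (hp : Prim S0 p) (hq : Prim S0 q) (hpq : p * q = 0) (hqp : q * p = 0)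
    (hz : ∀ x ∈ S1, p * x.1 * pᵀ = 0 ∧ pᵀ * x.2 * p = 0) (hz' : ∀ x ∈ S1, q * x.1 * qᵀ = 0 ∧ qᵀ * x.2 * q = 0)
    (ha : PA S0 p q a) (haa : a * a = p + q) (hx : x ∈ S1) (hy : y ∈ S1)
    (x1 : X2 p q x.1) (x2 : X2 pᵀ qᵀ x.2) (y1 : X2 p q y.1) (y2 : X2 pᵀ qᵀ y.2) : (p * br x y).trace = 0 := by
  have hp' : pᵀ * pᵀ = pᵀ := by rw [← transpose_mul, hp.idem]
  have hq' : qᵀ * qᵀ = qᵀ := by rw [← transpose_mul, hq.idem]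
  have k1 : pᵀ * aᵀ = aᵀ * qᵀ := by rw [← transpose_mul, ← transpose_mul, ha.ql]
  have k2 : qᵀ * aᵀ = aᵀ * pᵀ := by rw [← transpose_mul, ← transpose_mul, ha.pl]
  have k3 : pᵀ * aᵀ + qᵀ * aᵀ = aᵀ := by
    rw [k1, k2, ← transpose_mul, ← transpose_mul, ← transpose_add, add_comm, ha.tot]
  have A1 : ∀ x ∈ S1, X2 p q x.1 → a * x.1 = - (x.1 * aᵀ) := by
    intro x hx h
    exact h.anti hp.idem hq.idem ha.pl ha.ql ha.tot (hz _ (hS.j1 a ha.mem x hx)).1 (hz' _ (hS.j1 a ha.mem x hx)).1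
  have A2 : ∀ x ∈ S1, X2 pᵀ qᵀ x.2 → aᵀ * x.2 = - (x.2 * a) := by
    intro x hx h
    have := h.anti hp' hq' k1 k2 k3 (by simp only [transpose_transpose]; exact (hz _ (hS.j1 a ha.mem x hx)).2)
      (by simp only [transpose_transpose]; exact (hz' _ (hS.j1 a ha.mem x hx)).2)
    simpa only [transpose_transpose] using this
  have hN : a * br x y = br x y * a := by
    rw [br, mul_sub, sub_mul, ← mul_assoc, ← mul_assoc, A1 x hx x1, A1 y hy y1, neg_mul, neg_mul, mul_assoc, mul_assoc,
      A2 x hx x2, A2 y hy y2]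
    simp only [mul_neg, neg_neg, mul_assoc]
  have htot : p * br x y + q * br x y = br x y := by
    have : p * br x y + q * br x y = (p * x.1 + q * x.1) * y.2 - (p * y.1 + q * y.1) * x.2 := by
      rw [br]; noncomm_ring
    rw [this, x1.tot, y1.tot, br]
  have htr : (br x y).trace = 0 := by
    rw [br, trace_sub, tr_ss (hS.sym x hx) (hS.skew y hy), tr_ss (hS.sym y hy) (hS.skew x hx), sub_zero]
  have hapa : a * p * a = q := by
    rw [← ha.ql, mul_assoc, haa, mul_add, hqp, hq.idem, zero_add]
  have h1 : (q * br x y).trace = (p * br x y).trace := by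
    have : q * br x y = a * (p * br x y * a) := by rw [mul_assoc p, ← hN, ← hapa]; simp only [mul_assoc]
    rw [this, trace_mul_comm, mul_assoc _ a, haa, mul_assoc, trace_mul_comm, mul_assoc, add_mul, hp.idem, hqp, add_zero,
      trace_mul_comm]
  have h2 := congrArg trace htot
  rw [trace_add, h1, htr, ← two_mul] at h2
  exact (mul_eq_zero.1 h2).resolve_left two_ne_zero

theorem tr_ii [IsAlgClosed K] (hS : SimpSys S0 S1) (hJ : JA S0) (hE : PF S0 E)
    (hz : ∀ i, ∀ x ∈ S1, E i * x.1 * (E i)ᵀ = 0 ∧ (E i)ᵀ * x.2 * E i = 0)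
    (hx : x ∈ S1) (hy : y ∈ S1) (i : Fin r) : (E i * br x y).trace = 0 := by
  classical
  let t : Fin r → (Matrix (Fin n) (Fin n) K × Matrix (Fin n) (Fin n) K) →
    (Matrix (Fin n) (Fin n) K × Matrix (Fin n) (Fin n) K) := fun j x =>
    (E i * x.1 * (E j)ᵀ + E j * x.1 * (E i)ᵀ, (E i)ᵀ * x.2 * E j + (E j)ᵀ * x.2 * E i)
  have ii := (hE.prim i).idem
  have htm : ∀ j, ∀ x ∈ S1, t j x ∈ S1 := fun j x hx => hS.ab (hE.prim i).mem (hE.prim j).mem hx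
  have h0 : ∀ j, j ≠ i → (E i * br (t j x) (t j y)).trace = 0 := by
    intro j hji
    obtain ⟨a, ha, haa⟩ := hE.conn hJ i j (Ne.symm hji)
    have hp' : (E i)ᵀ * (E i)ᵀ = (E i)ᵀ := by rw [← transpose_mul, ii]
    have hq' : (E j)ᵀ * (E j)ᵀ = (E j)ᵀ := by rw [← transpose_mul, (hE.prim j).idem]
    have o1 := hE.orth i j (Ne.symm hji)
    have o2 := hE.orth j i hji
    have o1' : (E i)ᵀ * (E j)ᵀ = 0 := by rw [← transpose_mul, o2, transpose_zero]
    have o2' : (E j)ᵀ * (E i)ᵀ = 0 := by rw [← transpose_mul, o1, transpose_zero]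
    have xx : ∀ x : Matrix (Fin n) (Fin n) K × Matrix (Fin n) (Fin n) K, X2 (E i) (E j) (t j x).1 :=
      fun x => X2.of ii (hE.prim j).idem o1 o2 _
    have yy : ∀ x : Matrix (Fin n) (Fin n) K × Matrix (Fin n) (Fin n) K, X2 (E i)ᵀ (E j)ᵀ (t j x).2 := by
      intro x
      have := X2.of hp' hq' o1' o2' x.2
      simpa only [transpose_transpose] using this
    exact tr_ij hS (hE.prim i) (hE.prim j) o1 o2 (hz i) (hz j) ha haa (htm j x hx) (htm j y hy) (xx x) (yy x) (xx y) (yy y)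
  have key : ∀ x y : Matrix (Fin n) (Fin n) K × Matrix (Fin n) (Fin n) K, ∀ j, j ≠ i →
      (E i * ((t j x).1 * (t j y).2)).trace = (E i * (x.1 * (E j)ᵀ * y.2)).trace := by
    intro x y j hji
    have e1 : E i * (t j x).1 = E i * x.1 * (E j)ᵀ := by
      simp only [t]
      rw [mul_add, ← mul_assoc, ← mul_assoc, ii, ← mul_assoc, ← mul_assoc, hE.orth i j (Ne.symm hji)]; simp
    have e2 : (E j)ᵀ * (t j y).2 = (E j)ᵀ * y.2 * E i := by
      have o2' : (E j)ᵀ * (E i)ᵀ = 0 := by rw [← transpose_mul, hE.orth i j (Ne.symm hji), transpose_zero]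
      have hq' : (E j)ᵀ * (E j)ᵀ = (E j)ᵀ := by rw [← transpose_mul, (hE.prim j).idem]
      simp only [t]
      rw [mul_add, ← mul_assoc, ← mul_assoc, o2', ← mul_assoc, ← mul_assoc, hq']; simp
    rw [← mul_assoc, e1, mul_assoc, e2, ← mul_assoc, trace_mul_comm, ← mul_assoc, ← mul_assoc, ← mul_assoc, ii]
    simp only [mul_assoc]
  have key2 : ∀ x y : Matrix (Fin n) (Fin n) K × Matrix (Fin n) (Fin n) K, x ∈ S1 →
      (E i * (x.1 * y.2)).trace = ∑ j ∈ Finset.univ.erase i, (E i * ((t j x).1 * (t j y).2)).trace := by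
    intro x y hx
    have hs : ∑ j, (E j)ᵀ = 1 := by rw [← transpose_sum, hE.sum, transpose_one]
    calc (E i * (x.1 * y.2)).trace = (E i * (x.1 * (∑ j, (E j)ᵀ) * y.2)).trace := by rw [hs, mul_one]
      _ = ∑ j, (E i * (x.1 * (E j)ᵀ * y.2)).trace := by
        simp only [Finset.mul_sum, Finset.sum_mul, trace_sum]
      _ = ∑ j ∈ Finset.univ.erase i, (E i * (x.1 * (E j)ᵀ * y.2)).trace := by
        rw [← Finset.add_sum_erase _ _ (Finset.mem_univ i)]
        have : E i * (x.1 * (E i)ᵀ * y.2) = (E i * x.1 * (E i)ᵀ) * y.2 := by simp only [mul_assoc]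
        rw [this, (hz i x hx).1, zero_mul, trace_zero, zero_add]
      _ = _ := by
        refine Finset.sum_congr rfl (fun j hj => ?_)
        rw [key x y j (Finset.mem_erase.1 hj).1]
  rw [br, mul_sub, trace_sub, key2 x y hx, key2 y x hy, ← Finset.sum_sub_distrib]
  refine Finset.sum_eq_zero (fun j hj => ?_)
  rw [← trace_sub, ← mul_sub]
  exact h0 j (Finset.mem_erase.1 hj).1

theorem PF.conj (hJ : JA S0) (hE : PF S0 E) {w : Matrix (Fin n) (Fin n) K} (hw : w ∈ S0) (hww : w * w = 1) :
    PF S0 (fun i => w * E i * w) := by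
  have key : ∀ i j, w * E i * w * (w * E j * w) = w * (E i * E j) * w := by
    intro i j
    have : w * E i * w * (w * E j * w) = w * E i * (w * w) * E j * w := by simp only [mul_assoc]
    rw [this, hww]; simp only [mul_assoc, one_mul]
  refine ⟨fun i => ⟨umem hJ.j0 hw (hE.prim i).mem, ?_, ?_, ?_⟩, ?_, ?_⟩
  · rw [key, (hE.prim i).idem]
  · intro h
    apply (hE.prim i).ne
    have : E i = w * (w * E i * w) * w := by
      have : w * (w * E i * w) * w = (w * w) * E i * (w * w) := by simp only [mul_assoc]
      rw [this, hww, one_mul, mul_one]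
    rw [this, h]; simp
  · intro b hb
    obtain ⟨μ, hμ⟩ := (hE.prim i).prim _ (umem hJ.j0 hw hb)
    refine ⟨μ, ?_⟩
    have : w * E i * w * b * (w * E i * w) = w * (E i * (w * b * w) * E i) * w := by simp only [mul_assoc]
    rw [this, hμ, mul_smul_comm, smul_mul_assoc]
  · intro i j hij
    rw [key, hE.orth i j hij]; simp
  · rw [← Finset.sum_mul, ← Finset.mul_sum, hE.sum, mul_one, hww]

theorem tr_unit [IsAlgClosed K] (hJ : JA S0) (N : Matrix (Fin n) (Fin n) K)
    (hN : ∀ E : Fin r → Matrix (Fin n) (Fin n) K, PF S0 E → ∀ i, (E i * N).trace = 0) (hE : PF S0 E) (i j : Fin r)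
    (hij : i ≠ j) (ha : PA S0 (E i) (E j) a) (haa : a * a = E i + E j) : (a * N).trace = 0 := by
  have hp := (hE.prim i).idem
  have hq := (hE.prim j).idem
  have hpq := hE.orth i j hij
  have hqp := hE.orth j i hij.symm
  obtain ⟨s, hs⟩ := IsAlgClosed.exists_pow_nat_eq ((2:K)⁻¹) (n := 2) (by norm_num)
  have hN0 := hN E hE
  have hni := hN0 i
  have hnj := hN0 j
  have hpm := (hE.prim i).mem
  have hqm := (hE.prim j).mem
  set p := E i with hpd
  set q := E j
  have hm : p - q + a ∈ S0 := S0.add_mem (S0.sub_mem hpm hqm) ha.mem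
  have hap : a * p = q * a := ha.ql.symm
  have haq : a * q = p * a := ha.pl.symm
  have hww : (s • (p - q + a) + (1 - p - q)) * (s • (p - q + a) + (1 - p - q)) = 1 := by
    have e1 : (p - q + a) * (p - q + a) = (2:K) • (p + q) := by
      have : (p - q + a) * (p - q + a) = p * p - p * q - q * p + q * q + p * a + a * p - q * a - a * q + a * a := by
        noncomm_ring
      rw [this, hp, hq, hpq, hqp, haa, hap, haq, two_smul]; abel
    have e2 : (p - q + a) * (1 - p - q) = 0 := by
      have : (p - q + a) * (1 - p - q) = p - p * p - p * q - q + q * p + q * q + a - a * p - a * q := by noncomm_ring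
      rw [this, hp, hq, hpq, hqp, hap, haq]
      conv_lhs => rw [← ha.tot, mul_add, mul_add, ← mul_assoc, ← mul_assoc, ← mul_assoc, ← mul_assoc, hp, hq, hpq, hqp]
      noncomm_ring
    have e3 : (1 - p - q) * (p - q + a) = 0 := by
      have : (1 - p - q) * (p - q + a) = p - p * p + p * q - q - q * p + q * q + a - (p * a + q * a) := by noncomm_ring
      rw [this, hp, hq, hpq, hqp, ha.tot]
      noncomm_ring
    have e4 : (1 - p - q) * (1 - p - q) = 1 - p - q := by
      have : (1 - p - q) * (1 - p - q) = 1 - p - p - q - q + p * p + p * q + q * p + q * q := by noncomm_ring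
      rw [this, hp, hq, hpq, hqp]; abel
    rw [mul_add, add_mul, add_mul, smul_mul_assoc, smul_mul_assoc, mul_smul_comm, mul_smul_comm, e1, e2, e3, e4, smul_smul,
      smul_smul, ← pow_two, hs, inv_mul_cancel₀ two_ne_zero]
    simp
  have hwm : s • (p - q + a) + (1 - p - q) ∈ S0 :=
    S0.add_mem (S0.smul_mem _ hm) (S0.sub_mem (S0.sub_mem hJ.one hpm) hqm)
  have h1 := hN _ (hE.conj hJ hwm hww) i
  simp only [← hpd] at h1
  have e1 : (s • (p - q + a) + (1 - p - q)) * p = s • (p + a * p) := by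
    have : (s • (p - q + a) + (1 - p - q)) * p = s • (p * p - q * p + a * p) + (p - p * p - q * p) := by
      simp only [add_mul, sub_mul, smul_mul_assoc, one_mul]
    rw [this, hp, hqp]; simp
  have e2 : p * (s • (p - q + a) + (1 - p - q)) = s • (p + p * a) := by
    have : p * (s • (p - q + a) + (1 - p - q)) = s • (p * p - p * q + p * a) + (p - p * p - p * q) := by
      simp only [mul_add, mul_sub, mul_smul_comm, mul_one]
    rw [this, hp, hpq]; simp
  have e3 : (s • (p - q + a) + (1 - p - q)) * p * (s • (p - q + a) + (1 - p - q)) = (2:K)⁻¹ • (p + q + a) := by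
    have : ∀ w : Matrix (Fin n) (Fin n) K, w * p * w = (w * p) * (p * w) := by
      intro w; rw [mul_assoc w p (p * w), ← mul_assoc p p, hp, mul_assoc]
    rw [this, e1, e2, smul_mul_assoc, mul_smul_comm, smul_smul, ← pow_two, hs]
    congr 1
    have t : (p + a * p) * (p + p * a) = p * p + (p * p) * a + a * (p * p) + a * (p * p) * a := by noncomm_ring
    rw [t, hp, hap, mul_assoc q, haa, mul_add, hqp, hq]
    conv_rhs => rw [← ha.tot]
    abel
  rw [e3, smul_mul_assoc, trace_smul, add_mul, add_mul, trace_add, trace_add, hni, hnj, zero_add, zero_add,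
    smul_eq_mul] at h1
  exact (mul_eq_zero.1 h1).resolve_left (inv_ne_zero two_ne_zero)

theorem tr_PA [IsAlgClosed K] (hJ : JA S0) (N : Matrix (Fin n) (Fin n) K)
    (hN : ∀ E : Fin r → Matrix (Fin n) (Fin n) K, PF S0 E → ∀ i, (E i * N).trace = 0) (hE : PF S0 E) (i j : Fin r)
    (hij : i ≠ j) (hc : PA S0 (E i) (E j) c) : (c * N).trace = 0 := by
  have h1 : ∀ (f : K) (c : Matrix (Fin n) (Fin n) K), f ≠ 0 → PA S0 (E i) (E j) c → c * c = f • (E i + E j) → (c * N).trace = 0 := by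
    intro f c hf hc hcc
    obtain ⟨s, hs⟩ := IsAlgClosed.exists_pow_nat_eq (f⁻¹) (n := 2) (by norm_num)
    have hs0 : s ≠ 0 := by
      rintro rfl
      exact inv_ne_zero hf (by rw [← hs]; simp)
    have := tr_unit hJ N hN hE i j hij (hc.smul s) (by
      rw [smul_mul_assoc, mul_smul_comm, hcc, smul_smul, smul_smul, ← pow_two, hs, inv_mul_cancel₀ hf, one_smul])
    rw [smul_mul_assoc, trace_smul, smul_eq_mul] at this
    exact (mul_eq_zero.1 this).resolve_left hs0
  obtain ⟨f, hf⟩ := hc.sq hJ (hE.prim i) (hE.prim j)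
  by_cases hf0 : f = 0
  · rw [hf0, zero_smul] at hf
    obtain ⟨a, ha, haa⟩ := hE.conn hJ i j hij
    obtain ⟨g, hg⟩ := hc.polar hJ (hE.prim i) (hE.prim j) ha
    have h2 : ∀ t : K, t * g + t * t ≠ 0 → (c * N).trace = 0 := by
      intro t ht
      have h3 := h1 (t * g + t * t) (c + t • a) ht (hc.add (ha.smul t)) (by
        have : (c + t • a) * (c + t • a) = c * c + t • (c * a + a * c) + t • t • (a * a) := by
          simp only [mul_add, add_mul, mul_smul_comm, smul_mul_assoc, smul_add]; abel
        rw [this, hf, hg, haa, zero_add, add_smul, smul_smul, smul_smul])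
      have h4 := tr_unit hJ N hN hE i j hij ha haa
      rwa [add_mul, trace_add, smul_mul_assoc, trace_smul, h4, smul_zero, add_zero] at h3
    by_cases hg1 : g = -1
    · exact h2 (-1) (by rw [hg1]; norm_num)
    · exact h2 1 (by intro h; apply hg1; linear_combination h)
  · exact h1 f c hf0 hc hf

theorem exists_X [IsAlgClosed K] (hS : SimpSys S0 S1) (hJ : JA S0) :
    ∃ (r : ℕ) (E : Fin r → Matrix (Fin n) (Fin n) K), PF S0 E ∧ ∃ o x, XE S1 (E o) x ∧ x ≠ 0 := by
  by_contra hcon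
  push Not at hcon
  obtain ⟨r, E, hE⟩ := exists_PF hJ
  have hz : ∀ E : Fin r → Matrix (Fin n) (Fin n) K, PF S0 E → ∀ i, ∀ x ∈ S1, E i * x.1 * (E i)ᵀ = 0 ∧ (E i)ᵀ * x.2 * E i = 0 := by
    intro E hE i x hx
    have := hcon r E hE i _ (XE.of hS.toSys (hE.prim i).mem (hE.prim i).idem hx)
    exact ⟨congrArg Prod.fst this, congrArg Prod.snd this⟩
  have h0 : ∀ x ∈ S1, ∀ y ∈ S1, br x y = 0 := by
    intro x hx y hy
    have hN : ∀ E : Fin r → Matrix (Fin n) (Fin n) K, PF S0 E → ∀ i, (E i * br x y).trace = 0 :=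
      fun E hE i => tr_ii hS hJ hE (hz E hE) hx hy i
    apply hJ.nd _ (hS.j2 x hx y hy)
    intro b hb
    rw [trace_mul_comm]
    have ht : ∀ i j, (E i * b * E j * br x y).trace + (E j * b * E i * br x y).trace = 0 := by
      intro i j
      by_cases hij : i = j
      · subst hij
        obtain ⟨μ, hμ⟩ := (hE.prim i).prim b hb
        rw [hμ, smul_mul_assoc, trace_smul, hN E hE i]; simp
      · rw [← trace_add, ← add_mul]
        exact tr_PA hJ _ hN hE i j hij (PA.of hJ (hE.prim i) (hE.prim j) (hE.orth i j hij) (hE.orth j i (Ne.symm hij)) hb)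
    have hsum : (b * br x y).trace = ∑ i, ∑ j, (E i * b * E j * br x y).trace := by
      calc (b * br x y).trace = ((∑ i, E i) * b * (∑ j, E j) * br x y).trace := by rw [hE.sum, one_mul, mul_one]
        _ = _ := by
          simp only [Finset.sum_mul, Finset.mul_sum, trace_sum]
          rw [Finset.sum_comm]
    have hsum2 : (b * br x y).trace + (b * br x y).trace = 0 := by
      conv_lhs => rw [hsum]; rhs; rw [Finset.sum_comm]
      rw [← Finset.sum_add_distrib]
      refine Finset.sum_eq_zero (fun i _ => ?_)
      rw [← Finset.sum_add_distrib]
      exact Finset.sum_eq_zero (fun j _ => ht i j)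
    rw [← two_mul] at hsum2
    exact (mul_eq_zero.1 hsum2).resolve_left two_ne_zero
  rcases hS.simp ⊥ S1 ⟨bot_le, le_rfl, fun a _ b hb => by
      rw [(Submodule.mem_bot K).1 hb]; simp,
      fun a ha x _ => by rw [(Submodule.mem_bot K).1 ha]; simp [act]; exact S1.zero_mem,
      fun a ha x hx => hS.j1 a ha x hx, fun x hx y hy => by rw [h0 x hx y hy]; exact Submodule.zero_mem _⟩ with h | h
  · exact hS.ne1 h.2
  · have h1 : (1 : Matrix (Fin n) (Fin n) K) ∈ (⊥ : Submodule K (Matrix (Fin n) (Fin n) K)) := h.1 ▸ hJ.one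
    rw [Submodule.mem_bot] at h1
    apply hS.ne1
    rw [Submodule.eq_bot_iff]
    intro x _
    have : ∀ A : Matrix (Fin n) (Fin n) K, A = 0 := fun A => by rw [← mul_one A, h1, mul_zero]
    exact Prod.ext (this _) (this _)
end

section
set_option linter.unusedSectionVars false
variable {K : Type*} [Field K] [CharZero K] {n : ℕ} {S0 : Submodule K (Matrix (Fin n) (Fin n) K)}
    {S1 : Submodule K (Matrix (Fin n) (Fin n) K × Matrix (Fin n) (Fin n) K)}
    {p q a b c d e s : Matrix (Fin n) (Fin n) K} {r : ℕ} {E : Fin r → Matrix (Fin n) (Fin n) K}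
    {x y : Matrix (Fin n) (Fin n) K × Matrix (Fin n) (Fin n) K}

theorem core_c (hJ : JA S0) (he : Prim S0 e) (hs : s ∈ S0) (h0 : s ≠ 0) (hes : e * s = s) (hse : s * e = 0)
    (hi : ∀ a ∈ S0, a * s ∈ S0 ∧ s * a ∈ S0) :
    ∃ c ∈ S0, s * c = e ∧ e * c + c * e = c ∧ e * (c * c) * e = 0 := by
  have hss : s * s = 0 := by nth_rewrite 2 [← hes]; rw [← mul_assoc, hse, zero_mul]
  have : ∃ c ∈ S0, (s * c).trace ≠ 0 := by
    by_contra hc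
    push Not at hc
    exact h0 (hJ.nd s hs hc)
  obtain ⟨c, hc, ht⟩ := this
  obtain ⟨γ, hγ⟩ := he.prim c hc
  obtain ⟨μ, hμ⟩ := he.prim _ (hi c hc).2
  have hsce : s * c * e = μ • e := by rw [← hμ, ← mul_assoc, hes]
  have hμ0 : μ ≠ 0 := by
    rintro rfl
    apply ht
    rw [← hes, mul_assoc, trace_mul_comm, hsce, zero_smul, trace_zero]
  have h2 : ∃ c ∈ S0, s * c = e ∧ e * c + c * e = c := by
    refine ⟨μ⁻¹ • (e * c + c * e - (2 * γ) • e), S0.smul_mem _ (S0.sub_mem (hJ.j0 e he.mem c hc) (S0.smul_mem _ he.mem)), ?_, ?_⟩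
    · rw [mul_smul_comm, mul_sub, mul_add, ← mul_assoc, hse, ← mul_assoc, hsce, mul_smul_comm, hse, zero_mul, zero_add,
        smul_zero, sub_zero, smul_smul, inv_mul_cancel₀ hμ0, one_smul]
    · rw [mul_smul_comm, smul_mul_assoc, ← smul_add]
      congr 1
      have h3 : e * (e * c + c * e - (2 * γ) • e) = e * c + γ • e - (2 * γ) • e := by
        rw [mul_sub, mul_add, ← mul_assoc, he.idem, ← mul_assoc, hγ, mul_smul_comm, he.idem]
      have h4 : (e * c + c * e - (2 * γ) • e) * e = γ • e + c * e - (2 * γ) • e := by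
        rw [sub_mul, add_mul, hγ, mul_assoc c, he.idem, smul_mul_assoc, he.idem]
      rw [h3, h4, two_mul, add_smul]
      abel
  obtain ⟨c, hc, hsc, hec⟩ := h2
  obtain ⟨l, hl⟩ := he.prim (c * c) (half_mem S0 (hJ.j0 c hc c hc) rfl)
  refine ⟨c - l • s, S0.sub_mem hc (S0.smul_mem _ hs), ?_, ?_, ?_⟩
  · rw [mul_sub, mul_smul_comm, hss, smul_zero, sub_zero, hsc]
  · rw [mul_sub, sub_mul, mul_smul_comm, smul_mul_assoc, hes, hse, smul_zero, sub_zero, sub_add_eq_add_sub, hec]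
  · have : (c - l • s) * (c - l • s) = c * c - l • (c * s) - l • (s * c) + l • l • (s * s) := by
      simp only [mul_sub, sub_mul, mul_smul_comm, smul_mul_assoc, smul_sub]; abel
    rw [this, hss, hsc, smul_zero, smul_zero, add_zero, mul_sub, mul_sub, sub_mul, sub_mul, hl, mul_smul_comm,
      mul_smul_comm, smul_mul_assoc, smul_mul_assoc, he.idem, he.idem, mul_assoc e, mul_assoc c, hse]
    simp

theorem core [IsAlgClosed K] (hJ : JA S0) (hE : PF S0 E) (o : Fin r) (hs : s ∈ S0) (h0 : s ≠ 0) (hes : E o * s = s)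
    (hse : s * E o = 0) (hi : ∀ a ∈ S0, a * s ∈ S0 ∧ s * a ∈ S0) :
    (∀ m, ∃ ν : K, E o * m * E o = ν • E o) ∧ S0 = ⊤ := by
  obtain ⟨u, hu⟩ := hE.units hJ o
  have he := hE.prim o
  have key : (∀ a ∈ S0, a * E o ∈ S0) := by
    generalize E o = e at *
    obtain ⟨c, hc, hsc, hec, hcc⟩ := core_c hJ he hs h0 hes hse hi
    have hece : e * c * e = 0 := by
      have h := congrArg (e * ·) hec
      simp only [mul_add, ← mul_assoc, he.idem] at h
      simpa using h
    have hcce : c * c * e = 0 := by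
      have : c * c * e = e * (c * c) * e + c * (e * c * e) := by
        nth_rewrite 1 [← hec]; noncomm_ring
      rw [this, hcc, hece]; simp
    have hh := (hi c hc).1
    have hce : c * e ∈ S0 := by
      have := hJ.j0 _ hh c hc
      have e1 : c * s * c + c * (c * s) = c * e := by
        rw [mul_assoc, hsc, ← hes, ← mul_assoc, ← mul_assoc, hcce, zero_mul, add_zero]
      rwa [e1] at this
    intro a ha
    obtain ⟨α, hα⟩ := he.prim a ha
    have := hJ.j0 _ (hi a ha).1 _ hce
    have e1 : a * s * (c * e) + c * e * (a * s) = a * e + α • (c * s) := by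
      have h1 : a * s * (c * e) = a * e := by
        rw [mul_assoc, ← mul_assoc s, hsc, he.idem]
      have h2 : c * e * (a * s) = α • (c * s) := by
        nth_rewrite 1 [← hes]
        rw [show c * e * (a * (e * s)) = c * (e * a * e) * s by noncomm_ring, hα, mul_smul_comm, smul_mul_assoc,
          mul_assoc, hes]
      rw [h1, h2]
    rw [e1] at this
    exact (Submodule.add_mem_iff_left _ (S0.smul_mem _ hh)).1 this
  have key2 : ∀ a ∈ S0, E o * a ∈ S0 := fun a ha => by
    have := S0.sub_mem (hJ.j0 _ he.mem a ha) (key a ha)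
    rwa [add_sub_cancel_right] at this
  have hbd : ∀ b ∈ S0, ∀ d ∈ S0, ∃ κ : K, E o * b * d * E o = κ • E o := by
    intro b hb d hd
    obtain ⟨β, hβ⟩ := he.prim b hb
    obtain ⟨δ, hδ⟩ := he.prim d hd
    obtain ⟨κ, hκ⟩ := he.prim _ (hJ.j0 _ (key2 b hb) _ (key d hd))
    refine ⟨κ - δ * β, ?_⟩
    have hid := he.idem
    generalize E o = e at *
    have : e * (e * b * (d * e) + d * e * (e * b)) * e = (e * e) * b * d * (e * e) + (e * d * e) * (e * b * e) := by
      noncomm_ring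
    rw [this, hid, hβ, hδ, smul_mul_smul_comm, hid] at hκ
    rw [sub_smul, ← hκ, add_sub_cancel_right]
  have hM : ∀ m, ∃ ν : K, E o * m * E o = ν • E o := by
    intro m
    refine lemmaM hJ hE o ?_ ?_ ?_
    · rw [← mul_assoc, ← mul_assoc, he.idem]
    · rw [mul_assoc, he.idem]
    · intro b hb d hd
      obtain ⟨κ, hκ⟩ := hbd b hb d hd
      rw [hκ, mul_smul_comm, smul_mul_assoc, mul_assoc, he.idem, ← mul_assoc, ← mul_assoc, he.idem]
  refine ⟨hM, ?_⟩
  rw [eq_top_iff]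
  intro m _
  have hij : ∀ i j, E i * m * E j ∈ S0 := by
    intro i j
    obtain ⟨ν, hν⟩ := hM (u i * m * u j)
    have e1 : E i * m * E j = u i * (E o * (u i * m * u j) * E o) * u j := by
      rw [← hu.c i, ← hu.c j]; noncomm_ring
    rw [e1, hν, mul_smul_comm, smul_mul_assoc]
    apply S0.smul_mem
    obtain ⟨κ, hκ⟩ := hbd (u j) (hu.mem j) (u i) (hu.mem i)
    have := S0.sub_mem (hJ.j0 _ (key _ (hu.mem i)) _ (key2 _ (hu.mem j))) (S0.smul_mem κ he.mem)
    rw [← hκ] at this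
    convert this using 1
    rw [show u i * E o * (E o * u j) = u i * (E o * E o) * u j by noncomm_ring, he.idem]
    noncomm_ring
  have : m = ∑ i, ∑ j, E i * m * E j := by
    calc m = (∑ i, E i) * m * ∑ j, E j := by rw [hE.sum, one_mul, mul_one]
      _ = _ := by simp only [Finset.sum_mul, Finset.mul_sum]; rw [Finset.sum_comm]
  rw [this]
  exact S0.sum_mem fun i _ => S0.sum_mem fun j _ => hij i j

def trS (S0 : Submodule K (Matrix (Fin n) (Fin n) K)) : Submodule K (Matrix (Fin n) (Fin n) K) where
  carrier := {a | aᵀ ∈ S0}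
  zero_mem' := by simp
  add_mem' := fun {a b} ha hb => by
    rw [Set.mem_setOf_eq, transpose_add]; exact S0.add_mem ha hb
  smul_mem' := fun k {a} ha => by
    rw [Set.mem_setOf_eq, transpose_smul]; exact S0.smul_mem k ha

theorem mem_trS : a ∈ trS S0 ↔ aᵀ ∈ S0 := Iff.rfl

theorem JA.tr (hJ : JA S0) : JA (trS S0) where
  j0 := fun a ha b hb => by
    rw [mem_trS, transpose_add, transpose_mul, transpose_mul, add_comm]; exact hJ.j0 _ ha _ hb
  nd := fun a ha h => by
    rw [← transpose_eq_zero]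
    refine hJ.nd _ ha fun b hb => ?_
    rw [← trace_transpose, transpose_mul, transpose_transpose, trace_mul_comm]
    exact h _ (by rwa [mem_trS, transpose_transpose])
  cent := fun q h => by
    obtain ⟨κ, hκ⟩ := hJ.cent qᵀ fun a ha => by
      have := h aᵀ (by rwa [mem_trS, transpose_transpose])
      have := congrArg transpose this
      rw [transpose_mul, transpose_mul, transpose_transpose] at this
      exact this.symm
    refine ⟨κ, ?_⟩
    rw [← transpose_transpose q, hκ]; simp
  one := by rw [mem_trS, transpose_one]; exact hJ.one

theorem PF.tr (hE : PF S0 E) : PF (trS S0) (fun i => (E i)ᵀ) where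
  prim := fun i => ⟨by rw [mem_trS, transpose_transpose]; exact (hE.prim i).mem,
    by rw [← transpose_mul, (hE.prim i).idem], fun h => (hE.prim i).ne (by simpa using h),
    fun b hb => by
      obtain ⟨μ, hμ⟩ := (hE.prim i).prim _ hb
      refine ⟨μ, ?_⟩
      rw [← transpose_smul, ← hμ, transpose_mul, transpose_mul, transpose_transpose, mul_assoc]⟩
  orth := fun i j h => by rw [← transpose_mul, hE.orth j i h.symm, transpose_zero]
  sum := by rw [← transpose_sum, hE.sum, transpose_one]

end

section
set_option linter.unusedSectionVars false
variable {K : Type*} [Field K] [CharZero K] {n : ℕ} {S0 : Submodule K (Matrix (Fin n) (Fin n) K)}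
    {S1 : Submodule K (Matrix (Fin n) (Fin n) K × Matrix (Fin n) (Fin n) K)}
    {p q a b c d e s : Matrix (Fin n) (Fin n) K} {r : ℕ} {E : Fin r → Matrix (Fin n) (Fin n) K}
    {x y : Matrix (Fin n) (Fin n) K × Matrix (Fin n) (Fin n) K}

theorem skew_zero (he : e * e = e) (hM : ∀ m, ∃ ν : K, e * m * e = ν • e) {X : Matrix (Fin n) (Fin n) K}
    (hX : eᵀ * X * e = X) (hs : Xᵀ = - X) : X = 0 := by
  have h1 : ∀ k i j l, e k i * e j l * e.trace = e k l * e j i := by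
    intro k i j l
    obtain ⟨ν, hν⟩ := hM (single i j 1)
    have h2 : ∀ k l, e k i * e j l = ν * e k l := by
      intro k l
      have := congrFun (congrFun hν k) l
      rw [mul_apply] at this
      simpa [mul_apply, single_apply, ite_and, Finset.sum_ite_eq] using this
    have h3 : e j i = ν * e.trace := by
      have h4 : e j i = ∑ k, e j k * e k i := by
        conv_lhs => rw [← he, mul_apply]
      rw [h4, trace, Finset.mul_sum]
      refine Finset.sum_congr rfl fun k _ => ?_
      rw [mul_comm, h2]; rfl
    rw [h2, h3]; ring
  have hent : ∀ i j, X i j = ∑ l, ∑ k, e k i * X k l * e l j := by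
    intro i j
    conv_lhs => rw [← hX, mul_apply]
    refine Finset.sum_congr rfl fun l _ => ?_
    rw [mul_apply, Finset.sum_mul]; rfl
  have h5 : ∀ i j, X i j * e.trace = X j i := by
    intro i j
    rw [hent i j, hent j i, Finset.sum_mul]
    refine Finset.sum_congr rfl fun l _ => ?_
    rw [Finset.sum_mul]
    refine Finset.sum_congr rfl fun k _ => ?_
    linear_combination X k l * h1 k i l j
  have h6 : ∀ i j, X j i = - X i j := fun i j => congrFun (congrFun hs i) j
  have ht : ∃ k : ℕ, e.trace = k := by
    have h1 : IsIdempotentElem (Matrix.toLin' e) := by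
      unfold IsIdempotentElem
      rw [Module.End.mul_eq_comp, ← Matrix.toLin'_mul, he]
    have := ((LinearMap.isProj_range_iff_isIdempotentElem _).2 h1).trace
    rw [Matrix.trace_toLin'_eq] at this
    exact ⟨_, this⟩
  obtain ⟨k, hk⟩ := ht
  ext i j
  have h7 : X i j * ((k : K) + 1) = 0 := by
    rw [← hk]
    linear_combination h5 i j + h6 i j
  exact (mul_eq_zero.1 h7).resolve_right (Nat.cast_add_one_ne_zero k)

theorem T_bot (hS : SimpSys S0 S1) (h1 : (1 : Matrix (Fin n) (Fin n) K) ∈ S0) (hx : x ∈ S1) (hx0 : x ≠ 0) :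
    ∃ y ∈ S1, x.1 * y.2 ≠ 0 ∨ y.1 * x.2 ≠ 0 := by
  by_contra hcon
  push Not at hcon
  let T : Submodule K (Matrix (Fin n) (Fin n) K × Matrix (Fin n) (Fin n) K) :=
    { carrier := {x | x ∈ S1 ∧ ∀ y ∈ S1, x.1 * y.2 = 0 ∧ y.1 * x.2 = 0}
      zero_mem' := ⟨S1.zero_mem, fun y _ => by simp⟩
      add_mem' := fun {a b} ha hb => ⟨S1.add_mem ha.1 hb.1, fun y hy => by
        rw [Prod.fst_add, Prod.snd_add, add_mul, mul_add, (ha.2 y hy).1, (hb.2 y hy).1, (ha.2 y hy).2, (hb.2 y hy).2]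
        simp⟩
      smul_mem' := fun k {a} ha => ⟨S1.smul_mem k ha.1, fun y hy => by
        rw [Prod.smul_fst, Prod.smul_snd, smul_mul_assoc, mul_smul_comm, (ha.2 y hy).1, (ha.2 y hy).2]
        simp⟩ }
  have hT : ∀ z, z ∈ T ↔ z ∈ S1 ∧ ∀ y ∈ S1, z.1 * y.2 = 0 ∧ y.1 * z.2 = 0 := fun z => Iff.rfl
  have hI : IsIdl S0 S1 ⊥ T := by
    refine ⟨bot_le, fun z hz => hz.1, ?_, ?_, ?_, ?_⟩
    · intro a _ b hb
      rw [(Submodule.mem_bot K).1 hb]; simp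
    · intro a ha z _
      rw [(Submodule.mem_bot K).1 ha]
      have : act 0 z = 0 := by simp [act]
      rw [this]; exact T.zero_mem
    · intro a ha z hz
      refine (hT _).2 ⟨hS.j1 a ha z hz.1, fun y hy => ?_⟩
      have h2 := hz.2 _ (hS.j1 a ha y hy)
      have h3 := hz.2 y hy
      simp only [act] at h2 ⊢
      have e1 : (a * z.1 + z.1 * aᵀ) * y.2 = a * (z.1 * y.2) - z.1 * y.2 * a + z.1 * (aᵀ * y.2 + y.2 * a) := by
        noncomm_ring
      have e2 : y.1 * (aᵀ * z.2 + z.2 * a) = (y.1 * z.2) * a - a * (y.1 * z.2) + (a * y.1 + y.1 * aᵀ) * z.2 := by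
        noncomm_ring
      rw [e1, e2, h3.1, h3.2, h2.1, h2.2]; simp
    · intro z hz w hw
      rw [br, (hw.2 z hz).1, (hw.2 z hz).2, sub_zero]; exact Submodule.zero_mem _
  rcases hS.simp _ _ hI with h | h
  · have : x ∈ T := (hT x).2 ⟨hx, hcon⟩
    rw [h.2, Submodule.mem_bot] at this
    exact hx0 this
  · have h2 : (1 : Matrix (Fin n) (Fin n) K) ∈ (⊥ : Submodule K (Matrix (Fin n) (Fin n) K)) := h.1 ▸ h1
    rw [Submodule.mem_bot] at h2
    have : ∀ A : Matrix (Fin n) (Fin n) K, A = 0 := fun A => by rw [← mul_one A, h2, mul_zero]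
    exact hx0 (Prod.ext (this _) (this _))

theorem absorb (j0 : ∀ a ∈ S0, ∀ b ∈ S0, a * b + b * a ∈ S0) {t : Matrix (Fin n) (Fin n) K} (ha : a ∈ S0) (hs : s ∈ S0)
    (h1 : a * s + t ∈ S0) (h2 : t + s * a ∈ S0) : a * s ∈ S0 ∧ s * a ∈ S0 := by
  have ht : t ∈ S0 := half_mem S0 (S0.sub_mem (S0.add_mem h1 h2) (j0 a ha s hs)) (by abel)
  exact ⟨(Submodule.add_mem_iff_left _ ht).1 h1, (Submodule.add_mem_iff_right _ ht).1 h2⟩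

theorem pcase [IsAlgClosed K] (hS : SimpSys S0 S1) (hJ : JA S0) (hE : PF S0 E) (o : Fin r)
    (hp : ∀ x, XE S1 (E o) x → x.2 = 0) (hx : XE S1 (E o) x) (hx0 : x ≠ 0) :
    S0 = ⊤ ∧ ∃ y ∈ S1, y.2 ≠ 0 := by
  have hx2 := hp x hx
  obtain ⟨y, hy, hxy⟩ := T_bot hS hJ.one hx.mem hx0
  rw [hx2] at hxy
  replace hxy : x.1 * y.2 ≠ 0 := by simpa using hxy
  refine ⟨(core (s := x.1 * y.2) hJ hE o ?_ hxy ?_ ?_ ?_).2, y, hy, fun h => hxy (by rw [h, mul_zero])⟩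
  · have := hS.j2 x hx.mem y hy
    rwa [br, hx2, mul_zero, sub_zero] at this
  · rw [← mul_assoc, hx.l1]
  · have := hp _ (XE.of hS.toSys (hE.prim o).mem (hE.prim o).idem hy)
    simp only at this
    rw [← hx.r1, mul_assoc, mul_assoc, ← mul_assoc _ y.2, this, mul_zero]
  · intro a ha
    have hs := hS.j2 x hx.mem y hy
    rw [br, hx2, mul_zero, sub_zero] at hs
    refine absorb (t := x.1 * aᵀ * y.2) hS.j0 ha hs ?_ ?_
    · have := hS.j2 _ (hS.j1 a ha x hx.mem) y hy
      simp only [br, act, hx2, mul_zero, zero_mul, add_zero, sub_zero] at this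
      rwa [← mul_assoc, ← add_mul]
    · have := hS.j2 x hx.mem _ (hS.j1 a ha y hy)
      simp only [br, act, hx2, mul_zero, sub_zero] at this
      rwa [mul_assoc, mul_assoc, ← mul_add]

theorem qcase [IsAlgClosed K] (hS : SimpSys S0 S1) (hJ : JA S0) (hE : PF S0 E) (o : Fin r)
    (hp : ∀ x, XE S1 (E o) x → x.1 = 0) (hx : XE S1 (E o) x) (hx0 : x ≠ 0) : False := by
  have hx1 := hp x hx
  obtain ⟨y, hy, hxy⟩ := T_bot hS hJ.one hx.mem hx0
  rw [hx1] at hxy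
  replace hxy : y.1 * x.2 ≠ 0 := by simpa using hxy
  have hs := hS.j2 y hy x hx.mem
  rw [br, hx1, zero_mul, sub_zero] at hs
  have hc := (core (s := (y.1 * x.2)ᵀ) hJ.tr hE.tr o (by rwa [mem_trS, transpose_transpose]) (fun h => hxy (by rwa [transpose_eq_zero] at h)) ?_ ?_ ?_).1
  · have : x.2 = 0 := by
      refine skew_zero (hE.prim o).idem (fun m => ?_) (by rw [hx.l2, hx.r2]) (hS.skew x hx.mem)
      obtain ⟨ν, hν⟩ := hc mᵀ
      refine ⟨ν, transpose_injective ?_⟩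
      rw [transpose_smul, ← hν, transpose_mul, transpose_mul, mul_assoc]
    exact hx0 (Prod.ext hx1 this)
  · rw [← transpose_mul, mul_assoc, hx.r2]
  · have := hp _ (XE.of hS.toSys (hE.prim o).mem (hE.prim o).idem hy)
    simp only at this
    rw [← transpose_mul, ← hx.l2, ← mul_assoc, ← mul_assoc, this, zero_mul, transpose_zero]
  · intro a ha
    have := absorb (t := y.1 * aᵀᵀ * x.2) hS.j0 ha hs ?_ ?_
    · rw [mem_trS, mem_trS, transpose_mul, transpose_mul _ a, transpose_transpose]
      exact this.symm
    · have := hS.j2 _ (hS.j1 _ ha y hy) x hx.mem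
      simp only [br, act, hx1, zero_mul, sub_zero] at this
      rwa [← mul_assoc, ← add_mul]
    · have := hS.j2 y hy _ (hS.j1 _ ha x hx.mem)
      simp only [br, act, hx1, mul_zero, zero_mul, add_zero, sub_zero] at this
      rwa [mul_assoc, mul_assoc, ← mul_add]

theorem main_full [IsAlgClosed K] (hS : SimpSys S0 S1)
    (cent : ∀ q : Matrix (Fin n) (Fin n) K, (∀ a ∈ S0, q * a = a * q) → ∃ κ : K, q = κ • 1) :
    S0 = ⊤ ∧ ∀ B C : Matrix (Fin n) (Fin n) K, Bᵀ = B → Cᵀ = - C → (B, C) ∈ S1 := by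
  have hJ := JA_of hS cent
  obtain ⟨r, E, hE, o, x, hx, hx0⟩ := exists_X hS hJ
  rcases XE.pure hS hJ hE o with h | h
  · exact (qcase hS hJ hE o h hx hx0).elim
  obtain ⟨htop, y, hy, hy0⟩ := pcase hS hJ hE o h hx hx0
  refine ⟨htop, ?_⟩
  have hx2 := h x hx
  have hx1 : x.1 ≠ 0 := fun h => hx0 (Prod.ext h hx2)
  have hB : ∀ B : Matrix (Fin n) (Fin n) K, Bᵀ = B → (B, (0 : Matrix (Fin n) (Fin n) K)) ∈ S1 := by
    have : ∃ p q, x.1 p q ≠ 0 := by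
      by_contra hc
      push Not at hc
      exact hx1 (Matrix.ext hc)
    obtain ⟨p, q, hpq⟩ := this
    have h1 : ∀ (i j : Fin n) (t : K), (single i j t + single j i t, (0 : Matrix (Fin n) (Fin n) K)) ∈ S1 := by
      intro i j t
      have := hS.toSys.ab (a := single i p (t * (x.1 p q)⁻¹)) (b := single j q 1) (by rw [htop]; trivial) (by rw [htop]; trivial) hx.mem
      rw [hx2] at this
      have hqp : x.1 q p = x.1 p q := congrFun (congrFun (hS.sym x hx.mem) p) q
      simp only [single_mul_mul_single, transpose_single, hqp, mul_zero, zero_mul, add_zero, mul_one, one_mul] at this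
      rwa [inv_mul_cancel_right₀ hpq, mul_comm (x.1 p q), inv_mul_cancel_right₀ hpq] at this
    intro B hB
    apply half_mem S1 (S1.sum_mem fun i (_ : i ∈ Finset.univ) => S1.sum_mem fun j (_ : j ∈ Finset.univ) => h1 i j (B i j))
    have e1 : B = ∑ i, ∑ j, single i j (B i j) := matrix_eq_sum_single B
    have e2 : B = ∑ i, ∑ j, single j i (B i j) := by
      conv_lhs => rw [e1, Finset.sum_comm]
      refine Finset.sum_congr rfl fun i _ => Finset.sum_congr rfl fun j _ => ?_
      rw [show B j i = B i j from congrFun (congrFun hB i) j]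
    refine Prod.ext ?_ ?_
    · simp only [Prod.fst_add, Prod.fst_sum, Finset.sum_add_distrib]
      rw [← e1, ← e2]
    · simp [Prod.snd_sum]
  have hC : ∀ C : Matrix (Fin n) (Fin n) K, Cᵀ = - C → ((0 : Matrix (Fin n) (Fin n) K), C) ∈ S1 := by
    have hy' : ((0 : Matrix (Fin n) (Fin n) K), y.2) ∈ S1 := by
      have := S1.sub_mem hy (hB y.1 (hS.sym y hy))
      convert this using 1
      ext1 <;> simp
    have : ∃ p q, y.2 p q ≠ 0 := by
      by_contra hc
      push Not at hc
      exact hy0 (Matrix.ext hc)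
    obtain ⟨p, q, hpq⟩ := this
    have h1 : ∀ (i j : Fin n) (t : K), ((0 : Matrix (Fin n) (Fin n) K), single i j t - single j i t) ∈ S1 := by
      intro i j t
      have := hS.toSys.ab (a := single p i (t * (y.2 p q)⁻¹)) (b := single q j 1) (by rw [htop]; trivial) (by rw [htop]; trivial) hy'
      have hqp : y.2 q p = - y.2 p q := congrFun (congrFun (hS.skew y hy) p) q
      simp only [single_mul_mul_single, transpose_single, hqp, mul_zero, zero_mul, add_zero, mul_one, one_mul, neg_mul] at this
      rwa [inv_mul_cancel_right₀ hpq, mul_comm (y.2 p q), inv_mul_cancel_right₀ hpq, ← Matrix.single_neg, ← sub_eq_add_neg] at this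
    intro B hB
    apply half_mem S1 (S1.sum_mem fun i (_ : i ∈ Finset.univ) => S1.sum_mem fun j (_ : j ∈ Finset.univ) => h1 i j (B i j))
    have e1 : B = ∑ i, ∑ j, single i j (B i j) := matrix_eq_sum_single B
    have e2 : -B = ∑ i, ∑ j, single j i (B i j) := by
      rw [← hB]
      conv_lhs => rw [matrix_eq_sum_single Bᵀ, Finset.sum_comm]
      rfl
    refine Prod.ext ?_ ?_
    · simp [Prod.fst_sum]
    · simp only [Prod.snd_add, Prod.snd_sum, Finset.sum_sub_distrib]
      rw [← e1, ← e2, sub_neg_eq_add]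
  intro B C hB' hC'
  have := S1.add_mem (hB B hB') (hC C hC')
  simpa using this
end

section
set_option linter.unusedSectionVars false
variable {K : Type*} [Field K] [CharZero K] {n : ℕ}

theorem sandwich {p r : Matrix (Fin n) (Fin n) K} (h : ∀ Y, p * Y * r + r * Y * p = 0) : p = 0 ∨ r = 0 := by
  have h1 : ∀ k i j l, p k i * r j l + r k i * p j l = 0 := by
    intro k i j l
    have := congrFun (congrFun (h (single i j 1)) k) l
    simpa [mul_apply, single_apply, ite_and, Finset.sum_ite_eq] using this
  by_contra hc
  push Not at hc
  have : ∃ k i, p k i ≠ 0 := by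
    by_contra h
    push Not at h
    exact hc.1 (Matrix.ext h)
  obtain ⟨k, i, hki⟩ := this
  have h2 : r k i = 0 := by
    have h3 : (2 : K) * p k i * r k i = 0 := by linear_combination h1 k i k i
    exact (mul_eq_zero.1 h3).resolve_left (mul_ne_zero two_ne_zero hki)
  apply hc.2
  ext j l
  have := h1 k i j l
  rw [h2, zero_mul, add_zero] at this
  exact (mul_eq_zero.1 this).resolve_left hki

theorem central_scalar {f : Matrix (Fin n) (Fin n) K} (h : ∀ X, f * X = X * f) : ∃ κ : K, f = κ • 1 := by
  obtain ⟨κ, hκ⟩ := mem_range_scalar_of_commute_single (M := f) (fun i j _ => (h _).symm)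
  refine ⟨κ, ?_⟩
  rw [← hκ, scalar_apply, smul_one_eq_diagonal]

theorem trace_zero_of {S T : Submodule K (Matrix (Fin n) (Fin n) K)} (hST : S ⊔ T = ⊤) {Y : Matrix (Fin n) (Fin n) K}
    (h1 : ∀ a ∈ S, (a * Y).trace = 0) (h2 : ∀ a ∈ T, (a * Y).trace = 0) : Y = 0 := by
  have h3 : ∀ a : Matrix (Fin n) (Fin n) K, (a * Y).trace = 0 := by
    intro a
    have : a ∈ S ⊔ T := hST ▸ Submodule.mem_top
    obtain ⟨s, hs, t, ht, rfl⟩ := Submodule.mem_sup.1 this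
    rw [add_mul, trace_add, h1 s hs, h2 t ht, add_zero]
  ext i j
  have := h3 (single j i 1)
  simpa [trace, mul_apply, single_apply, ite_and, Finset.sum_ite_eq] using this

theorem tr_comm0 {f a W : Matrix (Fin n) (Fin n) K} (h : f * a = a * f) : (a * (f * W - W * f)).trace = 0 := by
  rw [mul_sub, trace_sub, ← mul_assoc, ← mul_assoc, trace_mul_comm (a * W) f, ← mul_assoc, h, sub_self]

theorem cent_or {S T : Submodule K (Matrix (Fin n) (Fin n) K)} (hST : S ⊔ T = ⊤) {f g : Matrix (Fin n) (Fin n) K}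
    (hf : ∀ a ∈ S, f * a = a * f) (hg : ∀ a ∈ T, g * a = a * g) : (∃ κ : K, f = κ • 1) ∨ (∃ κ : K, g = κ • 1) := by
  have hfg : f * g = g * f := by
    rw [← sub_eq_zero]
    refine trace_zero_of hST (fun a ha => tr_comm0 (hf a ha)) fun a ha => ?_
    have := tr_comm0 (W := f) (hg a ha)
    rw [← neg_sub, mul_neg, trace_neg, this, neg_zero]
  have hY : ∀ X, f * (g * X - X * g) - (g * X - X * g) * f = 0 := by
    intro X
    refine trace_zero_of hST (fun a ha => tr_comm0 (hf a ha)) fun a ha => ?_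
    have e : f * (g * X - X * g) - (g * X - X * g) * f = g * (f * X - X * f) - (f * X - X * f) * g := by
      have e1 : f * (g * X - X * g) - (g * X - X * g) * f = (f * g) * X - f * X * g - g * X * f + X * (g * f) := by
        noncomm_ring
      rw [e1, hfg, ← hfg]
      nth_rewrite 1 [hfg]
      noncomm_ring
    rw [e]
    exact tr_comm0 (hg a ha)
  have h2 : ∀ X Z, (f * X - X * f) * (g * Z - Z * g) + (g * X - X * g) * (f * Z - Z * f) = 0 := by
    intro X Z
    have e : (f * X - X * f) * (g * Z - Z * g) + (g * X - X * g) * (f * Z - Z * f) =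
      (f * (g * (X * Z) - (X * Z) * g) - (g * (X * Z) - (X * Z) * g) * f) -
        (f * (g * X - X * g) - (g * X - X * g) * f) * Z - X * (f * (g * Z - Z * g) - (g * Z - Z * g) * f) := by
      noncomm_ring
    rw [e, hY, hY, hY]; simp
  have h3 : ∀ X Y, (f * X - X * f) * Y * (g * X - X * g) + (g * X - X * g) * Y * (f * X - X * f) = 0 := by
    intro X Y
    have e : (f * X - X * f) * Y * (g * X - X * g) + (g * X - X * g) * Y * (f * X - X * f) =
      ((f * (X * Y) - (X * Y) * f) * (g * X - X * g) + (g * (X * Y) - (X * Y) * g) * (f * X - X * f)) -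
      X * ((f * Y - Y * f) * (g * X - X * g) + (g * Y - Y * g) * (f * X - X * f)) := by
      noncomm_ring
    rw [e, h2, h2]; simp
  have h4 : ∀ X, f * X - X * f = 0 ∨ g * X - X * g = 0 := fun X => sandwich (h3 X)
  by_cases h5 : ∀ X, f * X = X * f
  · exact Or.inl (central_scalar h5)
  right
  push Not at h5
  obtain ⟨X, hX⟩ := h5
  apply central_scalar
  intro Z
  have hgX := (h4 X).resolve_left (sub_ne_zero.2 hX)
  rw [← sub_eq_zero]
  rcases h4 Z with h | h
  · rcases h4 (X + Z) with h' | h'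
    · exfalso
      apply hX
      rw [← sub_eq_zero, ← h', mul_add, add_mul, add_sub_add_comm, h, add_zero]
    · rwa [mul_add, add_mul, add_sub_add_comm, hgX, zero_add] at h'
  · exact h
end

section
set_option linter.unusedSectionVars false
variable {K : Type*} [Field K] [CharZero K] {n : ℕ}

def evL : Matrix (Fin n) (Fin n) K →ₗ[K] MJ K n n where
  toFun a := fromBlocks a 0 0 aᵀ
  map_add' a b := by rw [fromBlocks_add]; simp
  map_smul' k a := by rw [RingHom.id_apply, fromBlocks_smul]; simp

def odL : (Matrix (Fin n) (Fin n) K × Matrix (Fin n) (Fin n) K) →ₗ[K] MJ K n n where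
  toFun x := fromBlocks 0 x.1 x.2 0
  map_add' a b := by rw [fromBlocks_add]; simp
  map_smul' k a := by rw [RingHom.id_apply, fromBlocks_smul]; simp

theorem sum_eq (a : Matrix (Fin n) (Fin n) K) (x : Matrix (Fin n) (Fin n) K × Matrix (Fin n) (Fin n) K) :
    evL a + odL x = fromBlocks a x.1 x.2 aᵀ := by
  change fromBlocks a 0 0 aᵀ + fromBlocks 0 x.1 x.2 0 = _
  rw [fromBlocks_add]; simp

theorem sum_inj {a b : Matrix (Fin n) (Fin n) K} {x y : Matrix (Fin n) (Fin n) K × Matrix (Fin n) (Fin n) K}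
    (h : evL a + odL x = evL b + odL y) : a = b ∧ x = y := by
  rw [sum_eq, sum_eq, fromBlocks_inj] at h
  exact ⟨h.1, Prod.ext h.2.1 h.2.2.1⟩

theorem odd_eq (a : Matrix (Fin n) (Fin n) K) (x : Matrix (Fin n) (Fin n) K × Matrix (Fin n) (Fin n) K) :
    oddPart K (evL a + odL x) = odL x := by
  rw [sum_eq]
  ext (i | i) (j | j) <;> simp [oddPart, pty, odL]

theorem jm (a b : Matrix (Fin n) (Fin n) K) (x y : Matrix (Fin n) (Fin n) K × Matrix (Fin n) (Fin n) K)
    (hx : x.1ᵀ = x.1 ∧ x.2ᵀ = - x.2) (hy : y.1ᵀ = y.1 ∧ y.2ᵀ = - y.2) :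
    jmul (evL a + odL x) (evL b + odL y) =
      (2 : K)⁻¹ • (evL (a * b + b * a + br x y) + odL (act a y + act b x)) := by
  have h2 : odL y * odL x = (2 : K)⁻¹ • (odL y * odL x + odL y * odL x) := by
    rw [← two_smul K, smul_smul, inv_mul_cancel₀ two_ne_zero, one_smul]
  rw [jmul, odd_eq, odd_eq, h2, ← smul_sub]
  congr 1
  rw [sum_eq, sum_eq, sum_eq]
  change _ - (fromBlocks 0 y.1 y.2 0 * fromBlocks 0 x.1 x.2 0 + fromBlocks 0 y.1 y.2 0 * fromBlocks 0 x.1 x.2 0) = _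
  rw [fromBlocks_multiply, fromBlocks_multiply, fromBlocks_multiply, fromBlocks_add, fromBlocks_add, sub_eq_add_neg,
    fromBlocks_neg, fromBlocks_add, fromBlocks_inj]
  simp only [br, act, transpose_add, transpose_sub, transpose_mul, hx.1, hx.2, hy.1, hy.2, Prod.fst_add, Prod.snd_add]
  refine ⟨?_, ?_, ?_, ?_⟩ <;> noncomm_ring

theorem mem_P {z : MJ K n n} : z ∈ PSub K n ↔ ∃ a x, z = evL a + odL x ∧ x.1ᵀ = x.1 ∧ x.2ᵀ = - x.2 := by
  constructor
  · intro h
    refine ⟨z.toBlocks₁₁, (z.toBlocks₁₂, z.toBlocks₂₁), ?_, ?_, ?_⟩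
    · rw [sum_eq]
      ext (i | i) (j | j) <;> simp [toBlocks₁₁, toBlocks₁₂, toBlocks₂₁]
      exact h.1 i j
    · ext i j
      exact h.2.1 j i
    · ext i j
      exact h.2.2 j i
  · rintro ⟨a, x, rfl, h1, h2⟩
    rw [sum_eq]
    refine ⟨fun i j => rfl, fun i j => ?_, fun i j => ?_⟩
    · exact congrFun (congrFun h1 j) i
    · exact congrFun (congrFun h2 j) i

theorem ev_mem (a : Matrix (Fin n) (Fin n) K) : evL a ∈ evenSub K n n := by
  rintro (i | i) (j | j) h
  · exact absurd rfl h
  · rfl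
  · rfl
  · exact absurd rfl h

theorem od_mem (x : Matrix (Fin n) (Fin n) K × Matrix (Fin n) (Fin n) K) : odL x ∈ oddSub K n n := by
  rintro (i | i) (j | j) h
  · rfl
  · exact absurd h (by simp [pty])
  · exact absurd h (by simp [pty])
  · rfl

theorem of_ev {z : MJ K n n} (hz : z ∈ PSub K n) (h : z ∈ evenSub K n n) : ∃ a, z = evL a := by
  obtain ⟨a, x, rfl, -, -⟩ := mem_P.1 hz
  have h1 : x = 0 := by
    rw [sum_eq] at h
    refine Prod.ext (Matrix.ext fun i j => ?_) (Matrix.ext fun i j => ?_)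
    · exact h (Sum.inl i) (Sum.inr j) (by simp [pty])
    · exact h (Sum.inr i) (Sum.inl j) (by simp [pty])
  exact ⟨a, by rw [h1, map_zero, add_zero]⟩

theorem of_od {z : MJ K n n} (hz : z ∈ PSub K n) (h : z ∈ oddSub K n n) :
    ∃ x, z = odL x ∧ x.1ᵀ = x.1 ∧ x.2ᵀ = - x.2 := by
  obtain ⟨a, x, rfl, h2, h3⟩ := mem_P.1 hz
  have h1 : a = 0 := by
    rw [sum_eq] at h
    refine Matrix.ext fun i j => ?_
    exact h (Sum.inl i) (Sum.inl j) rfl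
  exact ⟨x, by rw [h1, map_zero, zero_add], h2, h3⟩

theorem graded_dec {A : Submodule K (MJ K n n)} (hA : A ≤ PSub K n) (hg : IsGraded K A) {z : MJ K n n} (hz : z ∈ A) :
    ∃ a x, z = evL a + odL x ∧ evL a ∈ A ∧ odL x ∈ A := by
  unfold IsGraded IsGradedG at hg
  have hz' := hz
  rw [hg] at hz'
  obtain ⟨z0, h0, z1, h1, rfl⟩ := Submodule.mem_sup.1 hz'
  obtain ⟨a, rfl⟩ := of_ev (hA h0.1) h0.2
  obtain ⟨x, rfl, -, -⟩ := of_od (hA h1.1) h1.2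
  exact ⟨a, x, rfl, h0.1, h1.1⟩

theorem odL_sym {A : Submodule K (MJ K n n)} (hA : A ≤ PSub K n)
    {x : Matrix (Fin n) (Fin n) K × Matrix (Fin n) (Fin n) K} (hx : odL x ∈ A) : x.1ᵀ = x.1 ∧ x.2ᵀ = - x.2 := by
  obtain ⟨b, y, h, h1⟩ := mem_P.1 (hA hx)
  have : evL 0 + odL x = evL b + odL y := by rw [map_zero, zero_add, h]
  rw [(sum_inj this).2]
  exact h1

theorem simpSys_of {A : Submodule K (MJ K n n)} (hA : A ≤ PSub K n) (hs : IsSubalg K A) (hn : Nontriv K A)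
    (hsi : IsSimple K A) : SimpSys (A.comap evL) (A.comap odL) := by
  have two : ∀ {V : Type _} [AddCommGroup V] [Module K V] (S : Submodule K V) (v : V), (2 : K)⁻¹ • v ∈ S → v ∈ S := by
    intro V _ _ S v h
    have := S.smul_mem (2 : K) h
    rwa [smul_smul, mul_inv_cancel₀ two_ne_zero, one_smul] at this
  refine ⟨⟨?_, ?_, ?_⟩, fun x hx => (odL_sym hA hx).1, fun x hx => (odL_sym hA hx).2, ?_, ?_, ?_⟩
  · intro a ha b hb
    have h := hs.2 _ ha _ hb
    have e := jm a b 0 0 (by simp) (by simp)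
    simp only [map_zero, add_zero] at e
    rw [e] at h
    have h := two _ _ h
    have e2 : ∀ a : Matrix (Fin n) (Fin n) K, act a 0 = 0 := fun a => by simp [act]
    simpa [br, e2] using h
  · intro a ha x hx
    have h := hs.2 _ ha _ hx
    have e := jm a 0 0 x (by simp) (odL_sym hA hx)
    simp only [map_zero, add_zero, zero_add] at e
    rw [e] at h
    have h := two _ _ h
    have e2 : act 0 (0 : Matrix (Fin n) (Fin n) K × Matrix (Fin n) (Fin n) K) = 0 := by simp [act]
    simpa [br, e2] using h
  · intro x hx y hy
    have h := hs.2 _ hx _ hy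
    have e := jm 0 0 x y (odL_sym hA hx) (odL_sym hA hy)
    simp only [map_zero, add_zero, zero_add] at e
    rw [e] at h
    have h := two _ _ h
    have e2 : ∀ x : Matrix (Fin n) (Fin n) K × Matrix (Fin n) (Fin n) K, act 0 x = 0 := by simp [act]
    simpa [br, e2] using h
  · intro h
    apply hn
    rw [Submodule.eq_bot_iff]
    rintro z ⟨hz, hz'⟩
    obtain ⟨x, rfl, -⟩ := of_od (hA hz) hz'
    have : x ∈ A.comap odL := hz
    rw [h, Submodule.mem_bot] at this
    rw [this, map_zero]
  · rintro ⟨h1, h2, h3⟩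
    obtain ⟨z, hz, w, hw, h⟩ := hsi.1
    apply h
    obtain ⟨a, x, rfl, ha, hx⟩ := graded_dec hA hs.1 hz
    obtain ⟨b, y, rfl, hb, hy⟩ := graded_dec hA hs.1 hw
    rw [jm a b x y (odL_sym hA hx) (odL_sym hA hy), h1 a ha b hb, h2 a ha y hy, h2 b hb x hx, h3 x hx y hy]
    simp
  · intro I0 I1 hI
    have key : ∀ z, z ∈ I0.map evL ⊔ I1.map odL ↔ ∃ b ∈ I0, ∃ y ∈ I1, z = evL b + odL y := by
      intro z
      rw [Submodule.mem_sup]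
      constructor
      · rintro ⟨_, ⟨b, hb, rfl⟩, _, ⟨y, hy, rfl⟩, rfl⟩
        exact ⟨b, hb, y, hy, rfl⟩
      · rintro ⟨b, hb, y, hy, rfl⟩
        exact ⟨_, ⟨b, hb, rfl⟩, _, ⟨y, hy, rfl⟩, rfl⟩
    have hk := hsi.2 (I0.map evL ⊔ I1.map odL) ?_ ?_ ?_
    · rcases hk with h | h
      · left
        rw [sup_eq_bot_iff, Submodule.eq_bot_iff, Submodule.eq_bot_iff] at h
        rw [Submodule.eq_bot_iff, Submodule.eq_bot_iff]
        constructor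
        · intro a ha
          refine (sum_inj (a := a) (b := 0) (x := 0) (y := 0) ?_).1
          rw [h.1 _ ⟨a, ha, rfl⟩, map_zero, map_zero]
        · intro x hx
          refine (sum_inj (a := 0) (b := 0) (x := x) (y := 0) ?_).2
          rw [h.2 _ ⟨x, hx, rfl⟩, map_zero, map_zero]
      · right
        refine ⟨le_antisymm hI.le0 fun a ha => ?_, le_antisymm hI.le1 fun x hx => ?_⟩
        · have : evL a ∈ A := ha
          rw [← h, key] at this
          obtain ⟨b, hb, y, hy, e⟩ := this
          have e2 : evL a + odL 0 = evL b + odL y := by rw [map_zero, add_zero, e]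
          rw [(sum_inj e2).1]; exact hb
        · have : odL x ∈ A := hx
          rw [← h, key] at this
          obtain ⟨b, hb, y, hy, e⟩ := this
          have e2 : evL 0 + odL x = evL b + odL y := by rw [map_zero, zero_add, e]
          rw [(sum_inj e2).2]; exact hy
    · rw [sup_le_iff, Submodule.map_le_iff_le_comap, Submodule.map_le_iff_le_comap]
      exact ⟨hI.le0, hI.le1⟩
    · apply le_antisymm
      · apply sup_le_sup
        · refine le_inf le_sup_left ?_
          rintro _ ⟨a, _, rfl⟩
          exact ev_mem a
        · refine le_inf le_sup_right ?_
          rintro _ ⟨a, _, rfl⟩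
          exact od_mem a
      · exact sup_le inf_le_left inf_le_left
    · intro z hz w hw
      obtain ⟨a, x, rfl, ha, hx⟩ := graded_dec hA hs.1 hz
      obtain ⟨b, hb, y, hy, rfl⟩ := (key w).1 hw
      rw [jm a b x y (odL_sym hA hx) (odL_sym hA (hI.le1 hy))]
      apply Submodule.smul_mem
      exact (key _).2 ⟨_, I0.add_mem (hI.c00 a ha b hb) (hI.c11 x hx y hy), _,
        I1.add_mem (hI.c10 a ha y hy) (hI.c01 b hb x hx), rfl⟩

theorem exists_cent [IsAlgClosed K] {A : Submodule K (MJ K n n)} (hA : A ≤ PSub K n) (hs : IsSubalg K A) (hn : Nontriv K A)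
    (hsi : IsSimple K A) (hp : A ≠ PSub K n) :
    ∃ q, (∀ a ∈ A.comap evL, q * a = a * q) ∧ ¬ ∃ κ : K, q = κ • 1 := by
  by_contra hc
  push Not at hc
  obtain ⟨h1, h2⟩ := main_full (simpSys_of hA hs hn hsi) hc
  apply hp
  refine le_antisymm hA fun z hz => ?_
  obtain ⟨a, x, rfl, h3, h4⟩ := mem_P.1 hz
  have ha : a ∈ A.comap evL := by rw [h1]; trivial
  exact A.add_mem ha (h2 x.1 x.2 h3 h4)

theorem final_P [IsAlgClosed K] : ¬ ∃ A B : Submodule K (MJ K n n),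
        A ≤ PSub K n ∧ B ≤ PSub K n ∧
        IsSubalg K A ∧ IsSubalg K B ∧
        A ≠ PSub K n ∧ B ≠ PSub K n ∧
        Nontriv K A ∧ Nontriv K B ∧
        IsSimple K A ∧ IsSimple K B ∧
        A ⊔ B = PSub K n := by
  rintro ⟨A, B, hA, hB, sA, sB, pA, pB, nA, nB, iA, iB, hAB⟩
  obtain ⟨f, hf, hf'⟩ := exists_cent hA sA nA iA pA
  obtain ⟨g, hg, hg'⟩ := exists_cent hB sB nB iB pB
  have hST : A.comap evL ⊔ B.comap evL = ⊤ := by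
    rw [eq_top_iff]
    intro a _
    have : evL a ∈ A ⊔ B := by
      rw [hAB, mem_P]
      exact ⟨a, 0, by simp, by simp, by simp⟩
    obtain ⟨z, hz, w, hw, e⟩ := Submodule.mem_sup.1 this
    obtain ⟨b, x, rfl, hb, -⟩ := graded_dec hA sA.1 hz
    obtain ⟨c, y, rfl, hc, -⟩ := graded_dec hB sB.1 hw
    have e2 : evL (b + c) + odL (x + y) = evL a + odL 0 := by
      rw [map_zero, add_zero, ← e, map_add, map_add]; abel
    rw [← (sum_inj e2).1]
    exact Submodule.add_mem_sup hb hc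
  rcases cent_or hST hf hg with h | h
  · exact hf' h
  · exact hg' h
end


/-- for `F` algebraically closed of characteristic zero and `n ≥ 2`, the
Jordan superalgebra `P(n)` cannot be written as `A + B` for two proper nontrivial simple
subsuperalgebras `A` and `B`. -/
theorem no_simple_decomposition_P
    (F : Type*) [Field F] [IsAlgClosed F] [CharZero F]
    (n : ℕ) (hn : 2 ≤ n) :
    ¬ ∃ A B : Submodule F (MJ F n n),
        A ≤ PSub F n ∧ B ≤ PSub F n ∧
        IsSubalg F A ∧ IsSubalg F B ∧
        A ≠ PSub F n ∧ B ≠ PSub F n ∧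
        Nontriv F A ∧ Nontriv F B ∧
        IsSimple F A ∧ IsSimple F B ∧
        A ⊔ B = PSub F n := by
  exact final_P

end SJ
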